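/- For the residue sequence: in the cyclotomic KLR algebra R^Λ_n over Z, an idempotent e(i) for i ∈ I^n is nonzero if and only if i is the residue sequence of some standard λ-tableau for some multipartition λ ∈ P^Λ_n. -/

import Mathlib

namespace Paper

/-! ## The Khovanov–Lauda–Rouquier (quiver Hecke) algebra of type `Γ_e` over ℤ -/

/-- generators of the KLR algebra `R_n` of type `Γ_e`:
idempotents `e(i)` for `i ∈ I^n` (`I = ℤ/eℤ`), dots `y_1,…,y_n` and
crossings `ψ_1,…,ψ_{n-1}`. -/
inductive Gen (e n : ℕ) : Type
  | idem : (Fin n → ZMod e) → Gen e n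
  | dot : Fin n → Gen e n
  | cross : Fin (n - 1) → Gen e n

/-- the free algebra on the KLR generators. -/
abbrev F (e n : ℕ) := FreeAlgebra ℤ (Gen e n)

def fe {e n : ℕ} (i : Fin n → ZMod e) : F e n := FreeAlgebra.ι ℤ (Gen.idem i)
def fy {e n : ℕ} (r : Fin n) : F e n := FreeAlgebra.ι ℤ (Gen.dot r)
def fpsi {e n : ℕ} (r : Fin (n - 1)) : F e n := FreeAlgebra.ι ℤ (Gen.cross r)

/-- the index `r` of `ψ_r` as an element of `{1,…,n}` (0-based: position `r`). -/
def lo {n : ℕ} (r : Fin (n - 1)) : Fin n := ⟨r.1, by have := r.2; omega⟩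
/-- the index `r+1`. -/
def hi {n : ℕ} (r : Fin (n - 1)) : Fin n := ⟨r.1 + 1, by have := r.2; omega⟩

/-- the action of the simple transposition `s_r` on a residue sequence. -/
def swapIdx {e n : ℕ} (r : Fin (n - 1)) (i : Fin n → ZMod e) : Fin n → ZMod e :=
  i ∘ Equiv.swap (lo r) (hi r)

/-- the defining relations of the KLR algebra of type `Γ_e`
(Khovanov–Lauda, Rouquier).  The relation `∑_{i ∈ I^n} e(i) = 1` is imposed whenever
`I^n` is a finite set (i.e. `e ≠ 0`), via an arbitrary finset containing all of `I^n`. -/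
inductive Rel (e n : ℕ) : F e n → F e n → Prop
  | idem_mul (i j : Fin n → ZMod e) :
      Rel e n (fe i * fe j) (if i = j then fe i else 0)
  | idem_sum (S : Finset (Fin n → ZMod e)) (hS : ∀ i, i ∈ S) :
      Rel e n (∑ i ∈ S, fe i) 1
  | dot_idem (k : Fin n) (i : Fin n → ZMod e) :
      Rel e n (fy k * fe i) (fe i * fy k)
  | cross_idem (r : Fin (n - 1)) (i : Fin n → ZMod e) :
      Rel e n (fpsi r * fe i) (fe (swapIdx r i) * fpsi r)
  | dot_dot (k m : Fin n) : Rel e n (fy k * fy m) (fy m * fy k)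
  | cross_dot (r : Fin (n - 1)) (k : Fin n) (h1 : k ≠ lo r) (h2 : k ≠ hi r) :
      Rel e n (fpsi r * fy k) (fy k * fpsi r)
  | cross_cross (r t : Fin (n - 1)) (h : r.1 + 1 < t.1 ∨ t.1 + 1 < r.1) :
      Rel e n (fpsi r * fpsi t) (fpsi t * fpsi r)
  | cross_dot_hi (r : Fin (n - 1)) (i : Fin n → ZMod e) :
      Rel e n (fpsi r * fy (hi r) * fe i)
        ((fy (lo r) * fpsi r + if i (lo r) = i (hi r) then 1 else 0) * fe i)
  | dot_cross (r : Fin (n - 1)) (i : Fin n → ZMod e) :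
      Rel e n (fy (hi r) * fpsi r * fe i)
        ((fpsi r * fy (lo r) + if i (lo r) = i (hi r) then 1 else 0) * fe i)
  | cross_sq_eq (r : Fin (n - 1)) (i : Fin n → ZMod e) (h : i (lo r) = i (hi r)) :
      Rel e n (fpsi r * fpsi r * fe i) 0
  | cross_sq_far (r : Fin (n - 1)) (i : Fin n → ZMod e) (h1 : i (lo r) ≠ i (hi r))
      (h2 : i (hi r) ≠ i (lo r) + 1) (h3 : i (hi r) ≠ i (lo r) - 1) :
      Rel e n (fpsi r * fpsi r * fe i) (fe i)
  | cross_sq_up (r : Fin (n - 1)) (i : Fin n → ZMod e) (he : e ≠ 2)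
      (h : i (hi r) = i (lo r) + 1) :
      Rel e n (fpsi r * fpsi r * fe i) ((fy (hi r) - fy (lo r)) * fe i)
  | cross_sq_down (r : Fin (n - 1)) (i : Fin n → ZMod e) (he : e ≠ 2)
      (h : i (hi r) = i (lo r) - 1) :
      Rel e n (fpsi r * fpsi r * fe i) ((fy (lo r) - fy (hi r)) * fe i)
  | cross_sq_two (r : Fin (n - 1)) (i : Fin n → ZMod e) (he : e = 2)
      (h : i (hi r) = i (lo r) + 1) :
      Rel e n (fpsi r * fpsi r * fe i)
        ((fy (hi r) - fy (lo r)) * (fy (lo r) - fy (hi r)) * fe i)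
  | braid_other (r t : Fin (n - 1)) (ht : t.1 = r.1 + 1) (i : Fin n → ZMod e)
      (h : ¬ (i (hi t) = i (lo r) ∧ (i (hi r) = i (lo r) + 1 ∨ i (hi r) = i (lo r) - 1))) :
      Rel e n (fpsi r * fpsi t * fpsi r * fe i) (fpsi t * fpsi r * fpsi t * fe i)
  | braid_plus (r t : Fin (n - 1)) (ht : t.1 = r.1 + 1) (i : Fin n → ZMod e)
      (he : e ≠ 2) (h1 : i (hi t) = i (lo r)) (h2 : i (hi r) = i (lo r) + 1) :
      Rel e n (fpsi r * fpsi t * fpsi r * fe i) ((fpsi t * fpsi r * fpsi t + 1) * fe i)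
  | braid_minus (r t : Fin (n - 1)) (ht : t.1 = r.1 + 1) (i : Fin n → ZMod e)
      (he : e ≠ 2) (h1 : i (hi t) = i (lo r)) (h2 : i (hi r) = i (lo r) - 1) :
      Rel e n (fpsi r * fpsi t * fpsi r * fe i) ((fpsi t * fpsi r * fpsi t - 1) * fe i)
  | braid_two (r t : Fin (n - 1)) (ht : t.1 = r.1 + 1) (i : Fin n → ZMod e)
      (he : e = 2) (h1 : i (hi t) = i (lo r)) (h2 : i (hi r) = i (lo r) + 1) :
      Rel e n (fpsi r * fpsi t * fpsi r * fe i)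
        ((fpsi t * fpsi r * fpsi t + fy (lo r) - 2 * fy (hi r) + fy (hi t)) * fe i)

/-- the KLR (quiver Hecke) algebra `R_n` of type `Γ_e` over ℤ. -/
abbrev KLR (e n : ℕ) := RingQuot (Rel e n)

/-- the idempotent generator `e(i)` of `R_n`. -/
noncomputable def ae (e n : ℕ) (i : Fin n → ZMod e) : KLR e n :=
  RingQuot.mkRingHom (Rel e n) (fe i)
/-- the dot generator `y_r` of `R_n` (0-based index: `ay e n ⟨r-1,_⟩` is `y_r`). -/
noncomputable def ay (e n : ℕ) (r : Fin n) : KLR e n :=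
  RingQuot.mkRingHom (Rel e n) (fy r)
/-- the crossing generator `ψ_r` of `R_n` (0-based index). -/
noncomputable def apsi (e n : ℕ) (r : Fin (n - 1)) : KLR e n :=
  RingQuot.mkRingHom (Rel e n) (fpsi r)

end Paper
namespace Paper

/-- the cyclotomic relations: `e(i) y_1^{(Λ,α_{i_1})} = 0`, where the dominant weight `Λ`
is recorded as the finitely supported function `I → ℕ`, `i ↦ (Λ, α_i)`. -/
inductive CRel (e n : ℕ) (Λ : ZMod e →₀ ℕ) : KLR e n → KLR e n → Prop
  | cyc (i : Fin n → ZMod e) (h : 0 < n) :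
      CRel e n Λ (ae e n i * ay e n (⟨0, h⟩ : Fin n) ^ Λ (i ⟨0, h⟩)) 0

/-- the cyclotomic KLR algebra `R_n^Λ` of type `Γ_e` over ℤ. -/
abbrev CKLR (e n : ℕ) (Λ : ZMod e →₀ ℕ) := RingQuot (CRel e n Λ)

noncomputable def ce (e n : ℕ) (Λ : ZMod e →₀ ℕ) (i : Fin n → ZMod e) : CKLR e n Λ :=
  RingQuot.mkRingHom (CRel e n Λ) (ae e n i)
noncomputable def cy (e n : ℕ) (Λ : ZMod e →₀ ℕ) (r : Fin n) : CKLR e n Λ :=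
  RingQuot.mkRingHom (CRel e n Λ) (ay e n r)
noncomputable def cpsi (e n : ℕ) (Λ : ZMod e →₀ ℕ) (r : Fin (n - 1)) : CKLR e n Λ :=
  RingQuot.mkRingHom (CRel e n Λ) (apsi e n r)

end Paper
noncomputable section
open scoped Classical
namespace Paper

/-! ## Multipartitions and tableaux

A node is a triple (component, row, column), all 0-based.  A multicomposition of level
`l` is a function `Fin l → ℕ → ℕ` (component ↦ row ↦ row length).  Tableaux take values
in `{1,…,n}` (and `0` outside the diagram). -/

abbrev Node (l : ℕ) := Fin l × ℕ × ℕ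

/-- the Young diagram of a multicomposition. -/
def diag (l : ℕ) (lam : Fin l → ℕ → ℕ) : Set (Node l) :=
  {x | x.2.2 < lam x.1 x.2.1}

/-- `lam` is a multipartition of `n` (of level `l`). -/
def IsMultipartition (l n : ℕ) (lam : Fin l → ℕ → ℕ) : Prop :=
  (∀ c : Fin l, Antitone (lam c)) ∧ (∀ (c : Fin l) (r : ℕ), lam c r ≠ 0 → r < n) ∧
    (∑ c : Fin l, ∑ r ∈ Finset.range n, lam c r) = n

/-- the size of the `c`-th component of `lam` (whose rows are supported in `[0,n)`). -/
def compSize (l n : ℕ) (lam : Fin l → ℕ → ℕ) (c : Fin l) : ℕ :=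
  ∑ r ∈ Finset.range n, lam c r

/-- a `lam`-tableau: a bijection from the diagram of `lam` onto `{1,…,n}`,
normalised to vanish off the diagram. -/
def IsTableau (l n : ℕ) (lam : Fin l → ℕ → ℕ) (T : Node l → ℕ) : Prop :=
  Set.BijOn T (diag l lam) (Set.Icc 1 n) ∧ ∀ x, x ∉ diag l lam → T x = 0

/-- entries increase along rows and down columns. -/
def RowColIncreasing (l : ℕ) (lam : Fin l → ℕ → ℕ) (T : Node l → ℕ) : Prop :=
  (∀ (c : Fin l) (r j : ℕ), j + 1 < lam c r → T (c, r, j) < T (c, r, j + 1)) ∧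
  (∀ (c : Fin l) (r j : ℕ), j < lam c (r + 1) → T (c, r, j) < T (c, r + 1, j))

/-- `T` is a standard `lam`-tableau (in particular `lam` is a multipartition of `n`). -/
def IsStdTab (l n : ℕ) (lam : Fin l → ℕ → ℕ) (T : Node l → ℕ) : Prop :=
  IsMultipartition l n lam ∧ IsTableau l n lam T ∧ RowColIncreasing l lam T

/-- the initial tableau `t^λ`, filling `1,2,…,n` along the rows of the first component,
then the second component, and so on; it is the unique dominance-greatest standard
`λ`-tableau. -/
def initTab (l n : ℕ) (lam : Fin l → ℕ → ℕ) : Node l → ℕ := fun x =>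
  if x.2.2 < lam x.1 x.2.1 then
    (∑ c ∈ Finset.univ.filter (fun c : Fin l => c < x.1), compSize l n lam c) +
      (∑ r ∈ Finset.range x.2.1, lam x.1 r) + x.2.2 + 1
  else 0

/-- the shape of `T|_k`, the subtableau of entries `≤ k`. -/
def restShape (l : ℕ) (lam : Fin l → ℕ → ℕ) (T : Node l → ℕ) (k : ℕ) :
    Fin l → ℕ → ℕ :=
  fun c r => ((Finset.range (lam c r)).filter fun j => T (c, r, j) ≤ k).card

/-- the partial sum `∑_{c' < c} |λ^{(c')}| + ∑_{r < k} λ^{(c)}_r` used to define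
the dominance order. -/
def partialSum (l n : ℕ) (lam : Fin l → ℕ → ℕ) (c : Fin l) (k : ℕ) : ℕ :=
  (∑ c' ∈ Finset.univ.filter (fun c' : Fin l => c' < c), compSize l n lam c') +
    ∑ r ∈ Finset.range k, lam c r

/-- the dominance order `lam ⊵ mu` on multicompositions of the same level. -/
def ShapeDom (l n : ℕ) (lam mu : Fin l → ℕ → ℕ) : Prop :=
  ∀ (c : Fin l) (k : ℕ), partialSum l n mu c k ≤ partialSum l n lam c k

/-- the dominance order `S ⊵ T` on `λ`-tableaux: `Shape(S|_k) ⊵ Shape(T|_k)` for all `k`. -/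
def TabDom (l n : ℕ) (lam : Fin l → ℕ → ℕ) (S T : Node l → ℕ) : Prop :=
  ∀ k : ℕ, ShapeDom l n (restShape l lam S k) (restShape l lam T k)

/-- the adjacent transposition `s_r = (r, r+1)` on entries. -/
def sw (r : ℕ) : Equiv.Perm ℕ := Equiv.swap r (r + 1)

/-- the (right) action of a permutation of the entries on a tableau:
`(T·w)(x) = (T x)·w`. -/
def actT (l : ℕ) (T : Node l → ℕ) (w : Equiv.Perm ℕ) : Node l → ℕ := fun x => w (T x)

/-- the action of a word `s_{r_1} s_{r_2} ⋯ s_{r_m}` (leftmost letter acting first). -/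
def actWord (l : ℕ) (T : Node l → ℕ) (L : List ℕ) : Node l → ℕ :=
  L.foldl (fun U r => actT l U (sw r)) T

/-! ### The standard expression of `d(t)`

For a standard `λ`-tableau `t` let `t^{(i)}` be the tableau agreeing with `t` on the
entries `≥ i` and equal to the initial tableau of its shape on the entries `< i`;
then `t^{(i+1)} w_i = t^{(i)}` with `w_i = s_{a_i} s_{a_i + 1} ⋯ s_{i-1}` (or `w_i = 1`),
where `a_i` is the entry of `t^{(i+1)}` at the node of `t` containing `i`, and the
standard expression of `d(t)` is the concatenated word `w_n w_{n-1} ⋯ w_1`. -/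

/-- the interpolating tableau `t^{(i)}`. -/
def interT (l n : ℕ) (lam : Fin l → ℕ → ℕ) (T : Node l → ℕ) (i : ℕ) : Node l → ℕ :=
  fun x => if i ≤ T x then T x else initTab l n (restShape l lam T (i - 1)) x

/-- the entry `a_i` of `t^{(i+1)}` at the node of `t` containing `i`
(junk value `i`, giving the empty word, if there is no such node). -/
def aEntry (l n : ℕ) (lam : Fin l → ℕ → ℕ) (T : Node l → ℕ) (i : ℕ) : ℕ :=
  if h : ∃ x, x ∈ diag l lam ∧ T x = i then interT l n lam T (i + 1) h.choose else i

/-- the word `[a_i, a_i + 1, …, i-1]` of `w_i`. -/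
def wordAt (l n : ℕ) (lam : Fin l → ℕ → ℕ) (T : Node l → ℕ) (i : ℕ) : List ℕ :=
  List.range' (aEntry l n lam T i) (i - aEntry l n lam T i)

/-- the standard expression of `d(t)`, as the word `w_n w_{n-1} ⋯ w_1` read left to
right (leftmost letter first). -/
def stdWord (l n : ℕ) (lam : Fin l → ℕ → ℕ) (T : Node l → ℕ) : List ℕ :=
  ((List.range (n + 1)).reverse.map (wordAt l n lam T)).flatten

end Paper
end
noncomputable section
open scoped Classical
namespace Paper

/-! ## Residues, addable nodes and the elements `e_λ`, `y_λ`, `ψ_{st}` -/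

/-- the residue of a node: `res (r, c, m) = r - c + κ_m ∈ I = ℤ/eℤ`
(for the multicharge `κ`). -/
def res (e : ℕ) {l : ℕ} (κ : Fin l → ZMod e) (x : Node l) : ZMod e :=
  (x.2.1 : ZMod e) - (x.2.2 : ZMod e) + κ x.1

/-- the residue `res_T(k)` of the node of the tableau `T` containing the entry `k`. -/
def resAt (e : ℕ) {l : ℕ} (κ : Fin l → ZMod e) (lam : Fin l → ℕ → ℕ)
    (T : Node l → ℕ) (k : ℕ) : ZMod e :=
  if h : ∃ x, x ∈ diag l lam ∧ T x = k then res e κ h.choose else 0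

/-- the residue sequence `i_T = (res_T(1), …, res_T(n)) ∈ I^n` of a tableau. -/
def resSeqT (e n : ℕ) {l : ℕ} (κ : Fin l → ZMod e) (lam : Fin l → ℕ → ℕ)
    (T : Node l → ℕ) : Fin n → ZMod e :=
  fun k => resAt e κ lam T (k.1 + 1)

/-- `x` is an addable node of the multipartition `lam`. -/
def IsAddable {l : ℕ} (lam : Fin l → ℕ → ℕ) (x : Node l) : Prop :=
  x.2.2 = lam x.1 x.2.1 ∧ (x.2.1 = 0 ∨ lam x.1 x.2.1 < lam x.1 (x.2.1 - 1))

/-- `x` is below `y`: in a later component, or in the same component and a later row. -/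
def Below {l : ℕ} (x y : Node l) : Prop :=
  y.1 < x.1 ∨ (y.1 = x.1 ∧ y.2.1 < x.2.1)

/-- `A^Λ_T(k)`: the addable nodes of `Shape(T|_k)` which lie below the node of `T`
containing `k` and have the same residue as it. -/
def addSet (e : ℕ) {l : ℕ} (κ : Fin l → ZMod e) (lam : Fin l → ℕ → ℕ)
    (T : Node l → ℕ) (k : ℕ) : Set (Node l) :=
  {x | IsAddable (restShape l lam T k) x ∧
    ∀ y : Node l, y ∈ diag l lam → T y = k → (Below x y ∧ res e κ x = res e κ y)}

/-- `|A^Λ_T(k)|`. -/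
def addCount (e : ℕ) {l : ℕ} (κ : Fin l → ZMod e) (lam : Fin l → ℕ → ℕ)
    (T : Node l → ℕ) (k : ℕ) : ℕ :=
  (addSet e κ lam T k).ncard

/-- the element `y_μ = ∏_{k=1}^{m} y_k^{|A^Λ_{t^μ}(k)|}` of `R^Λ_n`, for a
multipartition `μ` of `m ≤ n`. -/
def yEl (e n : ℕ) (Λ : ZMod e →₀ ℕ) {l : ℕ} (κ : Fin l → ZMod e)
    (lam : Fin l → ℕ → ℕ) (m : ℕ) : CKLR e n Λ :=
  ((List.range m).map fun j =>
    if h : j < n then cy e n Λ ⟨j, h⟩ ^ addCount e κ lam (initTab l m lam) (j + 1)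
    else 1).prod

/-- `ψ_r ∈ R^Λ_n` for a (1-based) index `1 ≤ r ≤ n-1` (and `1` for junk indices). -/
def cpsiOf (e n : ℕ) (Λ : ZMod e →₀ ℕ) (r : ℕ) : CKLR e n Λ :=
  if h : 1 ≤ r ∧ r < n then cpsi e n Λ ⟨r - 1, by obtain ⟨h1, h2⟩ := h; omega⟩ else 1

/-- `ψ_w` for a word `w = s_{r_1} ⋯ s_{r_m}`. -/
def psiWord (e n : ℕ) (Λ : ZMod e →₀ ℕ) (L : List ℕ) : CKLR e n Λ :=
  (L.map (cpsiOf e n Λ)).prod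

/-- the graded cellular basis element
`ψ_{st} = ψ*_{d(s)} e_λ y_λ ψ_{d(t)} ∈ R^Λ_n`, where `d(s), d(t)` are taken with their
standard expressions and `e_λ = e(i_λ)` for the residue sequence `i_λ` of `t^λ`. -/
def psiST (e n : ℕ) (Λ : ZMod e →₀ ℕ) {l : ℕ} (κ : Fin l → ZMod e)
    (lam : Fin l → ℕ → ℕ) (S T : Node l → ℕ) : CKLR e n Λ :=
  psiWord e n Λ ((stdWord l n lam S).reverse) *
    ce e n Λ (resSeqT e n κ lam (initTab l n lam)) *
    yEl e n Λ κ lam n *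
    psiWord e n Λ (stdWord l n lam T)

end Paper
end

noncomputable section
open scoped Classical
set_option linter.unusedSectionVars false
namespace DefKLR

/-- The base ring of the deformation. -/
abbrev O := Polynomial ℤ

/-- Generators of the deformed KLR algebras, on strands indexed by `ℕ`. -/
inductive G (I : Type) : Type
  | E : (ℕ → I) → G I
  | Y : ℕ → G I
  | P : ℕ → G I

/-- The action of `s_r` on sequences. -/
def sw {β : Type*} (r : ℕ) (t : ℕ → β) : ℕ → β := t ∘ Equiv.swap r (r + 1)

section relations

variable {I : Type} [CommRing I] {A : Type*} [Ring A] [Algebra O A]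

/-- The deformation parameter. -/
def xx (A : Type*) [Ring A] [Algebra O A] : A := algebraMap O A Polynomial.X

/-- The deformed quadratic relation. -/
def Qv (i j : I) (a b : A) : A :=
  if i = j then 0 else
    (if j = i + 1 then b - a - xx A else 1) * (if i = j + 1 then a - b - xx A else 1)

/-- The error term of the braid relation. -/
def bt (i j k : I) (a b c : A) : A :=
  if k = i then
    (if j = i + 1 then (if i = j + 1 then a - 2 * b + c else 1)
      else if i = j + 1 then -1 else 0)
  else 0

/-- `D` satisfies the deformed KLR relations on the first `n` strands. -/
structure IsKLR (n : ℕ) (D : G I → A) : Prop where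
  EE : ∀ i, D (.E i) * D (.E i) = D (.E i)
  EE' : ∀ i j, i ≠ j → D (.E i) * D (.E j) = 0
  YE : ∀ r i, r < n → D (.Y r) * D (.E i) = D (.E i) * D (.Y r)
  PE : ∀ r i, r + 1 < n → D (.P r) * D (.E i) = D (.E (sw r i)) * D (.P r)
  YY : ∀ r s, r < n → s < n → D (.Y r) * D (.Y s) = D (.Y s) * D (.Y r)
  PY : ∀ r s, r + 1 < n → s < n → s ≠ r → s ≠ r + 1 →
    D (.P r) * D (.Y s) = D (.Y s) * D (.P r)
  PP : ∀ r s, r + 1 < s → s + 1 < n → D (.P r) * D (.P s) = D (.P s) * D (.P r)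
  PYh : ∀ r i, r + 1 < n → D (.P r) * D (.Y (r + 1)) * D (.E i) =
    (D (.Y r) * D (.P r) + if i r = i (r + 1) then 1 else 0) * D (.E i)
  YPh : ∀ r i, r + 1 < n → D (.Y (r + 1)) * D (.P r) * D (.E i) =
    (D (.P r) * D (.Y r) + if i r = i (r + 1) then 1 else 0) * D (.E i)
  sq : ∀ r i, r + 1 < n → D (.P r) * D (.P r) * D (.E i) =
    Qv (i r) (i (r + 1)) (D (.Y r)) (D (.Y (r + 1))) * D (.E i)
  br : ∀ r i, r + 2 < n → D (.P r) * D (.P (r + 1)) * D (.P r) * D (.E i) =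
    (D (.P (r + 1)) * D (.P r) * D (.P (r + 1)) +
      bt (i r) (i (r + 1)) (i (r + 2)) (D (.Y r)) (D (.Y (r + 1))) (D (.Y (r + 2)))) * D (.E i)

theorem IsKLR.mono {m n : ℕ} {D : G I → A} (h : IsKLR n D) (hmn : m ≤ n) : IsKLR m D where
  EE := h.EE
  EE' := h.EE'
  YE r i hr := h.YE r i (by omega)
  PE r i hr := h.PE r i (by omega)
  YY r s h1 h2 := h.YY r s (by omega) (by omega)
  PY r s h1 h2 := h.PY r s (by omega) (by omega)
  PP r s h1 h2 := h.PP r s h1 (by omega)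
  PYh r i h1 := h.PYh r i (by omega)
  YPh r i h1 := h.YPh r i (by omega)
  sq r i h1 := h.sq r i (by omega)
  br r i h1 := h.br r i (by omega)

/-- The value of the cyclotomic polynomial of residue `k` at `y`. -/
def cycPoly {l : ℕ} (κ : Fin l → I) (k : I) (y : A) : A :=
  ((List.finRange l).map fun c =>
    if κ c = k then y - algebraMap O A (Polynomial.X ^ 2 * (c.1 : O)) else 1).prod

/-- The deformed cyclotomic relation. -/
def IsCyc {l : ℕ} (κ : Fin l → I) (D : G I → A) : Prop :=
  ∀ i, D (.E i) * cycPoly κ (i 0) (D (.Y 0)) = 0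

end relations

/-! ### Spanning along a chain of crossings -/

section chain

variable {I : Type} {A : Type*} [Ring A] [Algebra O A]

/-- The relations needed to straighten words in one strand passing through the others. -/
structure Chain (n : ℕ) (E : (ℕ → I) → A) (y χ : ℕ → A) : Prop where
  EE : ∀ i, E i * E i = E i
  EE' : ∀ i j, i ≠ j → E i * E j = 0
  yE : ∀ r i, r ≤ n → y r * E i = E i * y r
  cE : ∀ r i, r < n → ∃ j, χ r * E i = E j * χ r
  yy : ∀ r s, r ≤ n → s ≤ n → y r * y s = y s * y r
  cy : ∀ r s, r < n → s ≤ n → s ≠ r → s ≠ r + 1 → χ r * y s = y s * χ r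
  cc : ∀ r s, r + 1 < s → s < n → χ r * χ s = χ s * χ r
  yc : ∀ r i, r < n → ∃ c : O, y r * χ r * E i = χ r * y (r + 1) * E i + c • E i
  yc' : ∀ r i, r < n → ∃ c : O, y (r + 1) * χ r * E i = χ r * y r * E i + c • E i
  sq : ∀ r i, r < n → ∃ q ∈ Algebra.adjoin O {u | ∃ s ≤ n, u = y s}, χ r * χ r * E i = q * E i
  br : ∀ r i, r + 1 < n → ∃ q ∈ Algebra.adjoin O {u | ∃ s ≤ n, u = y s},
    χ r * χ (r + 1) * χ r * E i = χ (r + 1) * χ r * χ (r + 1) * E i + q * E i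

/-- `χ_{a-1} ⋯ χ_0`. -/
def chi (χ : ℕ → A) : ℕ → A
  | 0 => 1
  | a + 1 => χ a * chi χ a

/-- Words avoiding `χ_0`, ending in `E i`. -/
inductive Hw (n : ℕ) (E : (ℕ → I) → A) (y χ : ℕ → A) (i : ℕ → I) : A → Prop
  | base : Hw n E y χ i (E i)
  | y (r : ℕ) (u : A) : r ≤ n → Hw n E y χ i u → Hw n E y χ i (y r * u)
  | c (r : ℕ) (u : A) : 1 ≤ r → r < n → Hw n E y χ i u → Hw n E y χ i (χ r * u)

/-- The span of `χ_{a-1} ⋯ χ_0 u` with `a ≤ k`. -/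
def NN (n : ℕ) (E : (ℕ → I) → A) (y χ : ℕ → A) (i : ℕ → I) (k : ℕ) : Submodule O A :=
  Submodule.span O {z | ∃ a ≤ k, ∃ u, Hw n E y χ i u ∧ z = chi χ a * u}

variable {n : ℕ} {E : (ℕ → I) → A} {y χ : ℕ → A}

theorem Chain.hw_hom (h : Chain n E y χ) {i : ℕ → I} {u : A} (hu : Hw n E y χ i u) :
    ∃ j, E j * u = u := by
  induction hu with
  | base => exact ⟨i, h.EE i⟩
  | y r u hr _ ih =>
    obtain ⟨j, hj⟩ := ih
    exact ⟨j, by rw [← mul_assoc, ← h.yE r j hr, mul_assoc, hj]⟩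
  | c r u h1 hr _ ih =>
    obtain ⟨j, hj⟩ := ih
    obtain ⟨k, hk⟩ := h.cE r j hr
    exact ⟨k, by rw [← mul_assoc, ← hk, mul_assoc, hj]⟩

theorem Chain.chi_hom (h : Chain n E y χ) {i : ℕ → I} {u : A} (hu : Hw n E y χ i u) (a : ℕ)
    (ha : a ≤ n) : ∃ j, E j * (chi χ a * u) = chi χ a * u := by
  induction a with
  | zero => simpa [chi] using h.hw_hom hu
  | succ a ih =>
    obtain ⟨j, hj⟩ := ih (by omega)
    obtain ⟨k, hk⟩ := h.cE a j (by omega)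
    refine ⟨k, ?_⟩
    rw [chi, mul_assoc, ← mul_assoc (E k), ← hk, mul_assoc, hj]

theorem Chain.chi_comm (h : Chain n E y χ) (a j : ℕ) (haj : a < j) (hj : j < n) :
    χ j * chi χ a = chi χ a * χ j := by
  induction a with
  | zero => simp [chi]
  | succ a ih =>
    rw [chi, ← mul_assoc, ← h.cc a j (by omega) hj, mul_assoc, ih (by omega), mul_assoc]

theorem NN_mono {i : ℕ → I} {k l : ℕ} (hkl : k ≤ l) : NN n E y χ i k ≤ NN n E y χ i l :=
  Submodule.span_mono fun z ⟨a, ha, u, hu⟩ => ⟨a, by omega, u, hu⟩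

theorem mul_mem_NN {i : ℕ → I} {k : ℕ} {z : A} {N : Submodule O A}
    (h : ∀ a ≤ k, ∀ u, Hw n E y χ i u → z * (chi χ a * u) ∈ N) {m : A}
    (hm : m ∈ NN n E y χ i k) : z * m ∈ N := by
  have : NN n E y χ i k ≤ N.comap (LinearMap.mulLeft O z) := by
    refine Submodule.span_le.2 ?_
    rintro _ ⟨a, ha, u, hu, rfl⟩
    exact h a ha u hu
  exact this hm

theorem NN_mem {i : ℕ → I} {k a : ℕ} (ha : a ≤ k) {u : A} (hu : Hw n E y χ i u) :
    chi χ a * u ∈ NN n E y χ i k := Submodule.subset_span ⟨a, ha, u, hu, rfl⟩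

theorem Chain.c_mem (h : Chain n E y χ) {i : ℕ → I} {k j : ℕ} (hk : k ≤ j) (hj : j < n) {m : A}
    (hm : m ∈ NN n E y χ i k) : χ j * m ∈ NN n E y χ i (j + 1) := by
  refine mul_mem_NN (fun a ha u hu => ?_) hm
  rcases eq_or_lt_of_le (ha.trans hk) with rfl | h1
  · rw [← mul_assoc]
    exact NN_mem (le_refl (a + 1)) hu
  · rw [← mul_assoc, h.chi_comm a j h1 hj, mul_assoc]
    exact NN_mem (by omega) (.c j u (by omega) hj hu)

theorem Chain.y_mem (h : Chain n E y χ) {i : ℕ → I} {k j : ℕ} (hk : k ≤ n) (hj : j ≤ n) {m : A}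
    (hm : m ∈ NN n E y χ i k) : y j * m ∈ NN n E y χ i k := by
  induction k generalizing j m with
  | zero =>
    refine mul_mem_NN (fun a ha u hu => ?_) hm
    obtain rfl : a = 0 := by omega
    simpa [chi] using NN_mem (le_refl 0) (Hw.y j u hj hu)
  | succ k ih =>
    refine mul_mem_NN (fun a ha u hu => ?_) hm
    rcases Nat.lt_or_ge a (k + 1) with h1 | h1
    · exact NN_mono (by omega) (ih (by omega) hj (NN_mem (by omega) hu))
    · obtain rfl : a = k + 1 := by omega
      have hmem : chi χ k * u ∈ NN n E y χ i k := NN_mem le_rfl hu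
      have hy : ∀ s ≤ n, χ k * (y s * (chi χ k * u)) ∈ NN n E y χ i (k + 1) := fun s hs =>
        h.c_mem le_rfl (by omega) (ih (by omega) hs hmem)
      obtain ⟨j', hj'⟩ := h.chi_hom hu k (by omega)
      rw [chi, mul_assoc]
      by_cases e1 : j = k
      · subst e1
        obtain ⟨c, hc⟩ := h.yc j j' (by omega)
        rw [← hj', ← mul_assoc, ← mul_assoc, hc, add_mul, mul_assoc, hj', smul_mul_assoc, hj',
          mul_assoc]
        exact add_mem (hy _ (by omega)) (Submodule.smul_mem _ _ (NN_mono (by omega) hmem))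
      by_cases e2 : j = k + 1
      · subst e2
        obtain ⟨c, hc⟩ := h.yc' k j' (by omega)
        rw [← hj', ← mul_assoc, ← mul_assoc, hc, add_mul, mul_assoc, hj', smul_mul_assoc, hj',
          mul_assoc]
        exact add_mem (hy _ (by omega)) (Submodule.smul_mem _ _ (NN_mono (by omega) hmem))
      · rw [← mul_assoc, ← h.cy k j (by omega) hj e1 e2, mul_assoc]
        exact hy j hj

theorem Chain.q_mem (h : Chain n E y χ) {i : ℕ → I} {k : ℕ} (hk : k ≤ n) {q : A}
    (hq : q ∈ Algebra.adjoin O {u | ∃ s ≤ n, u = y s}) {m : A}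
    (hm : m ∈ NN n E y χ i k) : q * m ∈ NN n E y χ i k := by
  induction hq using Algebra.adjoin_induction generalizing m with
  | mem z hz => obtain ⟨s, hs, rfl⟩ := hz; exact h.y_mem hk hs hm
  | algebraMap r => rw [← Algebra.smul_def]; exact Submodule.smul_mem _ _ hm
  | add a b _ _ ha hb => rw [add_mul]; exact add_mem (ha hm) (hb hm)
  | mul a b _ _ ha hb => rw [mul_assoc]; exact ha (hb hm)

theorem Chain.c_mem' (h : Chain n E y χ) {i : ℕ → I} {a j : ℕ} (ha : a ≤ n) (hj : j < a)
    {u : A} (hu : Hw n E y χ i u) : χ j * (chi χ a * u) ∈ NN n E y χ i a := by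
  induction a with
  | zero => omega
  | succ a ih =>
    rcases Nat.lt_trichotomy (j + 1) a with h1 | h1 | h1
    · rw [chi, mul_assoc, ← mul_assoc, h.cc j a h1 (by omega), mul_assoc]
      exact h.c_mem le_rfl (by omega) (ih (by omega) (by omega))
    · subst h1
      obtain ⟨j', hj'⟩ := h.chi_hom hu j (by omega)
      obtain ⟨q, hq, hb⟩ := h.br j j' (by omega)
      have : χ j * (chi χ (j + 1 + 1) * u) =
          chi χ (j + 1 + 1) * (χ (j + 1) * u) + q * (chi χ j * u) := by
        have e1 : χ j * (chi χ (j + 1 + 1) * u) =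
            χ j * χ (j + 1) * χ j * E j' * (chi χ j * u) := by
          rw [mul_assoc _ (E j'), hj']; simp only [chi, mul_assoc]
        rw [e1, hb, add_mul, mul_assoc _ (E j'), mul_assoc q, hj']
        congr 1
        simp only [chi, mul_assoc]
        rw [← mul_assoc (χ (j + 1)) (chi χ j) u, h.chi_comm j (j + 1) (by omega) (by omega)]
        simp only [mul_assoc]
      rw [this]
      exact add_mem (NN_mem le_rfl (.c _ u (by omega) (by omega) hu))
        (NN_mono (by omega) (h.q_mem (k := j) (by omega) hq (NN_mem le_rfl hu)))
    · obtain rfl : a = j := by omega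
      obtain ⟨j', hj'⟩ := h.chi_hom hu a (by omega)
      obtain ⟨q, hq, hb⟩ := h.sq a j' (by omega)
      have : χ a * (chi χ (a + 1) * u) = q * (chi χ a * u) := by
        have e1 : χ a * (chi χ (a + 1) * u) = χ a * χ a * E j' * (chi χ a * u) := by
          rw [mul_assoc _ (E j'), hj']; simp only [chi, mul_assoc]
        rw [e1, hb, mul_assoc, hj']
      rw [this]
      exact h.q_mem ha hq (NN_mem (by omega) hu)

theorem Chain.span (h : Chain n E y χ) (i : ℕ → I) {z : A}
    (hz : z ∈ Algebra.adjoin O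
      ({u | ∃ j, u = E j} ∪ {u | ∃ s ≤ n, u = y s} ∪ {u | ∃ s < n, u = χ s})) :
    z * E i ∈ NN n E y χ i n := by
  have key : ∀ m ∈ NN n E y χ i n, z * m ∈ NN n E y χ i n := by
    induction hz using Algebra.adjoin_induction with
    | mem z hz =>
      intro m hm
      rcases hz with (⟨j, rfl⟩ | ⟨s, hs, rfl⟩) | ⟨s, hs, rfl⟩
      · refine mul_mem_NN (fun a ha u hu => ?_) hm
        obtain ⟨j', hj'⟩ := h.chi_hom hu a ha
        by_cases e : j = j'
        · rw [e, hj']; exact NN_mem ha hu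
        · rw [← hj', ← mul_assoc, h.EE' _ _ e, zero_mul]; exact zero_mem _
      · exact h.y_mem le_rfl hs hm
      · refine mul_mem_NN (fun a ha u hu => ?_) hm
        rcases Nat.lt_or_ge s a with h1 | h1
        · exact NN_mono ha (h.c_mem' ha h1 hu)
        · exact NN_mono (by omega) (h.c_mem h1 hs (NN_mem le_rfl hu))
    | algebraMap r =>
      intro m hm
      rw [← Algebra.smul_def]; exact Submodule.smul_mem _ _ hm
    | add a b _ _ ha hb => intro m hm; rw [add_mul]; exact add_mem (ha m hm) (hb m hm)
    | mul a b _ _ ha hb => intro m hm; rw [mul_assoc]; exact ha _ (hb m hm)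
  have := key _ (NN_mem (Nat.zero_le n) (Hw.base (i := i)))
  simpa [chi] using this

/-- Every word avoiding `χ_0` has the form `b y_0^m E i`. -/
theorem Chain.hw_form (h : Chain n E y χ) {i : ℕ → I} {u : A} (hu : Hw n E y χ i u) :
    ∃ b ∈ Algebra.adjoin O ({u | ∃ j, u = E j} ∪ {u | ∃ s, 1 ≤ s ∧ s ≤ n ∧ u = y s} ∪
      {u | ∃ s, 1 ≤ s ∧ s < n ∧ u = χ s}), ∃ m : ℕ, u = b * y 0 ^ m * E i := by
  have comm : ∀ b ∈ Algebra.adjoin O ({u | ∃ j, u = E j} ∪ {u | ∃ s, 1 ≤ s ∧ s ≤ n ∧ u = y s} ∪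
      {u | ∃ s, 1 ≤ s ∧ s < n ∧ u = χ s}), y 0 * b = b * y 0 := by
    intro b hb
    induction hb using Algebra.adjoin_induction with
    | mem z hz =>
      rcases hz with (⟨j, rfl⟩ | ⟨s, hs, hs', rfl⟩) | ⟨s, hs, hs', rfl⟩
      · exact h.yE 0 j (by omega)
      · exact h.yy 0 s (by omega) hs'
      · exact (h.cy s 0 hs' (by omega) (by omega) (by omega)).symm
    | algebraMap r => exact (Algebra.commutes r _).symm
    | add a b _ _ ha hb => rw [mul_add, add_mul, ha, hb]
    | mul a b _ _ ha hb => rw [← mul_assoc, ha, mul_assoc, hb, mul_assoc]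
  induction hu with
  | base => exact ⟨1, one_mem _, 0, by simp⟩
  | y r u hr _ ih =>
    obtain ⟨b, hb, m, rfl⟩ := ih
    rcases Nat.eq_zero_or_pos r with rfl | hp
    · exact ⟨b, hb, m + 1, by rw [← mul_assoc, ← mul_assoc, comm b hb, pow_succ', ← mul_assoc]⟩
    · exact ⟨y r * b, mul_mem (Algebra.subset_adjoin (.inl (.inr ⟨r, hp, hr, rfl⟩))) hb, m,
        by simp only [mul_assoc]⟩
  | c r u h1 hr _ ih =>
    obtain ⟨b, hb, m, rfl⟩ := ih
    exact ⟨χ r * b, mul_mem (Algebra.subset_adjoin (.inr ⟨r, h1, hr, rfl⟩)) hb, m,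
        by simp only [mul_assoc]⟩

end chain

section universal

variable {I : Type} [CommRing I]

/-- The free algebra on the generators. -/
abbrev FF (I : Type) := FreeAlgebra O (G I)

/-- The evaluation of words. -/
abbrev ev {I : Type} {A : Type*} [Ring A] [Algebra O A] (D : G I → A) : FF I →ₐ[O] A :=
  FreeAlgebra.lift O D

/-- A generator as an element of the free algebra. -/
abbrev gen {I : Type} (g : G I) : FF I := FreeAlgebra.ι O g

/-- The subalgebra generated by a set of generators. -/
def FA {I : Type} (S : Set (G I)) : Subalgebra O (FF I) := Algebra.adjoin O (gen '' S)

/-- The generators on the first `n` strands. -/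
def gens (I : Type) (n : ℕ) : Set (G I) :=
  {g | (∃ i, g = .E i) ∨ (∃ r < n, g = .Y r) ∨ ∃ r, r + 1 < n ∧ g = .P r}

/-- The generators on the strands `1, …, n`. -/
def gensF (I : Type) (n : ℕ) : Set (G I) :=
  {g | (∃ i, g = .E i) ∨ (∃ r, 1 ≤ r ∧ r ≤ n ∧ g = .Y r) ∨ ∃ r, 1 ≤ r ∧ r < n ∧ g = .P r}

theorem ev_FA {A : Type*} [Ring A] [Algebra O A] (D : G I → A) (S : Set (G I)) :
    (FA S).map (ev D) = Algebra.adjoin O (D '' S) := by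
  rw [FA, AlgHom.map_adjoin]
  congr 1
  ext z
  simp [ev, gen]

/-- Elements of the free algebra identified by every deformed KLR representation. -/
def urel (I : Type) [CommRing I] (n : ℕ) (a b : FF I) : Prop :=
  ∀ (A : Type) [Ring A] [Algebra O A] (D : G I → A), IsKLR n D → ev D a = ev D b

/-- The universal deformed KLR algebra. -/
def U (I : Type) [CommRing I] (n : ℕ) : Type := RingQuot (urel I n)

instance (n : ℕ) : Ring (U I n) := inferInstanceAs (Ring (RingQuot (urel I n)))

instance (n : ℕ) : Algebra O (U I n) := inferInstanceAs (Algebra O (RingQuot (urel I n)))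

/-- The projection to the universal deformed KLR algebra. -/
def toU (I : Type) [CommRing I] (n : ℕ) : FF I →ₐ[O] U I n := RingQuot.mkAlgHom O (urel I n)

theorem toU_eq {n : ℕ} {a b : FF I} (h : urel I n a b) : toU I n a = toU I n b :=
  RingQuot.mkAlgHom_rel O h

theorem ev_eq_of_toU {n : ℕ} {a b : FF I} (h : toU I n a = toU I n b) : urel I n a b := by
  intro A _ _ D hD
  let f : U I n →ₐ[O] A := RingQuot.liftAlgHom O ⟨ev D, fun _ _ hr => hr A D hD⟩
  have hf : ∀ z, f (toU I n z) = ev D z :=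
    RingQuot.liftAlgHom_mkAlgHom_apply O (ev D) (fun _ _ hr => hr A D hD)
  rw [← hf, h, hf]

theorem map_xx {A B : Type*} [Ring A] [Algebra O A] [Ring B] [Algebra O B] (f : A →ₐ[O] B) :
    f (xx A) = xx B := by simp [xx]

theorem map_Qv {A B : Type*} [Ring A] [Algebra O A] [Ring B] [Algebra O B] (f : A →ₐ[O] B)
    (i j : I) (a b : A) : f (Qv i j a b) = Qv i j (f a) (f b) := by
  unfold Qv
  split_ifs <;> simp [map_xx]

theorem map_bt {A B : Type*} [Ring A] [Algebra O A] [Ring B] [Algebra O B] (f : A →ₐ[O] B)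
    (i j k : I) (a b c : A) : f (bt i j k a b c) = bt i j k (f a) (f b) (f c) := by
  unfold bt
  split_ifs <;> simp [map_ofNat f 2]

theorem isKLR_U (n : ℕ) : IsKLR n (fun g => toU I n (gen g)) := by
  have key : ∀ a b : FF I, (∀ (A : Type) [Ring A] [Algebra O A] (D : G I → A), IsKLR n D →
    ev D a = ev D b) → toU I n a = toU I n b := fun a b h => toU_eq h
  constructor
  · intro i
    rw [← map_mul]; exact key _ _ fun A _ _ D h => by simpa [ev] using h.EE i
  · intro i j hij
    rw [← map_mul, ← map_zero (toU I n)]; exact key _ _ fun A _ _ D h => by simpa [ev] using h.EE' i j hij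
  · intro r i hr
    rw [← map_mul, ← map_mul]; exact key _ _ fun A _ _ D h => by simpa [ev] using h.YE r i hr
  · intro r i hr
    rw [← map_mul, ← map_mul]; exact key _ _ fun A _ _ D h => by simpa [ev] using h.PE r i hr
  · intro r s hr hs
    rw [← map_mul, ← map_mul]; exact key _ _ fun A _ _ D h => by simpa [ev] using h.YY r s hr hs
  · intro r s hr hs h1 h2
    rw [← map_mul, ← map_mul]
    exact key _ _ fun A _ _ D h => by simpa [ev] using h.PY r s hr hs h1 h2
  · intro r s hr hs
    rw [← map_mul, ← map_mul]; exact key _ _ fun A _ _ D h => by simpa [ev] using h.PP r s hr hs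
  · intro r i hr
    have := key (gen (.P r) * gen (.Y (r + 1)) * gen (.E i))
      ((gen (.Y r) * gen (.P r) + if i r = i (r + 1) then 1 else 0) * gen (.E i))
      fun A _ _ D h => by
        have := h.PYh r i hr
        split_ifs at this ⊢ <;> simpa [ev] using this
    split_ifs at this ⊢ <;> simpa using this
  · intro r i hr
    have := key (gen (.Y (r + 1)) * gen (.P r) * gen (.E i))
      ((gen (.P r) * gen (.Y r) + if i r = i (r + 1) then 1 else 0) * gen (.E i))
      fun A _ _ D h => by
        have := h.YPh r i hr
        split_ifs at this ⊢ <;> simpa [ev] using this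
    split_ifs at this ⊢ <;> simpa using this
  · intro r i hr
    have := key (gen (.P r) * gen (.P r) * gen (.E i))
      (Qv (i r) (i (r + 1)) (gen (.Y r)) (gen (.Y (r + 1))) * gen (.E i))
      fun A _ _ D h => by simpa [ev, map_Qv] using h.sq r i hr
    simpa [map_Qv] using this
  · intro r i hr
    have := key (gen (.P r) * gen (.P (r + 1)) * gen (.P r) * gen (.E i))
      ((gen (.P (r + 1)) * gen (.P r) * gen (.P (r + 1)) + bt (i r) (i (r + 1)) (i (r + 2))
        (gen (.Y r)) (gen (.Y (r + 1))) (gen (.Y (r + 2)))) * gen (.E i))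
      fun A _ _ D h => by simpa [ev, map_bt] using h.br r i hr
    simpa [map_bt] using this

end universal

section chains

variable {I : Type} [CommRing I] {A : Type*} [Ring A] [Algebra O A]

theorem adjoin_Qv (i j : I) {S : Subalgebra O A} {a b : A} (ha : a ∈ S) (hb : b ∈ S) :
    Qv i j a b ∈ S := by
  have hx : xx A ∈ S := S.algebraMap_mem _
  unfold Qv
  split_ifs <;> first
    | exact zero_mem _
    | exact mul_mem (sub_mem (sub_mem hb ha) hx) (sub_mem (sub_mem ha hb) hx)
    | exact mul_mem (sub_mem (sub_mem hb ha) hx) (one_mem _)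
    | exact mul_mem (one_mem _) (sub_mem (sub_mem ha hb) hx)
    | exact mul_mem (one_mem _) (one_mem _)

theorem adjoin_bt (i j k : I) {S : Subalgebra O A} {a b c : A} (ha : a ∈ S) (hb : b ∈ S)
    (hc : c ∈ S) : bt i j k a b c ∈ S := by
  unfold bt
  split_ifs
  · refine add_mem (sub_mem ha (mul_mem ?_ hb)) hc
    have := S.algebraMap_mem (2 : O)
    rwa [map_ofNat] at this
  · exact one_mem _
  · exact neg_mem (one_mem _)
  · exact zero_mem _
  · exact zero_mem _

theorem IsKLR.chainF {n : ℕ} {D : G I → A} (h : IsKLR (n + 1) D) :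
    Chain n (fun i => D (.E i)) (fun j => D (.Y j)) (fun j => D (.P j)) where
  EE := h.EE
  EE' := h.EE'
  yE r i hr := h.YE r i (by omega)
  cE r i hr := ⟨_, h.PE r i (by omega)⟩
  yy r s h1 h2 := h.YY r s (by omega) (by omega)
  cy r s h1 h2 := h.PY r s (by omega) (by omega)
  cc r s h1 h2 := h.PP r s h1 (by omega)
  yc r i hr := by
    refine ⟨-(if i r = i (r + 1) then 1 else 0), ?_⟩
    rw [h.PYh r i (by omega)]
    split_ifs <;> simp [add_mul]
  yc' r i hr := by
    refine ⟨if i r = i (r + 1) then 1 else 0, ?_⟩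
    rw [h.YPh r i (by omega)]
    split_ifs <;> simp [add_mul]
  sq r i hr := ⟨_, adjoin_Qv _ _ (Algebra.subset_adjoin ⟨r, by omega, rfl⟩)
    (Algebra.subset_adjoin ⟨r + 1, by omega, rfl⟩), h.sq r i (by omega)⟩
  br r i hr := ⟨_, adjoin_bt _ _ _ (Algebra.subset_adjoin ⟨r, by omega, rfl⟩)
    (Algebra.subset_adjoin ⟨r + 1, by omega, rfl⟩)
    (Algebra.subset_adjoin ⟨r + 2, by omega, rfl⟩), by rw [h.br r i (by omega), add_mul]⟩

theorem IsKLR.chainL {n : ℕ} {D : G I → A} (h : IsKLR (n + 1) D) :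
    Chain n (fun i => D (.E i)) (fun j => D (.Y (n - j))) (fun j => D (.P (n - 1 - j))) where
  EE := h.EE
  EE' := h.EE'
  yE r i hr := h.YE _ i (by omega)
  cE r i hr := ⟨_, h.PE _ i (by omega)⟩
  yy r s h1 h2 := h.YY _ _ (by omega) (by omega)
  cy r s h1 h2 h3 h4 := h.PY _ _ (by omega) (by omega) (by omega) (by omega)
  cc r s h1 h2 := (h.PP _ _ (by omega) (by omega)).symm
  yc r i hr := by
    have e : n - r = n - 1 - r + 1 := by omega
    have e' : n - (r + 1) = n - 1 - r := by omega
    simp only [e, e']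
    refine ⟨if i (n - 1 - r) = i (n - 1 - r + 1) then 1 else 0, ?_⟩
    rw [h.YPh _ i (by omega)]
    split_ifs <;> simp [add_mul]
  yc' r i hr := by
    have e : n - r = n - 1 - r + 1 := by omega
    have e' : n - (r + 1) = n - 1 - r := by omega
    simp only [e, e']
    refine ⟨-(if i (n - 1 - r) = i (n - 1 - r + 1) then 1 else 0), ?_⟩
    rw [h.PYh _ i (by omega)]
    split_ifs <;> simp [add_mul]
  sq r i hr := ⟨_, adjoin_Qv _ _ (Algebra.subset_adjoin ⟨n - (n - 1 - r), by omega, rfl⟩)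
    (Algebra.subset_adjoin ⟨n - (n - 1 - r + 1), by omega, rfl⟩), by
      have e : n - (n - (n - 1 - r)) = n - 1 - r := by omega
      have e' : n - (n - (n - 1 - r + 1)) = n - 1 - r + 1 := by omega
      simp only [e, e']
      exact h.sq _ i (by omega)⟩
  br r i hr := by
    obtain ⟨k, hk⟩ : ∃ k, n - 1 - r = k + 1 := ⟨n - 1 - r - 1, by omega⟩
    have hk' : n - 1 - (r + 1) = k := by omega
    have h1 : D (.Y k) ∈ Algebra.adjoin O {u | ∃ s ≤ n, u = D (.Y (n - s))} :=
      Algebra.subset_adjoin ⟨n - k, by omega, by congr 2; omega⟩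
    have h2 : D (.Y (k + 1)) ∈ Algebra.adjoin O {u | ∃ s ≤ n, u = D (.Y (n - s))} :=
      Algebra.subset_adjoin ⟨n - (k + 1), by omega, by congr 2; omega⟩
    have h3 : D (.Y (k + 2)) ∈ Algebra.adjoin O {u | ∃ s ≤ n, u = D (.Y (n - s))} :=
      Algebra.subset_adjoin ⟨n - (k + 2), by omega, by congr 2; omega⟩
    refine ⟨_, neg_mem (adjoin_bt (i k) (i (k + 1)) (i (k + 2)) h1 h2 h3), ?_⟩
    simp only [hk, hk']
    rw [h.br k i (by omega), add_mul]
    simp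

/-- The position of the moving strand after `j` steps: from the right if `b`, from the left
otherwise. -/
def pos (b : Bool) (n j : ℕ) : ℕ := if b then n - j else j

/-- The `j`-th crossing met by the moving strand. -/
def cr (b : Bool) (n j : ℕ) : ℕ := if b then n - 1 - j else j

/-- The generators not involving the moving strand. -/
def gensB (I : Type) (b : Bool) (n : ℕ) : Set (G I) := if b then gens I n else gensF I n

theorem IsKLR.chain {n : ℕ} {D : G I → A} (h : IsKLR (n + 1) D) (b : Bool) :
    Chain n (fun i => D (.E i)) (fun j => D (.Y (pos b n j))) (fun j => D (.P (cr b n j))) := by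
  cases b
  · exact h.chainF
  · exact h.chainL

theorem adjoin_gens_le {n : ℕ} (D : G I → A) (b : Bool) :
    Algebra.adjoin O (D '' gens I (n + 1)) ≤ Algebra.adjoin O
      ({u | ∃ j, u = D (.E j)} ∪ {u | ∃ s ≤ n, u = D (.Y (pos b n s))} ∪
        {u | ∃ s < n, u = D (.P (cr b n s))}) := by
  refine Algebra.adjoin_mono ?_
  rintro _ ⟨g, hg, rfl⟩
  rcases hg with ⟨i, rfl⟩ | ⟨r, hr, rfl⟩ | ⟨r, hr, rfl⟩
  · exact .inl (.inl ⟨i, rfl⟩)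
  · refine .inl (.inr ⟨pos b n r, ?_, ?_⟩) <;> cases b <;> simp [pos] <;> first | omega | skip
    congr 2; omega
  · refine .inr ⟨cr b n r, ?_, ?_⟩ <;> cases b <;> simp [cr] <;> first | omega | skip
    congr 2; omega

theorem adjoin_gensB_ge {n : ℕ} (D : G I → A) (b : Bool) :
    Algebra.adjoin O
      ({u | ∃ j, u = D (.E j)} ∪ {u | ∃ s, 1 ≤ s ∧ s ≤ n ∧ u = D (.Y (pos b n s))} ∪
        {u | ∃ s, 1 ≤ s ∧ s < n ∧ u = D (.P (cr b n s))}) ≤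
      Algebra.adjoin O (D '' gensB I b n) := by
  refine Algebra.adjoin_mono ?_
  rintro u ((⟨j, rfl⟩ | ⟨s, h1, h2, rfl⟩) | ⟨s, h1, h2, rfl⟩)
  · exact ⟨_, by cases b <;> simp [gensB, gensF, gens], rfl⟩
  · refine ⟨_, ?_, rfl⟩
    cases b
    · exact .inr (.inl ⟨s, h1, h2, rfl⟩)
    · exact .inr (.inl ⟨n - s, by omega, rfl⟩)
  · refine ⟨_, ?_, rfl⟩
    cases b
    · exact .inr (.inr ⟨s, h1, h2, rfl⟩)
    · exact .inr (.inr ⟨n - 1 - s, by omega, rfl⟩)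

/-- The normal form attached to the coefficients `c`. -/
def normalForm (b : Bool) (n : ℕ) (D : G I → A) (i : ℕ → I) (N : ℕ) (c : ℕ → ℕ → FF I) : A :=
  ∑ a ∈ Finset.range (n + 1), ∑ m ∈ Finset.range N,
    chi (fun j => D (.P (cr b n j))) a * (ev D (c a m) * D (.Y (pos b n 0)) ^ m * D (.E i))

theorem normalForm_le (b : Bool) (n : ℕ) (D : G I → A) (i : ℕ → I) {N M : ℕ} (hNM : N ≤ M)
    (c : ℕ → ℕ → FF I) :
    normalForm b n D i N c = normalForm b n D i M (fun a m => if m < N then c a m else 0) := by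
  unfold normalForm
  refine Finset.sum_congr rfl fun a _ => ?_
  rw [← Finset.sum_subset (Finset.range_mono hNM)]
  · refine Finset.sum_congr rfl fun m hm => ?_
    simp [Finset.mem_range.1 hm]
  · intro m _ hm
    have : ¬ m < N := by simpa using hm
    simp [this]

theorem map_chi {A B : Type*} [Ring A] [Algebra O A] [Ring B] [Algebra O B] (f : A →ₐ[O] B)
    (χ : ℕ → A) (a : ℕ) : f (chi χ a) = chi (fun j => f (χ j)) a := by
  induction a with
  | zero => simp [chi]
  | succ a ih => simp [chi, ih]

theorem exists_normalForm_U (b : Bool) (n : ℕ) (i : ℕ → I) {z : FF I}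
    (hz : z ∈ FA (gens I (n + 1))) :
    ∃ (N : ℕ) (c : ℕ → ℕ → FF I), (∀ a m, c a m ∈ FA (gensB I b n)) ∧
      toU I (n + 1) z * toU I (n + 1) (gen (.E i)) =
        normalForm b n (fun g => toU I (n + 1) (gen g)) i N c := by
  set D : G I → U I (n + 1) := fun g => toU I (n + 1) (gen g) with hD
  have hK : IsKLR (n + 1) D := isKLR_U (n + 1)
  have hev : ev D = toU I (n + 1) := by
    ext g; simp [ev, hD, gen]
  have h1 : toU I (n + 1) z ∈ Algebra.adjoin O (D '' gens I (n + 1)) := by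
    rw [← ev_FA, hev]; exact ⟨z, hz, rfl⟩
  have h2 := (hK.chain b).span i (adjoin_gens_le D b h1)
  change ∃ (N : ℕ) (c : ℕ → ℕ → FF I), _ ∧ toU I (n + 1) z * D (.E i) = _
  revert h2
  generalize toU I (n + 1) z * D (.E i) = w
  intro h2
  induction h2 using Submodule.span_induction with
  | mem w hw =>
    obtain ⟨a, ha, u, hu, rfl⟩ := hw
    obtain ⟨β, hβ, m, rfl⟩ := (hK.chain b).hw_form hu
    have hβ' := adjoin_gensB_ge D b hβ
    rw [← ev_FA] at hβ'
    obtain ⟨β', hβ1, rfl⟩ := hβ'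
    refine ⟨m + 1, fun a' m' => if a' = a ∧ m' = m then β' else 0, fun a' m' => ?_, ?_⟩
    · dsimp only; split_ifs
      · exact hβ1
      · exact zero_mem _
    · unfold normalForm
      rw [Finset.sum_eq_single a, Finset.sum_eq_single m]
      · simp
      · intro m' _ hm'; simp [hm']
      · simp
      · intro a' _ ha'; simp [ha']
      · intro h; simp at h; omega
  | zero => exact ⟨0, fun _ _ => 0, fun _ _ => zero_mem _, by simp [normalForm]⟩
  | add u v _ _ hu hv =>
    obtain ⟨N, c, hc, rfl⟩ := hu
    obtain ⟨M, d, hd, rfl⟩ := hv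
    rw [normalForm_le b n D i (le_max_left N M), normalForm_le b n D i (le_max_right N M)]
    refine ⟨max N M, fun a m => (if m < N then c a m else 0) + if m < M then d a m else 0,
      fun a m => ?_, ?_⟩
    · dsimp only
      refine add_mem ?_ ?_ <;> split_ifs <;> first | exact zero_mem _ | exact hc a m | exact hd a m
    · simp only [normalForm, ← Finset.sum_add_distrib]
      refine Finset.sum_congr rfl fun a _ => Finset.sum_congr rfl fun m _ => ?_
      rw [map_add, add_mul, add_mul, mul_add]
  | smul r u _ hu =>
    obtain ⟨N, c, hc, rfl⟩ := hu
    refine ⟨N, fun a m => r • c a m, fun a m => Subalgebra.smul_mem _ (hc a m) r, ?_⟩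
    simp only [normalForm, Finset.smul_sum]
    refine Finset.sum_congr rfl fun a _ => Finset.sum_congr rfl fun m _ => ?_
    rw [map_smul, smul_mul_assoc, smul_mul_assoc, mul_smul_comm]

/-- Straightening of words, uniformly in the deformed KLR representation. -/
theorem exists_normalForm (b : Bool) (n : ℕ) (i : ℕ → I) {z : FF I}
    (hz : z ∈ FA (gens I (n + 1))) :
    ∃ (N : ℕ) (c : ℕ → ℕ → FF I), (∀ a m, c a m ∈ FA (gensB I b n)) ∧
      ∀ (A : Type) [Ring A] [Algebra O A] (D : G I → A), IsKLR (n + 1) D →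
        ev D z * D (.E i) = normalForm b n D i N c := by
  obtain ⟨N, c, hc, h⟩ := exists_normalForm_U b n i hz
  refine ⟨N, c, hc, fun A _ _ D hD => ?_⟩
  have hnf : ∀ {B : Type} [Ring B] [Algebra O B] (f : FF I →ₐ[O] B),
      f (normalForm b n gen i N c) = normalForm b n (fun g => f (gen g)) i N c := by
    intro B _ _ f
    have e1 : ev (gen (I := I)) = AlgHom.id O _ := by ext g; simp [ev, gen]
    have e2 : ev (fun g => f (gen g)) = f := by ext g; simp [ev, gen]
    simp [normalForm, map_sum, map_chi, e1, e2]
  have h3 : toU I (n + 1) (z * gen (.E i)) = toU I (n + 1) (normalForm b n gen i N c) := by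
    rw [hnf, map_mul, h]
  have h4 := ev_eq_of_toU h3 A D hD
  rw [hnf, map_mul] at h4
  simpa [ev, gen] using h4

end chains

section swaps

variable {β γ : Type*}

theorem sw_apply (r : ℕ) (t : ℕ → β) (q : ℕ) :
    sw r t q = if q = r then t (r + 1) else if q = r + 1 then t r else t q := by
  simp only [sw, Function.comp, Equiv.swap_apply_def]
  split_ifs <;> rfl

@[simp] theorem sw_self (r : ℕ) (t : ℕ → β) : sw r t r = t (r + 1) := by simp [sw_apply]
@[simp] theorem sw_succ (r : ℕ) (t : ℕ → β) : sw r t (r + 1) = t r := by simp [sw_apply]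
theorem sw_ne (r : ℕ) (t : ℕ → β) (q : ℕ) (h1 : q ≠ r) (h2 : q ≠ r + 1) : sw r t q = t q := by
  simp [sw_apply, h1, h2]

@[simp] theorem sw_sw (r : ℕ) (t : ℕ → β) : sw r (sw r t) = t := by
  funext q; simp only [sw_apply]; split_ifs <;> (try omega) <;> congr 1 <;> omega

theorem sw_comp (r : ℕ) (f : β → γ) (t : ℕ → β) : f ∘ sw r t = sw r (f ∘ t) := rfl

theorem sw_eq_self {r : ℕ} {t : ℕ → β} (h : t r = t (r + 1)) : sw r t = t := by
  funext q; simp only [sw_apply]; split_ifs with h1 h2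
  · rw [h1, h]
  · rw [h2, h]
  · rfl

theorem sw_inj {r : ℕ} {t s : ℕ → β} : sw r t = sw r s ↔ t = s :=
  ⟨fun h => by rw [← sw_sw r t, h, sw_sw], fun h => by rw [h]⟩

theorem sw_braid (r : ℕ) (t : ℕ → β) :
    sw r (sw (r + 1) (sw r t)) = sw (r + 1) (sw r (sw (r + 1) t)) := by
  funext q; simp only [sw_apply]; split_ifs <;> first | omega | rfl

theorem sw_far (r s : ℕ) (h : r + 1 < s) (t : ℕ → β) : sw r (sw s t) = sw s (sw r t) := by
  funext q; simp only [sw_apply]; split_ifs <;> first | omega | rfl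

end swaps

/-- The fields over which the seminormal representations live. -/
class Setup (K L : Type) [Field K] [Field L] [Algebra O K] [Algebra K L] [Algebra O L] where
  inj : Function.Injective (algebraMap O K)
  τ : L
  trans : Transcendental K τ

/-- Labels: contents `(c, h)` of nodes, or a free strand of given residue. -/
abbrev Lab (I : Type) (l : ℕ) := (Fin l × ℤ) ⊕ I

section links

variable {I : Type} {l : ℕ}

/-- Contents on the same or adjacent diagonals. -/
def linked : Lab I l → Lab I l → Prop
  | .inl a, .inl b => a.1 = b.1 ∧ (b.2 = a.2 ∨ b.2 = a.2 + 1 ∨ a.2 = b.2 + 1)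
  | _, _ => False

theorem linked_symm {a b : Lab I l} : linked a b ↔ linked b a := by
  rcases a with a | a <;> rcases b with b | b <;> simp only [linked]
  constructor <;> rintro ⟨h, h'⟩ <;> refine ⟨h.symm, ?_⟩ <;> tauto

end links

section labels

variable {I : Type} [CommRing I] {l : ℕ} (κ : Fin l → I)

/-- The residue of a label. -/
def resid : Lab I l → I
  | .inl a => (a.2 : I) + κ a.1
  | .inr k => k

variable (K L : Type) [Field K] [Field L] [Algebra O K] [Algebra K L] [Algebra O L]
  [IsScalarTower O K L] [Setup K L]

/-- The value of a content. -/
def vK (a : Fin l × ℤ) : K :=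
  algebraMap O K (Polynomial.X * (a.2 : O) + Polynomial.X ^ 2 * (a.1.1 : O))

theorem vK_eq {a b : Fin l × ℤ} {s : ℤ} (h : vK K a = vK K b + algebraMap O K (Polynomial.X * (s : O)))
    (hi : Function.Injective (algebraMap O K)) : a.1 = b.1 ∧ a.2 = b.2 + s := by
  rw [vK, vK, ← map_add] at h
  have h := hi h
  have e : ∀ (u : ℤ) (w : ℕ), (Polynomial.X * (u : O) + Polynomial.X ^ 2 * (w : O)) =
      Polynomial.C u * Polynomial.X ^ 1 + Polynomial.C (w : ℤ) * Polynomial.X ^ 2 := by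
    intro u w; simp; ring
  have h1 := congrArg (fun p => Polynomial.coeff p 1) h
  have h2 := congrArg (fun p => Polynomial.coeff p 2) h
  have e2 : (Polynomial.X * (s : O)) = Polynomial.C s * Polynomial.X ^ 1 := by simp; ring
  simp only [e, e2, Polynomial.coeff_add, Polynomial.coeff_C_mul, Polynomial.coeff_X_pow] at h1 h2
  norm_num at h1 h2
  exact ⟨Fin.ext h2, h1⟩

/-- The value of a label. -/
def vL : Lab I l → L
  | .inl a => algebraMap K L (vK K a)
  | .inr _ => Setup.τ K

theorem xx_tower : algebraMap K L (xx K) = xx L := by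
  rw [xx, xx, ← IsScalarTower.algebraMap_apply]

theorem τ_ne (c : K) : (Setup.τ K : L) ≠ algebraMap K L c := by
  intro h
  exact Setup.trans (K := K) (L := L) (h ▸ isAlgebraic_algebraMap c)

theorem vK_inj (K L : Type) [Field K] [Field L] [Algebra O K] [Algebra K L] [Algebra O L]
    [Setup K L] {a b : Fin l × ℤ} (h : vK K a = vK K b) : a = b := by
  have := vK_eq K (s := 0) (by simpa using h) (Setup.inj (L := L))
  exact Prod.ext this.1 (by simpa using this.2)

theorem vK_sub_eq (K L : Type) [Field K] [Field L] [Algebra O K] [Algebra K L] [Algebra O L]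
    [Setup K L] {a b : Fin l × ℤ} (h : vK K b - vK K a = xx K) :
    b.1 = a.1 ∧ b.2 = a.2 + 1 :=
  vK_eq K (s := 1) (by rw [sub_eq_iff_eq_add] at h; rw [h, xx]; simp [add_comm])
    (Setup.inj (L := L))

theorem vK_succ (c : Fin l) (h : ℤ) : vK K (c, h + 1) = vK K (c, h) + xx K := by
  rw [vK, vK, xx, ← map_add]
  congr 1
  push_cast
  ring

theorem vL_ne {a b : Lab I l} (hab : a ≠ b) (h : ∃ c, a = .inl c ∨ b = .inl c) :
    vL K L a ≠ vL K L b := by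
  rcases a with a | a <;> rcases b with b | b
  · intro e
    exact hab (congrArg _ (vK_inj K L ((algebraMap K L).injective e)))
  · exact (τ_ne K L _).symm
  · exact τ_ne K L _
  · simp at h

/-- The off-diagonal seminormal coefficient. -/
def kap (a b : Lab I l) : L :=
  if linked a b then 0 else if resid κ a = resid κ b then 1 / (vL K L b - vL K L a)
    else if resid κ b = resid κ a + 1 then vL K L b - vL K L a - xx L else 1

/-- The diagonal seminormal coefficient. -/
def dd (a b : Lab I l) : L :=
  if resid κ a = resid κ b then 1 / (vL K L b - vL K L a) else 0

theorem kap_ne {a b : Lab I l} (h : ¬ linked a b) (hv : vL K L a ≠ vL K L b) :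
    kap κ K L a b ≠ 0 := by
  unfold kap
  rw [if_neg h]
  split_ifs
  · exact one_div_ne_zero (sub_ne_zero.2 hv.symm)
  · rw [sub_ne_zero]
    rcases a with a | a <;> rcases b with b | b
    · intro e
      apply h
      simp only [vL] at e
      rw [← map_sub, ← xx_tower K L] at e
      have := vK_sub_eq K L ((algebraMap K L).injective e)
      exact ⟨this.1.symm, .inr (.inl this.2)⟩
    · intro e
      simp only [vL] at e
      rw [sub_eq_iff_eq_add, ← xx_tower K L, ← map_add] at e
      exact τ_ne K L _ e
    · intro e
      simp only [vL] at e
      rw [sub_eq_iff_eq_add', ← sub_eq_iff_eq_add, ← xx_tower K L, ← map_sub] at e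
      exact τ_ne K L _ e.symm
    · simp [vL] at hv
  · exact one_ne_zero

theorem kap_linked {a b : Lab I l} (h : linked a b) : kap κ K L a b = 0 := by simp [kap, h]

variable [Nontrivial I]

theorem kap_mul {a b : Lab I l} (hv : vL K L a ≠ vL K L b) :
    kap κ K L a b * kap κ K L b a = Qv (resid κ a) (resid κ b) (vL K L a) (vL K L b) -
      dd κ K L a b ^ 2 := by
  have h1 : vL K L b - vL K L a ≠ 0 := sub_ne_zero.2 hv.symm
  have h2 : vL K L a - vL K L b ≠ 0 := sub_ne_zero.2 hv
  by_cases hl : linked a b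
  · rw [kap_linked κ K L hl, zero_mul]
    rcases a with a | a <;> rcases b with b | b <;> simp only [linked] at hl
    obtain ⟨a, s⟩ := a
    obtain ⟨b, u⟩ := b
    obtain ⟨e, h | h | h⟩ := hl <;> simp only at e h <;> subst e <;> subst h
    · exact absurd rfl hv
    · simp [Qv, dd, resid, vL, vK_succ, xx_tower, add_assoc, add_comm, add_left_comm]
    · simp [Qv, dd, resid, vL, vK_succ, xx_tower, add_assoc, add_comm, add_left_comm]
  · have hl' : ¬ linked b a := fun h => hl (linked_symm.1 h)
    simp only [kap, if_neg hl, if_neg hl', Qv, dd]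
    by_cases hr : resid κ a = resid κ b
    · simp only [hr, if_true]
      field_simp
      ring
    · have hr' : ¬ resid κ b = resid κ a := fun h => hr h.symm
      simp only [hr, hr', if_false]
      ring

end labels

section raw

variable {I : Type} [CommRing I] {l : ℕ} (κ : Fin l → I)
variable (K L : Type) [Field K] [Field L] [Algebra O K] [Algebra K L] [Algebra O L]
  [IsScalarTower O K L] [Setup K L]

/-- The space on which the seminormal operators act. -/
abbrev VV (I : Type) (l : ℕ) (L : Type) [Field L] := (ℕ → Lab I l) →₀ L

variable {L} in
/-- The basis vectors. -/
abbrev bv {I : Type} {l : ℕ} (t : ℕ → Lab I l) : VV I l L := Finsupp.single t 1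

/-- The seminormal operators. -/
def raw : G I → Module.End L (VV I l L)
  | .E i => Finsupp.linearCombination L fun t => if resid κ ∘ t = i then bv t else 0
  | .Y r => Finsupp.linearCombination L fun t => vL K L (t r) • bv t
  | .P r => Finsupp.linearCombination L fun t =>
      kap κ K L (t r) (t (r + 1)) • bv (sw r t) + dd κ K L (t r) (t (r + 1)) • bv t

@[simp] theorem raw_E (i : ℕ → I) (t : ℕ → Lab I l) :
    raw κ K L (.E i) (bv t) = if resid κ ∘ t = i then bv t else 0 := by simp [raw]
@[simp] theorem raw_Y (r : ℕ) (t : ℕ → Lab I l) :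
    raw κ K L (.Y r) (bv t) = vL K L (t r) • bv t := by simp [raw]
@[simp] theorem raw_P (r : ℕ) (t : ℕ → Lab I l) :
    raw κ K L (.P r) (bv t) = kap κ K L (t r) (t (r + 1)) • bv (sw r t) +
      dd κ K L (t r) (t (r + 1)) • bv t := by simp [raw]

/-- The seminormal operators cut down to the basis vectors in `T`. -/
def DT (n : ℕ) (T : Set (ℕ → Lab I l)) (g : G I) : Module.End L (VV I l L) :=
  if g ∈ gens I n then
    raw κ K L g ∘ₗ Finsupp.linearCombination L fun t => if t ∈ T then bv t else 0
  else 0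

/-- The span of the basis vectors in `T`. -/
def ST (T : Set (ℕ → Lab I l)) : Submodule L (VV I l L) := Submodule.span L (bv '' T)

/-- `T` is stable under the seminormal operators on `n` strands. -/
def Adm (n : ℕ) (T : Set (ℕ → Lab I l)) : Prop :=
  ∀ t ∈ T, ∀ r, r + 1 < n → sw r t ∉ T → linked (t r) (t (r + 1))

/-- Nearby labels of members of `T` have different values. -/
def Sep (n : ℕ) (T : Set (ℕ → Lab I l)) : Prop :=
  ∀ t ∈ T, (∀ r, r + 1 < n → vL K L (t r) ≠ vL K L (t (r + 1))) ∧
    ∀ r, r + 2 < n → vL K L (t r) ≠ vL K L (t (r + 2))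

variable {κ K L} {n : ℕ} {T : Set (ℕ → Lab I l)}

theorem bv_mem {t : ℕ → Lab I l} (ht : t ∈ T) : bv t ∈ ST L T :=
  Submodule.subset_span ⟨t, ht, rfl⟩

theorem DT_bv (g : G I) (hg : g ∈ gens I n) (t : ℕ → Lab I l) (ht : t ∈ T) :
    DT κ K L n T g (bv t) = raw κ K L g (bv t) := by simp [DT, hg, ht]

theorem DT_bv_not (g : G I) (t : ℕ → Lab I l) (ht : t ∉ T) :
    DT κ K L n T g (bv t) = 0 := by
  unfold DT; split_ifs <;> simp [ht]

theorem DT_ST (g : G I) (hg : g ∈ gens I n) {v : VV I l L} (hv : v ∈ ST L T) :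
    DT κ K L n T g v = raw κ K L g v := by
  induction hv using Submodule.span_induction with
  | mem v hv => obtain ⟨t, ht, rfl⟩ := hv; exact DT_bv g hg t ht
  | zero => simp
  | add u v _ _ hu hv => rw [map_add, map_add, hu, hv]
  | smul c v _ hv => rw [map_smul, map_smul, hv]

theorem raw_ST (h : Adm n T) (g : G I) (hg : g ∈ gens I n) {v : VV I l L} (hv : v ∈ ST L T) :
    raw κ K L g v ∈ ST L T := by
  induction hv using Submodule.span_induction with
  | mem v hv =>
    obtain ⟨t, ht, rfl⟩ := hv
    rcases hg with ⟨i, rfl⟩ | ⟨r, hr, rfl⟩ | ⟨r, hr, rfl⟩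
    · rw [raw_E]; split_ifs
      · exact bv_mem ht
      · exact zero_mem _
    · rw [raw_Y]; exact Submodule.smul_mem _ _ (bv_mem ht)
    · rw [raw_P]
      refine add_mem ?_ (Submodule.smul_mem _ _ (bv_mem ht))
      by_cases hs : sw r t ∈ T
      · exact Submodule.smul_mem _ _ (bv_mem hs)
      · rw [kap_linked κ K L (h t ht r hr hs), zero_smul]; exact zero_mem _
  | zero => simp
  | add u v _ _ hu hv => rw [map_add]; exact add_mem hu hv
  | smul c v _ hv => rw [map_smul]; exact Submodule.smul_mem _ _ hv

theorem ev_ST (h : Adm n T) {z : FF I} (hz : z ∈ FA (gens I n)) {v : VV I l L} (hv : v ∈ ST L T) :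
    ev (DT κ K L n T) z v = ev (raw κ K L) z v ∧ ev (raw κ K L) z v ∈ ST L T := by
  induction hz using Algebra.adjoin_induction generalizing v with
  | mem z hz =>
    obtain ⟨g, hg, rfl⟩ := hz
    simp only [ev, gen, FreeAlgebra.lift_ι_apply]
    exact ⟨DT_ST g hg hv, raw_ST h g hg hv⟩
  | algebraMap r =>
    rw [AlgHom.commutes, AlgHom.commutes, Module.algebraMap_end_apply]
    refine ⟨rfl, ?_⟩
    rw [algebra_compatible_smul L]
    exact Submodule.smul_mem _ _ hv
  | add a b _ _ ha hb =>
    rw [map_add, map_add, LinearMap.add_apply, LinearMap.add_apply, (ha hv).1, (hb hv).1]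
    exact ⟨rfl, add_mem (ha hv).2 (hb hv).2⟩
  | mul a b _ _ ha hb =>
    rw [map_mul, map_mul, Module.End.mul_apply, Module.End.mul_apply, (hb hv).1,
      (ha (hb hv).2).1]
    exact ⟨rfl, (ha (hb hv).2).2⟩

theorem DT_rel (h : Adm n T) {z w : FF I} (hz : z ∈ FA (gens I n)) (hw : w ∈ FA (gens I n))
    {g g' : G I} (hg : g ∈ gens I n) (hg' : g' ∈ gens I n)
    (H : ∀ t ∈ T, ev (raw κ K L) (z * gen g) (bv t) = ev (raw κ K L) (w * gen g') (bv t)) :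
    ev (DT κ K L n T) (z * gen g) = ev (DT κ K L n T) (w * gen g') := by
  refine Finsupp.lhom_ext' fun t => LinearMap.ext_ring ?_
  simp only [LinearMap.comp_apply, Finsupp.lsingle_apply]
  by_cases ht : t ∈ T
  · have m : ∀ g ∈ gens I n, gen g ∈ FA (gens I n) := fun g hg =>
      Algebra.subset_adjoin ⟨g, hg, rfl⟩
    rw [(ev_ST h (mul_mem hz (m g hg)) (bv_mem ht)).1, (ev_ST h (mul_mem hw (m g' hg')) (bv_mem ht)).1]
    exact H t ht
  · simp [ev, gen, DT_bv_not _ t ht]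

end raw

section coefficients

variable {I : Type} [CommRing I] {l : ℕ} (κ : Fin l → I)
variable (K L : Type) [Field K] [Field L] [Algebra O K] [Algebra K L] [Algebra O L]
  [IsScalarTower O K L] [Setup K L]

theorem dd_symm (a b : Lab I l) : dd κ K L b a = - dd κ K L a b := by
  unfold dd
  by_cases h : resid κ a = resid κ b
  · rw [if_pos h, if_pos h.symm, ← neg_sub (vL K L b), div_neg]
  · rw [if_neg h, if_neg (fun h' => h h'.symm), neg_zero]

theorem dd_braid {a b c : Lab I l} (hab : vL K L a ≠ vL K L b) (hbc : vL K L b ≠ vL K L c)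
    (hac : vL K L a ≠ vL K L c) :
    dd κ K L a b * dd κ K L b c = dd κ K L a c * (dd κ K L a b + dd κ K L b c) := by
  have h1 := sub_ne_zero.2 hab.symm
  have h2 := sub_ne_zero.2 hbc.symm
  have h3 := sub_ne_zero.2 hac.symm
  unfold dd
  by_cases h : resid κ a = resid κ b
  · by_cases h' : resid κ b = resid κ c
    · simp only [h, h', if_true]
      field_simp
      ring
    · simp [h, h']
  · by_cases h' : resid κ b = resid κ c
    · have : resid κ a ≠ resid κ c := fun e => h (e.trans h'.symm)
      simp [h, this]
    · simp [h, h']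

theorem braid_coeff [Nontrivial I] {a b c : Lab I l} (hab : vL K L a ≠ vL K L b)
    (hbc : vL K L b ≠ vL K L c) (hac : vL K L a ≠ vL K L c) :
    kap κ K L a b * kap κ K L b a * dd κ K L a c + dd κ K L a b ^ 2 * dd κ K L b c =
    kap κ K L b c * kap κ K L c b * dd κ K L a c + dd κ K L b c ^ 2 * dd κ K L a b +
      bt (resid κ a) (resid κ b) (resid κ c) (vL K L a) (vL K L b) (vL K L c) := by
  rw [kap_mul κ K L hab, kap_mul κ K L hbc]
  have E := dd_braid κ K L hab hbc hac
  by_cases h : resid κ c = resid κ a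
  · by_cases h' : resid κ a = resid κ b
    · simp only [Qv, bt, h', h.trans h', if_true]
      simp only [left_eq_add, one_ne_zero, if_false]
      linear_combination (dd κ K L a b - dd κ K L b c) * E
    · have h1 : dd κ K L a b = 0 := by simp [dd, h']
      have h2 : dd κ K L b c = 0 := by rw [dd, if_neg]; rw [h]; exact fun e => h' e.symm
      have h3 := sub_ne_zero.2 hac.symm
      have h4 : dd κ K L a c = 1 / (vL K L c - vL K L a) := by simp [dd, h]
      have h5 : ¬ resid κ b = resid κ a := fun e => h' e.symm
      rw [h1, h2, h4]
      simp only [Qv, bt, h, h', h5, if_true, if_false]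
      split_ifs <;> field_simp <;> ring
  · have h1 : dd κ K L a c = 0 := by rw [dd, if_neg]; exact fun e => h e.symm
    rw [h1, zero_mul] at E
    simp only [bt, h, h1, if_false]
    linear_combination (dd κ K L a b - dd κ K L b c) * E

end coefficients

section evaluation

variable {I : Type} [CommRing I] {A : Type*} [Ring A] [Algebra O A]

theorem ev_gen (D : G I → A) (g : G I) : ev D (gen g) = D g := FreeAlgebra.lift_ι_apply _ _

theorem ev_Qv (D : G I → A) (i j : I) (a b : FF I) :
    ev D (Qv i j a b) = Qv i j (ev D a) (ev D b) := map_Qv (ev D) i j a b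

theorem ev_bt (D : G I → A) (i j k : I) (a b c : FF I) :
    ev D (bt i j k a b c) = bt i j k (ev D a) (ev D b) (ev D c) := map_bt (ev D) i j k a b c

end evaluation

section rep

variable {I : Type} [CommRing I] {l : ℕ} {κ : Fin l → I}
variable {K L : Type} [Field K] [Field L] [Algebra O K] [Algebra K L] [Algebra O L]
  [IsScalarTower O K L] [Setup K L]

theorem xx_End (V : Type*) [AddCommGroup V] [Module L V] [Module O V] [IsScalarTower O L V]
    (v : V) : (xx (Module.End L V)) v = xx L • v := by
  rw [xx, xx, Module.algebraMap_end_apply, algebraMap_smul]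

theorem Qv_bv (i j : I) (r s : ℕ) (t : ℕ → Lab I l) :
    Qv i j (raw κ K L (.Y r)) (raw κ K L (.Y s)) (bv t) =
      Qv i j (vL K L (t r)) (vL K L (t s)) • bv t := by
  unfold Qv
  split_ifs <;> simp only [mul_one, one_mul, Module.End.mul_apply, LinearMap.sub_apply, raw_Y,
    xx_End, Module.End.one_apply, one_smul, zero_smul, LinearMap.zero_apply, ← sub_smul, map_smul,
    smul_smul]
  congr 1
  ring

theorem bt_bv (i j k : I) (r s q : ℕ) (t : ℕ → Lab I l) :
    bt i j k (raw κ K L (.Y r)) (raw κ K L (.Y s)) (raw κ K L (.Y q)) (bv t) =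
      bt i j k (vL K L (t r)) (vL K L (t s)) (vL K L (t q)) • bv t := by
  unfold bt
  split_ifs <;> simp [-Finsupp.smul_single, two_mul, sub_smul, add_smul]

variable {n : ℕ} {T : Set (ℕ → Lab I l)}

theorem isKLR_DT [Nontrivial I] (h : Adm n T) (hs : Sep (K := K) (L := L) n T) :
    IsKLR n (DT κ K L n T) := by
  have gE : ∀ i, G.E i ∈ gens I n := fun i => .inl ⟨i, rfl⟩
  have gY : ∀ r, r < n → G.Y r ∈ gens I n := fun r hr => .inr (.inl ⟨r, hr, rfl⟩)
  have gP : ∀ r, r + 1 < n → G.P r ∈ gens I n := fun r hr => .inr (.inr ⟨r, hr, rfl⟩)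
  have m : ∀ {g}, g ∈ gens I n → gen g ∈ FA (gens I n) := fun {g} hg =>
      Algebra.subset_adjoin ⟨g, hg, rfl⟩
  have one : (1 : FF I) ∈ FA (gens I n) := one_mem _
  constructor
  · intro i
    have := DT_rel (κ := κ) (K := K) (L := L) h (m (gE i)) one (gE i) (gE i) ?_
    · simpa using this
    · intro t _
      by_cases e : resid κ ∘ t = i <;> simp [e]
  · intro i j hij
    have := DT_rel (κ := κ) (K := K) (L := L) h (m (gE i)) (zero_mem _) (gE j) (gE j) ?_
    · simpa using this
    · intro t _
      by_cases e : resid κ ∘ t = j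
      · have : ¬ resid κ ∘ t = i := fun e' => hij (e'.symm.trans e)
        simp [e, hij.symm]
      · simp [e]
  · intro r i hr
    have := DT_rel (κ := κ) (K := K) (L := L) h (m (gY r hr)) (m (gE i)) (gE i) (gY r hr) ?_
    · simpa using this
    · intro t _
      by_cases e : resid κ ∘ t = i <;> simp [e, -Finsupp.smul_single]
  · intro r i hr
    have := DT_rel (κ := κ) (K := K) (L := L) h (m (gP r hr)) (m (gE (sw r i))) (gE i) (gP r hr) ?_
    · simpa using this
    · intro t _
      by_cases e : resid κ ∘ t = i
      · have : dd κ K L (t r) (t (r+1)) = 0 ∨ resid κ ∘ t = sw r i := by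
          by_cases e' : resid κ (t r) = resid κ (t (r + 1))
          · right
            rw [← e]
            exact (sw_eq_self (t := resid κ ∘ t) e').symm
          · left; simp [dd, e']
        rcases this with e' | e'
        · simp [e, e', -Finsupp.smul_single, sw_comp]
        · have e'' : i = sw r i := e.symm.trans e'
          simp [e, ← e'', -Finsupp.smul_single, sw_comp]
      · have : resid κ ∘ t ≠ sw r i ∨ dd κ K L (t r) (t (r+1)) = 0 := by
          by_cases e' : resid κ (t r) = resid κ (t (r + 1))
          · left
            intro e''
            apply e
            have := sw_eq_self (t := resid κ ∘ t) e'
            rw [← this, e'', sw_sw]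
          · right; simp [dd, e']
        rcases this with e' | e' <;>
        simp [e, e', -Finsupp.smul_single, sw_comp, sw_inj]
  · intro r s hr hs
    have := DT_rel (κ := κ) (K := K) (L := L) h (m (gY r hr)) (m (gY s hs)) (gY s hs) (gY r hr) ?_
    · simpa using this
    · intro t _
      simp [-Finsupp.smul_single, smul_smul, mul_comm]
  · intro r s hr hs h1 h2
    have := DT_rel (κ := κ) (K := K) (L := L) h (m (gP r hr)) (m (gY s hs)) (gY s hs) (gP r hr) ?_
    · simpa using this
    · intro t _
      simp [-Finsupp.smul_single, smul_smul, sw_ne r t s h1 h2, mul_comm]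
  · intro r s hr hs
    have := DT_rel (κ := κ) (K := K) (L := L) h (m (gP r (by omega))) (m (gP s hs)) (gP s hs)
      (gP r (by omega)) ?_
    · simpa using this
    · intro t _
      simp only [gen, ev, map_mul, FreeAlgebra.lift_ι_apply, Module.End.mul_apply, raw_P, map_add,
        map_smul, sw_ne r t s (by omega) (by omega), sw_ne r t (s+1) (by omega) (by omega),
        sw_ne s t r (by omega) (by omega), sw_ne s t (r+1) (by omega) (by omega),
        sw_far r s hr]
      module
  · intro r i hr
    have := DT_rel (κ := κ) (K := K) (L := L) h (mul_mem (m (gP r hr)) (m (gY (r+1) hr)))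
      (w := gen (.Y r) * gen (.P r) + if i r = i (r + 1) then 1 else 0)
      (add_mem (mul_mem (m (gY r (by omega))) (m (gP r hr)))
        (by split_ifs; exacts [one_mem _, zero_mem _])) (gE i) (gE i) ?_
    · split_ifs at this ⊢ <;> simpa using this
    · intro t ht
      have hv := sub_ne_zero.2 ((hs t ht).1 r hr).symm
      by_cases e : resid κ ∘ t = i
      · subst e
        simp only [Function.comp]
        by_cases e' : resid κ (t r) = resid κ (t (r + 1))
        · simp only [e', gen, ev, map_mul, map_add, map_one, FreeAlgebra.lift_ι_apply,
            Module.End.mul_apply, LinearMap.add_apply, raw_P, raw_Y, raw_E, Function.comp_def,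
            if_true, Module.End.one_apply, map_smul, sw_self, dd]
          have : (1 : L) / (vL K L (t (r+1)) - vL K L (t r)) * vL K L (t (r+1)) =
            1 / (vL K L (t (r+1)) - vL K L (t r)) * vL K L (t r) + 1 := by field_simp; ring
          linear_combination (norm := module) this • (bv t : VV I l L)
        · simp only [e', gen, ev, map_mul, map_add, map_zero, FreeAlgebra.lift_ι_apply,
            Module.End.mul_apply, LinearMap.add_apply, raw_P, raw_Y, raw_E, Function.comp_def,
            if_true, if_false, map_smul, sw_self, dd]
          simp only [LinearMap.zero_apply]
          module
      · simp [e]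
  · intro r i hr
    have := DT_rel (κ := κ) (K := K) (L := L) h (mul_mem (m (gY (r+1) hr)) (m (gP r hr)))
      (w := gen (.P r) * gen (.Y r) + if i r = i (r + 1) then 1 else 0)
      (add_mem (mul_mem (m (gP r hr)) (m (gY r (by omega))))
        (by split_ifs; exacts [one_mem _, zero_mem _])) (gE i) (gE i) ?_
    · split_ifs at this ⊢ <;> simpa using this
    · intro t ht
      have hv := sub_ne_zero.2 ((hs t ht).1 r hr).symm
      by_cases e : resid κ ∘ t = i
      · subst e
        simp only [Function.comp]
        by_cases e' : resid κ (t r) = resid κ (t (r + 1))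
        · simp only [e', gen, ev, map_mul, map_add, map_one, FreeAlgebra.lift_ι_apply,
            Module.End.mul_apply, LinearMap.add_apply, raw_P, raw_Y, raw_E, Function.comp_def,
            if_true, Module.End.one_apply, map_smul, sw_succ, dd]
          have : (1 : L) / (vL K L (t (r+1)) - vL K L (t r)) * vL K L (t (r+1)) =
            1 / (vL K L (t (r+1)) - vL K L (t r)) * vL K L (t r) + 1 := by field_simp; ring
          linear_combination (norm := module) this • (bv t : VV I l L)
        · simp only [e', gen, ev, map_mul, map_add, map_zero, FreeAlgebra.lift_ι_apply,
            Module.End.mul_apply, LinearMap.add_apply, raw_P, raw_Y, raw_E, Function.comp_def,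
            if_true, if_false, map_smul, sw_succ, dd]
          simp only [LinearMap.zero_apply]
          module
      · simp [e]
  · intro r i hr
    have mQ := adjoin_Qv (i r) (i (r+1)) (m (gY r (by omega))) (m (gY (r+1) hr))
    have := DT_rel (κ := κ) (K := K) (L := L) h (mul_mem (m (gP r hr)) (m (gP r hr)))
      mQ (gE i) (gE i) ?_
    · simpa [ev_Qv] using this
    · intro t ht
      by_cases e : resid κ ∘ t = i
      · subst e
        have k := kap_mul κ K L ((hs t ht).1 r hr)
        have d := dd_symm κ K L (t r) (t (r+1))
        simp only [map_mul, ev_Qv, ev_gen,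
            Module.End.mul_apply, raw_P, raw_E, Function.comp_def,
            if_true, map_smul, map_add, Qv_bv, sw_self, sw_succ, sw_sw, d]
        linear_combination (norm := module) k • (bv t : VV I l L)
      · simp [e]
  · intro r i hr
    have mQ := adjoin_bt (i r) (i (r+1)) (i (r+2)) (m (gY r (by omega))) (m (gY (r+1) (by omega)))
      (m (gY (r+2) hr))
    have p := m (gP r (by omega))
    have q := m (gP (r+1) hr)
    have := DT_rel (κ := κ) (K := K) (L := L) h (mul_mem (mul_mem p q) p)
      (add_mem (mul_mem (mul_mem q p) q) mQ) (gE i) (gE i) ?_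
    · simpa [ev_bt] using this
    · intro t ht
      by_cases e : resid κ ∘ t = i
      · subst e
        have k := braid_coeff κ K L ((hs t ht).1 r (by omega)) ((hs t ht).1 (r+1) hr)
          ((hs t ht).2 r hr)
        have D := dd_braid κ K L ((hs t ht).1 r (by omega)) ((hs t ht).1 (r+1) hr)
          ((hs t ht).2 r hr)
        have d := dd_symm κ K L (t r) (t (r+1))
        have d' := dd_symm κ K L (t (r+1)) (t (r+1+1))
        simp only [map_mul, ev_bt, ev_gen,
            Module.End.mul_apply, raw_P, raw_E, Function.comp_def,
            if_true, map_smul, map_add, bt_bv, LinearMap.add_apply, sw_apply, sw_sw, sw_braid]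
        simp only [← show r + 1 + 1 = r + 2 from rfl] at *
        simp only [show r ≠ r + 1 by omega,
          show r ≠ r + 2 by omega, show r + 1 ≠ r by omega,
          show r + 2 ≠ r by omega, show r + 2 ≠ r + 1 by omega, if_false, d, d']
        linear_combination (norm := module) k • (bv t : VV I l L) +
          (kap κ K L (t r) (t (r+1)) * D) • (bv (sw r t) : VV I l L) +
          (-kap κ K L (t (r+1)) (t (r+2)) * D) • (bv (sw (r+1) t) : VV I l L)
      · simp [e]

end rep

section states

variable {I : Type} {l : ℕ}

/-- The position before a position on the same component. -/
def prv (a : Fin l × ℤ) : Fin l × ℤ := (a.1, a.2 - 1)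

/-- Moving a bead to the position `a`. -/
def step (σ : Fin l × ℤ → Prop) : Lab I l → Fin l × ℤ → Prop
  | .inl a => fun b => b = a ∨ (b ≠ prv a ∧ σ b)
  | .inr _ => σ

/-- The bead configuration after `m` moves, starting from the vacuum. -/
def st (t : ℕ → Lab I l) : ℕ → Fin l × ℤ → Prop
  | 0 => fun b => b.2 < 0
  | m + 1 => step (st t m) (t m)

/-- A bead can be moved to `a`. -/
def Legal (σ : Fin l × ℤ → Prop) (a : Fin l × ℤ) : Prop := σ (prv a) ∧ ¬ σ a

/-- The first `m` labels form a legal sequence of moves. -/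
def StdU (m : ℕ) (t : ℕ → Lab I l) : Prop := ∀ q < m, ∃ a, t q = .inl a ∧ Legal (st t q) a

/-- Standard sequences of length `n`, with free strands afterwards. -/
def Std (n : ℕ) (t : ℕ → Lab I l) : Prop := StdU n t ∧ ∀ q, n ≤ q → ∃ k, t q = .inr k

theorem st_congr {t s : ℕ → Lab I l} {m : ℕ} (h : ∀ q < m, t q = s q) : st t m = st s m := by
  induction m with
  | zero => rfl
  | succ m ih => rw [st, st, ih fun q hq => h q (by omega), h m (by omega)]

theorem StdU.congr {t s : ℕ → Lab I l} {m : ℕ} (h : ∀ q < m, t q = s q) (ht : StdU m t) :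
    StdU m s := by
  intro q hq
  rw [← h q hq, ← st_congr fun p hp => h p (by omega)]
  exact ht q hq

theorem StdU.mono {t : ℕ → Lab I l} {m n : ℕ} (hmn : m ≤ n) (ht : StdU n t) : StdU m t :=
  fun q hq => ht q (by omega)

theorem prv_ne (a : Fin l × ℤ) : prv a ≠ a := fun h => by
  have := congrArg Prod.snd h
  simp [prv] at this

theorem linked_iff {a b : Fin l × ℤ} :
    linked (I := I) (.inl a) (.inl b) ↔ b = a ∨ a = prv b ∨ b = prv a := by
  obtain ⟨a, s⟩ := a
  obtain ⟨b, u⟩ := b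
  simp only [linked, prv, Prod.mk.injEq]
  constructor
  · rintro ⟨rfl, h | h | h⟩
    · simp [h]
    · right; left; simp [h]
    · right; right; simp [h]
  · rintro (⟨h, h'⟩ | ⟨h, h'⟩ | ⟨h, h'⟩)
    · exact ⟨h.symm, .inl h'⟩
    · exact ⟨h, .inr (.inl (by omega))⟩
    · exact ⟨h.symm, .inr (.inr (by omega))⟩

theorem prv_inj {a b : Fin l × ℤ} : prv a = prv b ↔ a = b := by
  simp [prv, Prod.ext_iff]

theorem prv_prv_ne (a : Fin l × ℤ) : prv (prv a) ≠ a := fun h => by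
  have := congrArg Prod.snd h
  simp [prv] at this
  omega

theorem Legal.not_linked_ne {σ : Fin l × ℤ → Prop} {a b : Fin l × ℤ} (ha : Legal σ a)
    (hb : Legal σ b) (hab : a ≠ b) : ¬ linked (I := I) (.inl a) (.inl b) := by
  rw [linked_iff]
  rintro (h | rfl | rfl)
  · exact hab h.symm
  · exact ha.2 hb.1
  · exact hb.2 ha.1

theorem Legal.step_ne {σ : Fin l × ℤ → Prop} {a b : Fin l × ℤ}
    (hb : Legal (step σ (.inl a : Lab I l)) b) : a ≠ b := by
  rintro rfl
  exact hb.2 (.inl rfl)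

theorem Legal.step_step_ne {σ : Fin l × ℤ → Prop} {a b c : Fin l × ℤ}
    (hc : Legal (step (step σ (.inl a : Lab I l)) (.inl b : Lab I l)) c) : a ≠ c := by
  rintro rfl
  obtain ⟨h1, h2⟩ := hc
  simp only [step] at h1 h2
  have := prv_ne a
  have := prv_prv_ne a
  rcases h1 with h1 | ⟨h1, h3 | h3⟩
  · subst h1
    apply h2
    right
    exact ⟨fun h => this h.symm, .inl trivial⟩
  · exact prv_ne a h3
  · exact h3.1 rfl

theorem legal_step_iff {σ : Fin l × ℤ → Prop} {a : Fin l × ℤ} {x : Lab I l}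
    (h : ¬ linked x (.inl a)) : Legal (step σ x) a ↔ Legal σ a := by
  rcases x with b | k
  · rw [linked_iff] at h
    push Not at h
    obtain ⟨h1, h2, h3⟩ := h
    simp only [Legal, step, h1, h3, false_or, ne_eq, not_false_eq_true, true_and,
      prv_inj, h2.symm]
  · rfl

theorem step_comm {σ : Fin l × ℤ → Prop} {x y : Lab I l} (h : ¬ linked x y) :
    step (step σ x) y = step (step σ y) x := by
  rcases x with a | k <;> rcases y with b | k'
  · rw [linked_iff] at h
    push Not at h
    obtain ⟨h1, h2, h3⟩ := h
    funext c
    simp only [step, eq_iff_iff]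
    constructor
    · rintro (rfl | ⟨h, rfl | ⟨h', h''⟩⟩)
      · exact .inr ⟨h3, .inl rfl⟩
      · exact .inl rfl
      · exact .inr ⟨h', .inr ⟨h, h''⟩⟩
    · rintro (rfl | ⟨h, rfl | ⟨h', h''⟩⟩)
      · exact .inr ⟨h2, .inl rfl⟩
      · exact .inl rfl
      · exact .inr ⟨h', .inr ⟨h, h''⟩⟩
  all_goals rfl

theorem not_linked_symm {x y : Lab I l} (h : ¬ linked x y) : ¬ linked y x :=
  fun h' => h (linked_symm.1 h')

theorem st_sw {r : ℕ} {t : ℕ → Lab I l} (h : ¬ linked (t r) (t (r + 1))) (q : ℕ)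
    (hq : q ≠ r + 1) : st (sw r t) q = st t q := by
  rcases Nat.lt_or_ge q (r + 1) with h1 | h1
  · exact st_congr fun p hp => sw_ne r t p (by omega) (by omega)
  · obtain ⟨p, rfl⟩ := Nat.exists_eq_add_of_lt (lt_of_le_of_ne h1 hq.symm)
    induction p with
    | zero =>
      simp only [st, sw_self, sw_succ]
      rw [st_congr fun p hp => sw_ne r t p (by omega) (by omega)]
      exact step_comm (not_linked_symm h)
    | succ p ih =>
      have e := ih (by omega) (by omega)
      rw [show r + 1 + (p + 1) + 1 = (r + 1 + p + 1) + 1 by omega, st, e, sw_ne r t _ (by omega) (by omega)]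
      rfl

theorem StdU.sw {n r : ℕ} {t : ℕ → Lab I l} (ht : StdU n t) (hr : r + 1 < n)
    (h : ¬ linked (t r) (t (r + 1))) : StdU n (sw r t) := by
  obtain ⟨a, ha, la⟩ := ht r (by omega)
  obtain ⟨b, hb, lb⟩ := ht (r + 1) hr
  have hab := h
  rw [ha, hb] at hab
  rw [st, legal_step_iff (by rwa [ha])] at lb
  intro q hq
  by_cases h1 : q = r
  · subst h1
    rw [sw_self, st_sw h _ (by omega)]
    exact ⟨b, hb, lb⟩
  by_cases h2 : q = r + 1
  · subst h2
    rw [sw_succ, st, st_sw h _ (by omega), sw_self]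
    exact ⟨a, ha, (legal_step_iff (by rw [hb]; exact not_linked_symm hab)).2 la⟩
  rw [sw_ne r t q h1 h2, st_sw h q h2]
  exact ht q hq

theorem StdU.not_sw {n r : ℕ} {t : ℕ → Lab I l} (ht : StdU n t) (hr : r + 1 < n)
    (h : linked (t r) (t (r + 1))) : ¬ StdU (r + 1) (DefKLR.sw r t) := by
  intro hs
  obtain ⟨a, ha, la⟩ := ht r (by omega)
  obtain ⟨b, hb, lb⟩ := ht (r + 1) hr
  obtain ⟨c, hc, lc⟩ := hs r (by omega)
  rw [sw_self, hb] at hc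
  rw [st_congr fun p hp => sw_ne r t p (by omega) (by omega)] at lc
  cases Sum.inl.inj hc
  rw [st, ha] at lb
  rw [ha, hb] at h
  exact la.not_linked_ne lc lb.step_ne h

theorem Std.sw {n r : ℕ} {t : ℕ → Lab I l} (ht : Std n t) (hr : r + 1 < n)
    (h : ¬ linked (t r) (t (r + 1))) : Std n (sw r t) := by
  refine ⟨ht.1.sw hr h, fun q hq => ?_⟩
  rw [sw_ne r t q (by omega) (by omega)]
  exact ht.2 q hq

theorem StdU.ne_succ {n r : ℕ} {t : ℕ → Lab I l} (ht : StdU n t) (hr : r + 1 < n) :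
    t r ≠ t (r + 1) := by
  obtain ⟨a, ha, la⟩ := ht r (by omega)
  obtain ⟨b, hb, lb⟩ := ht (r + 1) hr
  rw [st, ha] at lb
  rw [ha, hb]
  exact fun e => lb.step_ne (Sum.inl.inj e)

theorem StdU.ne_succ_succ {n r : ℕ} {t : ℕ → Lab I l} (ht : StdU n t) (hr : r + 2 < n) :
    t r ≠ t (r + 2) := by
  obtain ⟨a, ha, la⟩ := ht r (by omega)
  obtain ⟨b, hb, lb⟩ := ht (r + 1) (by omega)
  obtain ⟨c, hc, lc⟩ := ht (r + 2) hr
  rw [st, st, ha, hb] at lc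
  rw [ha, hc]
  exact fun e => lc.step_step_ne (Sum.inl.inj e)

theorem exists_last_move {t : ℕ → Lab I l} {m : ℕ} {b : Fin l × ℤ} (h : ¬ st t m (prv b))
    (h' : st t m b) : ∃ p < m, t p = .inl b ∧ ∀ q, p < q → q < m → ¬ linked (.inl b) (t q) := by
  induction m with
  | zero =>
    simp only [st, prv] at h h'
    omega
  | succ m ih =>
    by_cases hl : linked (.inl b) (t m)
    · rcases ha : t m with a | k
      · rw [ha, linked_iff] at hl
        rcases hl with rfl | rfl | rfl
        · exact ⟨m, by omega, ha, fun q h1 h2 => by omega⟩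
        · simp only [st, ha, step] at h'
          rcases h' with h' | h'
          · exact absurd h' (prv_ne _)
          · exact absurd rfl h'.1
        · simp [st, ha, step] at h
      · simp [ha, linked] at hl
    · have hst : st t (m + 1) (prv b) = st t m (prv b) ∧ st t (m + 1) b = st t m b := by
        rw [st]
        rcases ha : t m with a | k
        · rw [ha, linked_iff] at hl
          push Not at hl
          obtain ⟨h1, h2, h3⟩ := hl
          simp [step, h1.symm, h2, h3.symm, prv_inj]
        · simp [step]
      obtain ⟨p, hp, hpb, hq⟩ := ih (by rwa [← hst.1]) (by rwa [← hst.2])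
      refine ⟨p, by omega, hpb, fun q h1 h2 => ?_⟩
      rcases Nat.lt_succ_iff_lt_or_eq.1 h2 with h3 | rfl
      · exact hq q h1 h3
      · exact hl

end states

section vectors

variable {I : Type} [CommRing I] {l : ℕ} {κ : Fin l → I}
variable {K L : Type} [Field K] [Field L] [Algebra O K] [Algebra K L] [Algebra O L]
  [IsScalarTower O K L] [Setup K L]

theorem adm_Std (n : ℕ) : Adm n {t : ℕ → Lab I l | Std n t} := by
  intro t ht r hr hs
  by_contra h
  exact hs (Std.sw ht hr h)

theorem sep_Std (n : ℕ) : Sep (K := K) (L := L) n {t : ℕ → Lab I l | Std n t} := by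
  intro t ht
  refine ⟨fun r hr => ?_, fun r hr => ?_⟩
  · obtain ⟨a, ha, -⟩ := ht.1 r (by omega)
    exact vL_ne K L (ht.1.ne_succ hr) ⟨a, .inl ha⟩
  · obtain ⟨a, ha, -⟩ := ht.1 r (by omega)
    exact vL_ne K L (ht.1.ne_succ_succ hr) ⟨a, .inl ha⟩

end vectors

section polynomials

variable {K M : Type*} [Field K] [AddCommGroup M] [Module K M]

open Polynomial

theorem aeval_mem {y : Module.End K M} {W : Submodule K M} (hW : ∀ u ∈ W, y u ∈ W)
    (p : K[X]) {u : M} (hu : u ∈ W) : aeval y p u ∈ W := by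
  induction p using Polynomial.induction_on' with
  | add p q hp hq => rw [map_add]; exact add_mem hp hq
  | monomial k a =>
    rw [aeval_monomial, Module.End.mul_apply, Module.algebraMap_end_apply]
    refine W.smul_mem _ ?_
    induction k with
    | zero => simpa using hu
    | succ k ih => rw [pow_succ', Module.End.mul_apply]; exact hW _ ih

theorem aeval_intertwine {f y y' : Module.End K M} {W : Submodule K M} (hW : ∀ u ∈ W, y u ∈ W)
    (h : ∀ u ∈ W, f (y u) = y' (f u)) (p : K[X]) {u : M} (hu : u ∈ W) :
    f (aeval y p u) = aeval y' p (f u) := by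
  induction p using Polynomial.induction_on' with
  | add p q hp hq => simp [hp, hq]
  | monomial k a =>
    simp only [aeval_monomial, Module.End.mul_apply, Module.algebraMap_end_apply, map_smul]
    congr 1
    have : ∀ k, (y ^ k) u ∈ W ∧ f ((y ^ k) u) = (y' ^ k) (f u) := by
      intro k
      induction k with
      | zero => simpa using hu
      | succ k ih =>
        rw [pow_succ', pow_succ', Module.End.mul_apply, Module.End.mul_apply, h _ ih.1, ih.2]
        exact ⟨hW _ ih.1, rfl⟩
    exact (this k).2

theorem aeval_eigen {y : Module.End K M} {u : M} {a : K} (h : y u = a • u) (p : K[X]) :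
    aeval y p u = p.eval a • u := by
  induction p using Polynomial.induction_on' with
  | add p q hp hq => simp [hp, hq, add_smul]
  | monomial k b =>
    have : (y ^ k) u = a ^ k • u := by
      induction k with
      | zero => simp
      | succ k ih =>
        rw [pow_succ', Module.End.mul_apply, ih, map_smul, h, smul_smul, pow_succ]
    simp [aeval_monomial, this, smul_smul, mul_comm]

end polynomials

section increments

open Polynomial

variable {I : Type} [CommRing I] {l : ℕ} (κ : Fin l → I)
variable {K : Type} [Field K] [Algebra O K]
variable {M : Type} [AddCommGroup M] [Module K M] [Module O M] [IsScalarTower O K M]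

/-- A sequence of contents as a sequence of labels. -/
def lab (I : Type) {l : ℕ} (c : ℕ → Fin l × ℤ) (q : ℕ) : Lab I l := .inl (c q)

/-- The residue of a content. -/
def rs (a : Fin l × ℤ) : I := resid κ (.inl a)

/-- Weight vectors for the first `m` dots. -/
def Wt (D : G I → Module.End K M) (m : ℕ) (i : ℕ → I) (c : ℕ → Fin l × ℤ) (v : M) : Prop :=
  D (.E i) v = v ∧ ∀ q < m, D (.Y q) v = vK K (c q) • v

/-- The polynomial with simple roots at the values of the contents in `S`. -/
def pS (K : Type) [Field K] [Algebra O K] (S : Finset (Fin l × ℤ)) : K[X] :=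
  ∏ B ∈ S, (X - C (vK K B))

/-- The next dot acts with simple eigenvalues at legal contents. -/
def Inc (D : G I → Module.End K M) (m : ℕ) : Prop :=
  ∀ (i : ℕ → I) (c : ℕ → Fin l × ℤ) (v : M), StdU m (lab I c) → (∀ q < m, i q = rs κ (c q)) →
    Wt D m i c v → ∃ S : Finset (Fin l × ℤ), (∀ B ∈ S, Legal (st (lab I c) m) B ∧ rs κ B = i m) ∧
      aeval (D (.Y m)) (pS K S) v = 0

variable {κ} {D : G I → Module.End K M} {n m r : ℕ} {i : ℕ → I} {c : ℕ → Fin l × ℤ} {v u : M}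

theorem Wt.mono {m' : ℕ} (h : Wt D m i c v) (hm : m' ≤ m) : Wt D m' i c v :=
  ⟨h.1, fun q hq => h.2 q (by omega)⟩

theorem lab_sw (r : ℕ) (c : ℕ → Fin l × ℤ) : lab I (sw r c) = sw r (lab I c) := rfl

theorem pS_eval_eq_zero (hK : Function.Injective (algebraMap O K)) {S : Finset (Fin l × ℤ)}
    {B : Fin l × ℤ} (h : (pS K S).eval (vK K B) = 0) : B ∈ S := by
  rw [pS, eval_prod, Finset.prod_eq_zero_iff] at h
  obtain ⟨B', hB', h⟩ := h
  simp only [eval_sub, eval_X, eval_C] at h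
  have := vK_eq K (a := B) (b := B') (s := 0) (by simpa using sub_eq_zero.1 h) hK
  have : B = B' := Prod.ext this.1 (by simpa using this.2)
  rwa [this]

theorem nonStd (hK : Function.Injective (algebraMap O K)) (hI : ∀ q < m, Inc κ D q)
    (hv : Wt D m i c v) (hv0 : v ≠ 0) :
    StdU m (lab I c) ∧ ∀ q < m, i q = rs κ (c q) := by
  induction m with
  | zero => exact ⟨fun q hq => by omega, fun q hq => by omega⟩
  | succ m ih =>
    obtain ⟨h1, h2⟩ := ih (fun q hq => hI q (by omega)) (hv.mono (by omega))
    obtain ⟨S, hS, h⟩ := hI m (by omega) i c v h1 h2 (hv.mono (by omega))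
    rw [aeval_eigen (hv.2 m (by omega)), smul_eq_zero] at h
    have := hS _ (pS_eval_eq_zero hK (h.resolve_right hv0))
    constructor
    · intro q hq
      rcases Nat.lt_succ_iff_lt_or_eq.1 hq with h | rfl
      · exact h1 q h
      · exact ⟨c q, rfl, this.1⟩
    · intro q hq
      rcases Nat.lt_succ_iff_lt_or_eq.1 hq with h | rfl
      · exact h2 q h
      · exact this.2.symm

theorem app {a b : Module.End K M} (h : a = b) (v : M) : a v = b v := by rw [h]

theorem Wt.swap (hD : IsKLR n D) (hm : m ≤ n) (hr : r + 1 < n) (hv : Wt D m i c v) (hrm : r + 1 < m)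
    (hc : vK K (c r) ≠ vK K (c (r + 1))) {d : K}
    (hd : d = if i r = i (r + 1) then 1 / (vK K (c (r + 1)) - vK K (c r)) else 0) :
    Wt D m (sw r i) (sw r c) (D (.P r) v - d • v) := by
  have hne := sub_ne_zero.2 hc.symm
  have e1 := app (hD.PYh r i hr) v
  have e2 := app (hD.YPh r i hr) v
  have eP := app (hD.PE r i hr) v
  simp only [Module.End.mul_apply, hv.1] at e1 e2 eP
  rw [hv.2 _ hrm] at e1
  rw [LinearMap.add_apply, Module.End.mul_apply] at e1 e2
  rw [hv.2 r (by omega)] at e2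
  refine ⟨?_, fun q hq => ?_⟩
  · rw [map_sub, map_smul, ← eP, hd]
    split_ifs with h
    · rw [sw_eq_self h, hv.1]
    · simp
  · by_cases h1 : q = r
    · subst h1
      rw [sw_self, map_sub, map_smul, hv.2 q (by omega)]
      rw [map_smul] at e1
      rw [smul_sub, e1, hd]
      split_ifs with h
      · simp only [Module.End.one_apply]
        match_scalars <;> field_simp
        ring
      · simp
    by_cases h2 : q = r + 1
    · subst h2
      rw [sw_succ, map_sub, map_smul, hv.2 _ hq, e2, map_smul, smul_sub, hd]
      split_ifs with h
      · simp only [Module.End.one_apply]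
        match_scalars <;> field_simp
        ring
      · simp
    · have e3 := app (hD.PY r q hr (by omega) h1 h2) v
      simp only [Module.End.mul_apply] at e3
      rw [sw_ne r c q h1 h2, map_sub, map_smul, ← e3, hv.2 q hq, map_smul, smul_sub, smul_comm]

theorem xx_EndK (v : M) : (xx (Module.End K M)) v = xx K • v := by
  rw [xx, xx, Module.algebraMap_end_apply, algebraMap_smul]

theorem Qv_apply (i j : I) {y y' : Module.End K M} {a b : K} {v : M} (h : y v = a • v)
    (h' : y' v = b • v) : Qv i j y y' v = Qv i j a b • v := by
  unfold Qv
  split_ifs <;> simp only [mul_one, one_mul, Module.End.mul_apply, LinearMap.sub_apply, h, h',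
    xx_EndK, Module.End.one_apply, one_smul, zero_smul, LinearMap.zero_apply, ← sub_smul, map_smul,
    smul_smul]
  congr 1
  ring

theorem bt_apply (i j k : I) {y y' y'' : Module.End K M} {a b c : K} {v : M} (h : y v = a • v)
    (h' : y' v = b • v) (h'' : y'' v = c • v) :
    bt i j k y y' y'' v = bt i j k a b c • v := by
  unfold bt
  split_ifs <;> simp [two_mul, sub_smul, add_smul, h, h', h'']

theorem Qv_sub_ne [Nontrivial I] (hK : Function.Injective (algebraMap O K)) {a b : Fin l × ℤ}
    (h : ¬ linked (I := I) (.inl a) (.inl b)) {d : K}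
    (hd : d = if rs κ a = rs κ b then 1 / (vK K b - vK K a) else 0) :
    Qv (rs κ a) (rs κ b) (vK K a) (vK K b) - d ^ 2 ≠ 0 := by
  have hab : vK K a ≠ vK K b := by
    intro e
    have := vK_eq K (s := 0) (by simpa using e) hK
    exact h ⟨this.1, .inl (by simpa using this.2.symm)⟩
  have h1 : vK K b - vK K a - xx K ≠ 0 := by
    intro e
    have := vK_eq K (a := b) (b := a) (s := 1) (by
      rw [sub_eq_zero, sub_eq_iff_eq_add'] at e; rw [e]; simp [xx]) hK
    exact h ⟨this.1.symm, .inr (.inl this.2)⟩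
  have h2 : vK K a - vK K b - xx K ≠ 0 := by
    intro e
    have := vK_eq K (a := a) (b := b) (s := 1) (by
      rw [sub_eq_zero, sub_eq_iff_eq_add'] at e; rw [e]; simp [xx]) hK
    exact h ⟨this.1, .inr (.inr this.2)⟩
  rw [hd]
  unfold Qv
  by_cases hr : rs κ a = rs κ b
  · simp only [hr, if_true, zero_sub, ne_eq, neg_eq_zero]
    exact pow_ne_zero 2 (one_div_ne_zero (sub_ne_zero.2 hab.symm))
  · simp only [hr, if_false]
    split_ifs <;> simp [h1, h2]

theorem Wt.swap_inj [Nontrivial I] (hK : Function.Injective (algebraMap O K)) (hD : IsKLR n D)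
    (hr : r + 1 < n) (hv : Wt D m i c v) (hrm : r + 1 < m)
    (hc : ¬ linked (I := I) (.inl (c r)) (.inl (c (r + 1)))) (hi : i r = rs κ (c r))
    (hi' : i (r + 1) = rs κ (c (r + 1))) {d : K}
    (hd : d = if i r = i (r + 1) then 1 / (vK K (c (r + 1)) - vK K (c r)) else 0)
    (h0 : D (.P r) v - d • v = 0) : v = 0 := by
  have e := app (hD.sq r i hr) v
  simp only [Module.End.mul_apply, hv.1] at e
  rw [Qv_apply _ _ (hv.2 r (by omega)) (hv.2 _ hrm), sub_eq_zero.1 h0, map_smul,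
    sub_eq_zero.1 h0, smul_smul, ← sub_eq_zero, ← sub_smul, smul_eq_zero] at e
  refine e.resolve_left fun h => ?_
  rw [hi, hi'] at hd h
  exact Qv_sub_ne hK hc hd (by rw [← neg_sub, pow_two, h, neg_zero])

theorem bt_ne [Nontrivial I] (hK : Function.Injective (algebraMap O K)) {A B : Fin l × ℤ}
    (h : linked (I := I) (.inl B) (.inl A)) (hAB : B ≠ A) :
    bt (rs κ B) (rs κ A) (rs κ B) (vK K B) (vK K A) (vK K B) ≠ 0 := by
  obtain ⟨b, s⟩ := B
  obtain ⟨a, w⟩ := A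
  obtain ⟨e, h⟩ := h
  simp only at e h
  subst e
  have hx : (2 : K) * xx K ≠ 0 := by
    rw [xx, ← map_ofNat (algebraMap O K) 2, ← map_mul, Ne, ← map_zero (algebraMap O K)]
    intro h
    have := hK h
    simp at this
  have key : ∀ h : ℤ, vK K (b, h + 1) = vK K (b, h) + xx K := by
    intro h
    rw [vK, vK, xx, ← map_add]
    congr 1
    push_cast
    ring
  unfold bt
  rcases h with rfl | rfl | rfl
  · exact absurd rfl hAB
  · have : rs κ (b, s + 1) = rs κ (b, s) + 1 := by simp [rs, resid]; ring
    simp only [this, if_true]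
    split_ifs
    · rw [key]; intro h; apply hx; linear_combination -h
    · exact one_ne_zero
  · have : rs κ (b, w + 1) = rs κ (b, w) + 1 := by simp [rs, resid]; ring
    simp only [this, if_true]
    split_ifs
    · rw [key]; intro h; apply hx; linear_combination h
    · exact neg_ne_zero.2 one_ne_zero

theorem linked_ne_resid [Nontrivial I] {A B : Fin l × ℤ}
    (h : linked (I := I) (.inl B) (.inl A)) (hAB : B ≠ A) : rs κ B ≠ rs κ A := by
  obtain ⟨b, s⟩ := B
  obtain ⟨a, w⟩ := A
  obtain ⟨e, h⟩ := h
  simp only at e h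
  subst e
  rcases h with rfl | rfl | rfl
  · exact absurd rfl hAB
  · simp [rs, resid]
  · simp [rs, resid]

theorem vK_ne_of_not_linked (hK : Function.Injective (algebraMap O K)) {a b : Fin l × ℤ}
    (h : ¬ linked (I := I) (.inl a) (.inl b)) : vK K a ≠ vK K b := by
  intro e
  have := vK_eq K (s := 0) (by simpa using e) hK
  exact h ⟨this.1, .inl (by simpa using this.2.symm)⟩

theorem vK_ne_of_ne (hK : Function.Injective (algebraMap O K)) {a b : Fin l × ℤ}
    (h : a ≠ b) : vK K a ≠ vK K b := by
  intro e
  have := vK_eq K (s := 0) (by simpa using e) hK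
  exact h (Prod.ext this.1 (by simpa using this.2))

theorem vanish [Nontrivial I] (hK : Function.Injective (algebraMap O K)) (hD : IsKLR n D)
    (hr : r + 1 < n) (hI : ∀ q ≤ r, Inc κ D q) {p : ℕ} (hp : p < r)
    (hs : StdU (r + 1) (lab I c)) (hi : ∀ q < r + 2, i q = rs κ (c q))
    (hl : linked (I := I) (.inl (c p)) (.inl (c r))) (hne : c p ≠ c r)
    (hun : ∀ q, p < q → q < r → ¬ linked (I := I) (.inl (c p)) (.inl (c q)))
    (hc : c (r + 1) = c p) (hu : Wt D (r + 2) i c u) : u = 0 := by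
  obtain ⟨d, hrd⟩ : ∃ d, r = p + 1 + d := ⟨r - (p + 1), by omega⟩
  induction d generalizing p u i c with
  | zero =>
    obtain rfl : r = p + 1 := by omega
    have i1 : i p ≠ i (p + 1) := by
      rw [hi p (by omega), hi (p + 1) (by omega)]; exact linked_ne_resid hl hne
    have i2 : i (p + 1) ≠ i (p + 1 + 1) := by
      rw [hi (p + 1 + 1) (by omega), hi (p + 1) (by omega), hc]
      exact (linked_ne_resid hl hne).symm
    have v1 := hu.swap hD (by omega) (r := p) (by omega) (by omega) (vK_ne_of_ne hK hne)
      (if_neg i1).symm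
    have v2 := hu.swap hD (by omega) (r := p + 1) (by omega) (by omega)
      (by rw [hc]; exact vK_ne_of_ne hK hne.symm) (if_neg i2).symm
    rw [zero_smul, sub_zero] at v1 v2
    have z1 : D (.P p) u = 0 := by
      by_contra h
      have := (nonStd hK (fun q hq => hI q (by omega)) (v1.mono (m' := p + 1) (by omega)) h).1
      exact hs.not_sw (r := p) (by omega) hl this
    have z2 : D (.P (p + 1)) u = 0 := by
      by_contra h
      have := (nonStd hK (fun q hq => hI q (by omega)) (v2.mono (m' := p + 2) (by omega)) h).1
      refine this.ne_succ (r := p) (by omega) ?_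
      rw [lab_sw, sw_self, sw_ne _ _ _ (by omega) (by omega), lab, lab, hc]
    have e := app (hD.br p i (by omega)) u
    simp only [Module.End.mul_apply, hu.1, LinearMap.add_apply, z1, z2, map_zero, zero_add] at e
    rw [bt_apply _ _ _ (hu.2 p (by omega)) (hu.2 (p + 1) (by omega)) (hu.2 (p + 2) (by omega)),
      hi p (by omega), hi (p + 1) (by omega), hi (p + 2) (by omega), hc] at e
    exact (smul_eq_zero.1 e.symm).resolve_left (bt_ne hK hl hne)
  | succ d ih =>
    have hnl := hun (p + 1) (by omega) (by omega)
    refine hu.swap_inj hK hD (r := p) (by omega) (by omega) hnl (hi _ (by omega))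
      (hi _ (by omega)) rfl ?_
    have w := hu.swap hD (by omega) (r := p) (by omega) (by omega)
      (vK_ne_of_not_linked hK hnl) rfl
    have cp : ∀ q, p + 1 < q → sw p c q = c q := fun q hq => sw_ne _ _ _ (by omega) (by omega)
    refine ih (p := p + 1) (c := sw p c) (i := sw p i) (by omega) ?_ ?_ ?_ ?_ ?_ ?_ w (by omega)
    · exact hs.sw (by omega) hnl
    · intro q hq
      simp only [sw_apply]
      split_ifs <;> exact hi _ (by omega)
    · rw [sw_succ, cp _ (by omega)]; exact hl
    · rw [sw_succ, cp _ (by omega)]; exact hne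
    · intro q h1 h2
      rw [sw_succ, cp q h1]; exact hun q (by omega) h2
    · rw [sw_succ, cp _ (by omega)]; exact hc

end increments

section increments

open Polynomial

variable {I : Type} [CommRing I] {l : ℕ} {κ : Fin l → I}
variable {K : Type} [Field K] [Algebra O K]
variable {M : Type} [AddCommGroup M] [Module K M] [Module O M] [IsScalarTower O K M]
variable {D : G I → Module.End K M} {n m r : ℕ} {i : ℕ → I} {c : ℕ → Fin l × ℤ} {v u : M}

/-- The next position on the same component. -/
def nxt (a : Fin l × ℤ) : Fin l × ℤ := (a.1, a.2 + 1)

theorem prv_nxt (a : Fin l × ℤ) : prv (nxt a) = a := by simp [prv, nxt]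

theorem vK_nxt (a : Fin l × ℤ) : vK K (nxt a) = vK K a + xx K := vK_succ K a.1 a.2

theorem vK_prv (a : Fin l × ℤ) : vK K (prv a) = vK K a - xx K := by
  have := vK_nxt (K := K) (prv a)
  rw [show nxt (prv a) = a by simp [prv, nxt]] at this
  rw [this]; ring

theorem rs_nxt (a : Fin l × ℤ) : rs κ (nxt a) = rs κ a + 1 := by
  simp [rs, resid, nxt]; ring

theorem rs_prv (a : Fin l × ℤ) : rs κ (prv a) = rs κ a - 1 := by
  simp [rs, resid, prv]; ring

theorem aeval_pS_comm {f y : Module.End K M} (h : f * y = y * f) (p : K[X]) (v : M) :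
    f (aeval y p v) = aeval y p (f v) :=
  aeval_intertwine (W := ⊤) (fun _ _ => trivial) (fun u _ => app h u) p trivial

theorem aeval_X_sub {y : Module.End K M} (a : K) (v : M) : aeval y (X - C a) v = y v - a • v := by
  simp

theorem Wt.aeval (hD : IsKLR n D) (hm : m < n) (hv : Wt D m i c v) (p : K[X]) :
    Wt D m i c (aeval (D (.Y m)) p v) := by
  refine ⟨?_, fun q hq => ?_⟩
  · rw [aeval_pS_comm (hD.YE m i hm).symm, hv.1]
  · rw [aeval_pS_comm (hD.YY q m (by omega) hm), hv.2 q hq, map_smul]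

/-- The next content repeats an earlier one without the necessary move in between. -/
def Blocked (I : Type) {l : ℕ} (c : ℕ → Fin l × ℤ) (r : ℕ) (B : Fin l × ℤ) : Prop :=
  ∃ p < r, c p = B ∧ linked (I := I) (.inl (c p)) (.inl (c r)) ∧ c p ≠ c r ∧
    ∀ q, p < q → q < r → ¬ linked (I := I) (.inl (c p)) (.inl (c q))

theorem prune [Nontrivial I] (hK : Function.Injective (algebraMap O K)) (hD : IsKLR n D)
    (hr : r + 1 < n) (hI : ∀ q ≤ r, Inc κ D q) (hs : StdU (r + 1) (lab I c))
    (hi : ∀ q < r + 1, i q = rs κ (c q)) (S : Finset (Fin l × ℤ)) :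
    ∀ v : M, Wt D (r + 1) i c v → (∀ B ∈ S, rs κ B = i (r + 1) ∧
      (Legal (st (lab I c) (r + 1)) B ∨ Blocked I c r B)) →
    aeval (D (.Y (r + 1))) (pS K S) v = 0 →
    ∃ S : Finset (Fin l × ℤ), (∀ B ∈ S, Legal (st (lab I c) (r + 1)) B ∧ rs κ B = i (r + 1)) ∧
      aeval (D (.Y (r + 1))) (pS K S) v = 0 := by
  induction S using Finset.strongInduction with
  | H S ih =>
    intro v hv hS h0
    by_cases hall : ∀ B ∈ S, Legal (st (lab I c) (r + 1)) B
    · exact ⟨S, fun B hB => ⟨hall B hB, (hS B hB).1⟩, h0⟩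
    push Not at hall
    obtain ⟨B, hB, hBl⟩ := hall
    obtain ⟨p, hp, rfl, hl, hne, hun⟩ := (hS B hB).2.resolve_left hBl
    refine ih (S.erase (c p)) (Finset.erase_ssubset hB) v hv
      (fun B' hB' => hS B' (Finset.mem_of_mem_erase hB')) ?_
    have hu := hv.aeval hD hr (pS K (S.erase (c p)))
    have hc : ∀ q, q ≤ r → Function.update c (r + 1) (c p) q = c q := fun q hq =>
      Function.update_of_ne (by omega) _ _
    refine vanish (c := Function.update c (r + 1) (c p)) (i := i) (p := p) hK hD hr hI hp ?_ ?_ ?_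
      ?_ ?_ ?_ ?_
    · exact hs.congr fun q hq => by rw [lab, lab, hc q (by omega)]
    · intro q hq
      rcases Nat.lt_succ_iff_lt_or_eq.1 hq with h | rfl
      · rw [hc q (by omega)]; exact hi q h
      · rw [Function.update_self]; exact (hS _ hB).1.symm
    · rw [hc p hp.le, hc r le_rfl]; exact hl
    · rw [hc p hp.le, hc r le_rfl]; exact hne
    · intro q h1 h2
      rw [hc p hp.le, hc q h2.le]; exact hun q h1 h2
    · rw [Function.update_self, hc p hp.le]
    · refine ⟨hu.1, fun q hq => ?_⟩
      rcases Nat.lt_succ_iff_lt_or_eq.1 hq with h | rfl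
      · rw [hc q (by omega)]; exact hu.2 q h
      · rw [Function.update_self, ← sub_eq_zero, ← aeval_X_sub, ← Module.End.mul_apply, ← map_mul,
          pS, Finset.mul_prod_erase S (fun B => X - C (vK K B)) hB]
        exact h0

theorem legal_or_blocked {A B : Fin l × ℤ} (hs : StdU (r + 1) (lab I c)) (hA : c r = A)
    (hB : B = nxt A ∨ B = prv A) : Legal (st (lab I c) (r + 1)) B ∨ Blocked I c r B := by
  subst hA
  obtain ⟨a, ha, hl⟩ := hs r (by omega)
  obtain rfl := Sum.inl.inj ha
  by_cases hL : Legal (st (lab I c) (r + 1)) B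
  · exact .inl hL
  right
  have hst : st (lab I c) (r + 1) = step (st (lab I c) r) (.inl (c r) : Lab I l) := rfl
  have key : st (lab I c) r B ∧ ¬ st (lab I c) r (prv B) := by
    rcases hB with rfl | rfl
    · rw [prv_nxt]
      refine ⟨?_, hl.2⟩
      by_contra h
      apply hL
      rw [hst, Legal, prv_nxt]
      refine ⟨.inl rfl, ?_⟩
      rintro (h' | h')
      · have := prv_ne (nxt (c r))
        rw [prv_nxt] at this
        exact this h'.symm
      · exact h h'.2
    · refine ⟨hl.1, fun h => hL ?_⟩
      rw [hst, Legal]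
      refine ⟨.inr ⟨prv_ne _, h⟩, ?_⟩
      rintro (h' | h')
      · exact prv_ne _ h'
      · exact h'.1 rfl
  obtain ⟨p, hp, hpb, hun⟩ := exists_last_move key.2 key.1
  obtain rfl : c p = B := Sum.inl.inj hpb
  refine ⟨p, hp, rfl, ?_, ?_, hun⟩
  · rw [linked_iff]
    rcases hB with h | h
    · right; right; rw [h, prv_nxt]
    · right; left; exact h
  · rcases hB with h | h
    · rw [h]
      intro e
      have := prv_ne (nxt (c r))
      rw [prv_nxt] at this
      exact this e.symm
    · rw [h]; exact prv_ne _

theorem Qv_pS [Nontrivial I] {y y' : Module.End K M} (h : y * y' = y' * y) (A : Fin l × ℤ) {j : I}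
    (hj : rs κ A ≠ j) : ∃ Ex : Finset (Fin l × ℤ),
      (∀ B ∈ Ex, rs κ B = j ∧ (B = nxt A ∨ B = prv A)) ∧
      ∀ u : M, y u = vK K A • u → Qv (rs κ A) j y y' u = 0 → aeval y' (pS K Ex) u = 0 := by
  have hne : nxt A ≠ prv A := by
    intro e
    have := congrArg Prod.snd e
    simp [nxt, prv] at this
    omega
  have a1 : ∀ u : M, y u = vK K A • u →
      aeval y' (X - C (vK K (nxt A))) u = (y' - y - xx (Module.End K M)) u := by
    intro u hu
    rw [aeval_X_sub, vK_nxt, LinearMap.sub_apply, LinearMap.sub_apply, hu, xx_EndK]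
    module
  have a2 : ∀ u : M, y u = vK K A • u →
      aeval y' (X - C (vK K (prv A))) u = - (y - y' - xx (Module.End K M)) u := by
    intro u hu
    rw [aeval_X_sub, vK_prv, LinearMap.sub_apply, LinearMap.sub_apply, hu, xx_EndK]
    module
  unfold Qv
  rw [if_neg hj]
  by_cases h1 : j = rs κ A + 1 <;> by_cases h2 : rs κ A = j + 1
  · refine ⟨{nxt A, prv A}, ?_, fun u hu h0 => ?_⟩
    · intro B hB
      rcases Finset.mem_insert.1 hB with rfl | hB
      · exact ⟨by rw [rs_nxt, h1], .inl rfl⟩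
      · rw [Finset.mem_singleton] at hB
        subst hB
        exact ⟨by rw [rs_prv, h2]; ring, .inr rfl⟩
    · rw [if_pos h1, if_pos h2, Module.End.mul_apply] at h0
      rw [pS, Finset.prod_pair hne, map_mul, Module.End.mul_apply, a2 u hu, map_neg,
        neg_eq_zero, a1, h0]
      simp only [LinearMap.sub_apply, map_sub, hu, map_smul, xx_EndK]
      have := app h u
      simp only [Module.End.mul_apply] at this
      rw [this, hu, map_smul]
      module
  · refine ⟨{nxt A}, ?_, fun u hu h0 => ?_⟩
    · intro B hB
      rw [Finset.mem_singleton] at hB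
      subst hB
      exact ⟨by rw [rs_nxt, h1], .inl rfl⟩
    · rw [if_pos h1, if_neg h2, mul_one] at h0
      rw [pS, Finset.prod_singleton, a1 u hu, h0]
  · refine ⟨{prv A}, ?_, fun u hu h0 => ?_⟩
    · intro B hB
      rw [Finset.mem_singleton] at hB
      subst hB
      exact ⟨by rw [rs_prv, h2]; ring, .inr rfl⟩
    · rw [if_neg h1, if_pos h2, one_mul] at h0
      rw [pS, Finset.prod_singleton, a2 u hu, h0, neg_zero]
  · refine ⟨∅, by simp, fun u hu h0 => ?_⟩
    rw [if_neg h1, if_neg h2, one_mul] at h0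
    simpa [pS] using h0

theorem Wt.P_apply (hD : IsKLR n D) (hr : r + 1 < n) (hv : Wt D (r + 1) i c v) :
    Wt D r (sw r i) c (D (.P r) v) := by
  refine ⟨?_, fun q hq => ?_⟩
  · have := app (hD.PE r i hr) v
    simp only [Module.End.mul_apply, hv.1] at this
    exact this.symm
  · have := app (hD.PY r q hr (by omega) (by omega) (by omega)) v
    simp only [Module.End.mul_apply] at this
    rw [← this, hv.2 q (by omega), map_smul]

theorem Inc.succ [Nontrivial I] (hK : Function.Injective (algebraMap O K)) (hD : IsKLR n D)
    (hr : r + 1 < n) (hI : ∀ q ≤ r, Inc κ D q) : Inc κ D (r + 1) := by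
  intro i c v hs hi hv
  have hir := hi r (by omega)
  obtain ⟨A, ha, hl⟩ := hs r (by omega)
  obtain rfl : c r = A := Sum.inl.inj ha
  have hst : st (lab I c) (r + 1) = step (st (lab I c) r) (.inl (c r) : Lab I l) := rfl
  have hw := hv.P_apply hD hr
  obtain ⟨S, hS, h0⟩ := hI r le_rfl (sw r i) c (D (.P r) v) (hs.mono (by omega)) (fun q hq => by
    rw [sw_ne _ _ _ (by omega) (by omega)]; exact hi q (by omega)) hw
  rw [sw_self] at hS
  have hW : ∀ q < n, ∀ u ∈ LinearMap.ker (D (.E i) - 1), D (.Y q) u ∈ LinearMap.ker (D (.E i) - 1) := by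
    intro q hq u hu
    rw [LinearMap.mem_ker, LinearMap.sub_apply, sub_eq_zero, Module.End.one_apply] at hu ⊢
    have := app (hD.YE q i hq) u
    simp only [Module.End.mul_apply, hu] at this
    exact this.symm
  have hvW : v ∈ LinearMap.ker (D (.E i) - 1) := by
    rw [LinearMap.mem_ker, LinearMap.sub_apply, sub_eq_zero, Module.End.one_apply, hv.1]
  have hnl : ∀ B, Legal (st (lab I c) r) B → c r ≠ B → Legal (st (lab I c) (r + 1)) B := by
    intro B hB hne
    rw [hst, legal_step_iff (hl.not_linked_ne hB hne)]
    exact hB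
  by_cases hii : i r = i (r + 1)
  · rw [sw_eq_self hii] at hw
    have e1 := app (hD.YPh r i hr) v
    have e2 := app (hD.sq r i hr) v
    simp only [Module.End.mul_apply, hv.1, LinearMap.add_apply, if_pos hii,
      Module.End.one_apply, hv.2 r (by omega), map_smul] at e1 e2
    rw [Qv, if_pos hii, LinearMap.zero_apply] at e2
    have hwW : D (.P r) v ∈ LinearMap.ker (D (.E i) - 1) := by
      rw [LinearMap.mem_ker, LinearMap.sub_apply, sub_eq_zero, Module.End.one_apply, hw.1]
    have hf := aeval_intertwine (f := (D (.Y r) - D (.Y (r + 1))) * D (.P r) + 1) (y := D (.Y r))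
      (y' := D (.Y (r + 1))) (W := LinearMap.ker (D (.E i) - 1)) (hW r (by omega)) (by
        intro u hu
        rw [LinearMap.mem_ker, LinearMap.sub_apply, sub_eq_zero, Module.End.one_apply] at hu
        have e1 := app (hD.YPh r i hr) u
        have e2 := app (hD.PYh r i hr) u
        have e3 := app (hD.YY r (r + 1) (by omega) hr) (D (.P r) u)
        simp only [Module.End.mul_apply, hu, LinearMap.add_apply, if_pos hii,
          Module.End.one_apply] at e1 e2 e3
        simp only [Module.End.mul_apply, LinearMap.add_apply, LinearMap.sub_apply,
          Module.End.one_apply, map_add, map_sub]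
        have e4 : D (.P r) (D (.Y r) u) = D (.Y (r + 1)) (D (.P r) u) - u := by rw [e1]; abel
        rw [e4, map_sub, map_sub, e3]
        abel) (pS K S) hwW
    rw [h0, map_zero] at hf
    have hφ : ((D (.Y r) - D (.Y (r + 1))) * D (.P r) + 1) (D (.P r) v) = D (.P r) v := by
      simp [e2]
    rw [hφ] at hf
    have hv' : v = aeval (D (.Y (r + 1))) (X - C (vK K (c r))) (D (.P r) v) := by
      rw [aeval_X_sub, e1]; abel
    refine ⟨S.erase (c r), fun B hB => ?_, ?_⟩
    · obtain ⟨h1, h2⟩ := hS B (Finset.mem_of_mem_erase hB)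
      exact ⟨hnl B h1 (Finset.ne_of_mem_erase hB).symm, h2⟩
    · rw [hv', ← Module.End.mul_apply, ← map_mul]
      by_cases hc : c r ∈ S
      · rw [pS, Finset.prod_erase_mul S (fun B => X - C (vK K B)) hc]
        exact hf.symm
      · rw [Finset.erase_eq_of_notMem hc, mul_comm, map_mul, Module.End.mul_apply, ← hf, map_zero]
  · have hpoly := aeval_intertwine (f := D (.P r)) (y := D (.Y (r + 1)))
      (y' := D (.Y r)) (W := LinearMap.ker (D (.E i) - 1)) (hW _ hr) (by
        intro u hu
        rw [LinearMap.mem_ker, LinearMap.sub_apply, sub_eq_zero, Module.End.one_apply] at hu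
        have e1 := app (hD.PYh r i hr) u
        simpa only [Module.End.mul_apply, hu, LinearMap.add_apply, if_neg hii, add_zero] using e1)
      (pS K S) hvW
    rw [h0] at hpoly
    have hv' := hv.aeval hD hr (pS K S)
    have e2 := app (hD.sq r i hr) (aeval (D (.Y (r + 1))) (pS K S) v)
    simp only [Module.End.mul_apply, hv'.1] at e2
    rw [hpoly, map_zero, hir] at e2
    obtain ⟨Ex, hEx, hQ⟩ := Qv_pS (K := K) (κ := κ) (hD.YY r (r + 1) (by omega) hr) (c r)
      (by rw [← hir]; exact hii)
    have h3 := hQ _ (hv'.2 r (by omega)) e2.symm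
    refine prune hK hD hr hI hs hi (Ex ∪ S) v hv ?_ ?_
    · intro B hB
      rcases Finset.mem_union.1 hB with hB | hB
      · exact ⟨(hEx B hB).1, legal_or_blocked hs rfl (hEx B hB).2⟩
      · obtain ⟨h1, h2⟩ := hS B hB
        refine ⟨h2, .inl (hnl B h1 ?_)⟩
        rintro rfl
        exact hii (hir.trans h2)
    · rw [pS, Finset.prod_union, map_mul, Module.End.mul_apply]
      · exact h3
      · rw [Finset.disjoint_left]
        intro B hB hB'
        obtain ⟨h1, h2⟩ := hS B hB'
        refine hl.not_linked_ne (I := I) h1 ?_ ?_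
        · rintro rfl
          exact hii (hir.trans h2)
        · rw [linked_iff]
          rcases (hEx B hB).2 with h | h
          · right; left; rw [h, prv_nxt]
          · right; right; exact h

theorem cycPoly_apply {κ : Fin l → I} {k : I} {y : Module.End K M} :
    cycPoly κ k y = aeval y (pS K ((Finset.univ.filter fun c : Fin l => κ c = k).map
      (Function.Embedding.sectL (Fin l) (0 : ℤ)))) := by
  rw [pS, Finset.prod_map, Finset.prod_filter, Fin.prod_univ_def, map_list_prod, List.map_map,
    cycPoly]
  congr 1
  refine List.map_congr_left fun c _ => ?_
  simp only [Function.comp_apply]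
  split_ifs
  · ext u
    rw [aeval_X_sub, LinearMap.sub_apply, Module.algebraMap_end_apply, ← algebraMap_smul K]
    congr 3
    simp
  · simp

theorem Inc.zero (hD : IsKLR n D) (hn : 0 < n) (hC : IsCyc κ D) : Inc κ D 0 := by
  intro i c v _ _ hv
  refine ⟨_, ?_, (app (cycPoly_apply (K := K) (κ := κ) (k := i 0) (y := D (.Y 0))) v).symm.trans ?_⟩
  · intro B hB
    rw [Finset.mem_map] at hB
    obtain ⟨b, hb, rfl⟩ := hB
    simp only [Finset.mem_filter, Finset.mem_univ, true_and] at hb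
    rw [Function.Embedding.sectL_apply]
    exact ⟨by simp [Legal, st, prv], by simpa [rs, resid] using hb⟩
  · have := app (hC i) v
    simp only [Module.End.mul_apply] at this
    rw [cycPoly_apply (K := K), aeval_pS_comm (hD.YE 0 i hn).symm, hv.1] at this
    rw [cycPoly_apply (K := K), this]
    rfl

theorem inc [Nontrivial I] (hK : Function.Injective (algebraMap O K)) (hD : IsKLR n D)
    (hC : IsCyc κ D) (hm : m < n) : Inc κ D m := by
  induction m using Nat.strong_induction_on with
  | _ m ih =>
    rcases m with _ | r
    · exact Inc.zero hD hm hC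
    · exact Inc.succ hK hD hm fun q hq => ih q (by omega) (by omega)

end increments

section transfer

variable {I : Type} [CommRing I] {n : ℕ}

theorem IsKLR.map {A B : Type*} [Ring A] [Algebra O A] [Ring B] [Algebra O B] {D : G I → A}
    (h : IsKLR n D) (f : A →ₐ[O] B) : IsKLR n (fun g => f (D g)) where
  EE i := by simpa only [map_mul] using congrArg f (h.EE i)
  EE' i j hij := by simpa only [map_mul, map_zero] using congrArg f (h.EE' i j hij)
  YE r i hr := by simpa only [map_mul] using congrArg f (h.YE r i hr)
  PE r i hr := by simpa only [map_mul] using congrArg f (h.PE r i hr)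
  YY r s hr hs := by simpa only [map_mul] using congrArg f (h.YY r s hr hs)
  PY r s h1 h2 h3 h4 := by simpa only [map_mul] using congrArg f (h.PY r s h1 h2 h3 h4)
  PP r s h1 h2 := by simpa only [map_mul] using congrArg f (h.PP r s h1 h2)
  PYh r i hr := by
    have := congrArg f (h.PYh r i hr)
    simp only [map_mul, map_add] at this
    rw [this]
    split_ifs <;> simp
  YPh r i hr := by
    have := congrArg f (h.YPh r i hr)
    simp only [map_mul, map_add] at this
    rw [this]
    split_ifs <;> simp
  sq r i hr := by simpa only [map_mul, map_Qv] using congrArg f (h.sq r i hr)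
  br r i hr := by simpa only [map_mul, map_add, map_bt] using congrArg f (h.br r i hr)

theorem isKLR_of_urel {A : Type*} [Ring A] [Algebra O A] {D : G I → A}
    (h : ∀ a b, urel I n a b → ev D a = ev D b) : IsKLR n D := by
  let f : U I n →ₐ[O] A := RingQuot.liftAlgHom O ⟨ev D, fun a b hab => h a b hab⟩
  have hf : ∀ z, f (toU I n z) = ev D z :=
    RingQuot.liftAlgHom_mkAlgHom_apply O (ev D) (fun a b hab => h a b hab)
  have := (isKLR_U (I := I) n).map f
  simpa [hf, ev, gen] using this

end transfer

section generic

variable {K M : Type*} [Field K] [AddCommGroup M] [Module K M]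

theorem comp_mem {ι Θ : Type*} (A : Θ → Module.End K M) (wt : ι → Θ → K) (T : Submodule K M)
    (hT : ∀ θ, ∀ u ∈ T, A θ u ∈ T) (F : Finset ι) : ∀ f : ι → M,
    (∀ k ∈ F, ∀ θ, A θ (f k) = wt k θ • f k) →
    (∀ k ∈ F, ∀ k' ∈ F, k ≠ k' → ∃ θ, wt k θ ≠ wt k' θ) → ∑ k ∈ F, f k ∈ T → ∀ k ∈ F, f k ∈ T := by
  induction F using Finset.induction_on with
  | empty => intro f _ _ _ k hk; simp at hk
  | insert a F ha ih =>
    intro f hA hs hx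
    have key : ∀ k ∈ F, f k ∈ T := by
      intro k hk
      obtain ⟨θ, hθ⟩ := hs k (Finset.mem_insert_of_mem hk) a (Finset.mem_insert_self _ _) (by
        rintro rfl; exact ha hk)
      have h1 : ∑ k ∈ F, (wt k θ - wt a θ) • f k ∈ T := by
        have h2 := T.sub_mem (hT θ _ hx) (T.smul_mem (wt a θ) hx)
        rw [Finset.sum_insert ha, map_add, map_sum, smul_add, Finset.smul_sum,
          hA a (Finset.mem_insert_self _ _), add_sub_add_left_eq_sub, ← Finset.sum_sub_distrib] at h2
        refine (Finset.sum_congr rfl fun k hk => ?_).subst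
          (motive := fun x => x ∈ T) h2
        rw [hA k (Finset.mem_insert_of_mem hk), sub_smul]
      have := ih (fun k => (wt k θ - wt a θ) • f k) (fun k hk θ' => by
        rw [map_smul, hA k (Finset.mem_insert_of_mem hk), smul_comm])
        (fun k hk k' hk' => hs k (Finset.mem_insert_of_mem hk) k' (Finset.mem_insert_of_mem hk'))
        h1 k hk
      exact (T.smul_mem_iff (sub_ne_zero.2 hθ)).1 this
    intro k hk
    rcases Finset.mem_insert.1 hk with rfl | hk
    · rw [Finset.sum_insert ha] at hx
      exact (T.add_mem_iff_left (T.sum_mem key)).1 hx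
    · exact key k hk

end generic

section cyclic

open Polynomial

variable {I : Type} [CommRing I] {l : ℕ} {κ : Fin l → I}
variable {K : Type} [Field K] [Algebra O K]
variable {M : Type} [AddCommGroup M] [Module K M] [Module O M] [IsScalarTower O K M]
variable {D : G I → Module.End K M} {n m r : ℕ} {i : ℕ → I} {c : ℕ → Fin l × ℤ} {v u w : M}

/-- The `K`-subspace spanned by words in a set of generators applied to a vector. -/
def Cyc (D : G I → Module.End K M) (S : Set (G I)) (w : M) : Submodule K M :=
  Submodule.span K {u | ∃ z ∈ FA S, ev D z w = u}

theorem ev_mem {S : Set (G I)} {T : Submodule K M} (hT : ∀ g ∈ S, ∀ u ∈ T, D g u ∈ T) {z : FF I}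
    (hz : z ∈ FA S) (hu : u ∈ T) : ev D z u ∈ T := by
  induction hz using Algebra.adjoin_induction generalizing u with
  | mem z hz =>
    obtain ⟨g, hg, rfl⟩ := hz
    simpa [ev, gen] using hT g hg u hu
  | algebraMap r =>
    rw [AlgHom.commutes, Module.algebraMap_end_apply, ← algebraMap_smul K]
    exact T.smul_mem _ hu
  | add a b _ _ ha hb => rw [map_add]; exact T.add_mem (ha hu) (hb hu)
  | mul a b _ _ ha hb => rw [map_mul]; exact ha (hb hu)

theorem Cyc.le {S : Set (G I)} {T : Submodule K M} (hw : w ∈ T)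
    (hT : ∀ g ∈ S, ∀ u ∈ T, D g u ∈ T) : Cyc D S w ≤ T := by
  refine Submodule.span_le.2 ?_
  rintro u ⟨z, hz, rfl⟩
  exact ev_mem hT hz hw

theorem Cyc.self (D : G I → Module.End K M) (S : Set (G I)) (w : M) : w ∈ Cyc D S w :=
  Submodule.subset_span ⟨1, one_mem _, by simp⟩

theorem Cyc.gen_mem {S : Set (G I)} : ∀ g ∈ S, ∀ u ∈ Cyc D S w, D g u ∈ Cyc D S w := by
  intro g hg u hu
  induction hu using Submodule.span_induction with
  | mem u hu =>
    obtain ⟨z, hz, rfl⟩ := hu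
    exact Submodule.subset_span
      ⟨gen g * z, mul_mem (Algebra.subset_adjoin ⟨g, hg, rfl⟩) hz, by simp [ev, gen]⟩
  | zero => simp
  | add a b _ _ ha hb => rw [map_add]; exact add_mem ha hb
  | smul k a _ ha => rw [map_smul]; exact Submodule.smul_mem _ _ ha

theorem mem_gens_E (i : ℕ → I) : G.E i ∈ gens I m := .inl ⟨i, rfl⟩
theorem mem_gens_Y {q : ℕ} (hq : q < m) : G.Y q ∈ gens I m := .inr (.inl ⟨q, hq, rfl⟩)
theorem mem_gens_P {q : ℕ} (hq : q + 1 < m) : G.P q ∈ gens I m := .inr (.inr ⟨q, hq, rfl⟩)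

theorem E_apply (hD : IsKLR n D) (h : D (.E i) v = v) (j : ℕ → I) :
    D (.E j) v = if j = i then v else 0 := by
  split_ifs with hj
  · rw [hj, h]
  · have := app (hD.EE' j i hj) v
    simpa [h] using this

theorem spanE_stable (hD : IsKLR n D) (hm : m ≤ n) {T : Submodule K M}
    (hT : ∀ g ∈ gens I m, ∀ u ∈ T, D g u ∈ T) :
    ∀ g ∈ gens I m, ∀ u ∈ Submodule.span K {u | u ∈ T ∧ ∃ i, D (.E i) u = u},
      D g u ∈ Submodule.span K {u | u ∈ T ∧ ∃ i, D (.E i) u = u} := by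
  intro g hg u hu
  induction hu using Submodule.span_induction with
  | mem u hu =>
    obtain ⟨hu, i, hi⟩ := hu
    rcases hg with ⟨j, rfl⟩ | ⟨q, hq, rfl⟩ | ⟨q, hq, rfl⟩
    · rw [E_apply hD hi]
      split_ifs
      · exact Submodule.subset_span ⟨hu, i, hi⟩
      · exact zero_mem _
    · refine Submodule.subset_span ⟨hT _ (mem_gens_Y hq) _ hu, i, ?_⟩
      have := app (hD.YE q i (by omega)) u
      simp only [Module.End.mul_apply, hi] at this
      exact this.symm
    · refine Submodule.subset_span ⟨hT _ (mem_gens_P hq) _ hu, sw q i, ?_⟩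
      have := app (hD.PE q i (by omega)) u
      simp only [Module.End.mul_apply, hi] at this
      exact this.symm
  | zero => simp
  | add a b _ _ ha hb => rw [map_add]; exact add_mem ha hb
  | smul k a _ ha => rw [map_smul]; exact Submodule.smul_mem _ _ ha

theorem split_eigen (hD : IsKLR n D) (hm : m < n) {T : Submodule K M}
    (hK : Function.Injective (algebraMap O K))
    (hT : ∀ u ∈ T, D (.Y m) u ∈ T) (S : Finset (Fin l × ℤ)) : ∀ u ∈ T, Wt D m i c u →
    aeval (D (.Y m)) (pS K S) u = 0 →
    u ∈ Submodule.span K {u | u ∈ T ∧ ∃ c : ℕ → Fin l × ℤ, Wt D (m + 1) i c u} := by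
  induction S using Finset.induction_on with
  | empty => intro u _ _ h; simp [pS] at h; rw [h]; exact zero_mem _
  | insert B S hB ih =>
    intro u hu hw h0
    have hcop : IsCoprime (X - C (vK K B)) (pS K S) := by
      refine IsCoprime.prod_right fun B' hB' => isCoprime_X_sub_C_of_isUnit_sub ?_
      refine (sub_ne_zero.2 (vK_ne_of_ne hK ?_)).isUnit
      rintro rfl
      exact hB hB'
    obtain ⟨a, b, hab⟩ := hcop
    rw [pS, Finset.prod_insert hB] at h0
    have e : u = aeval (D (.Y m)) (a * (X - C (vK K B))) u + aeval (D (.Y m)) (b * pS K S) u := by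
      rw [← LinearMap.add_apply, ← map_add, hab]; simp
    rw [e]
    refine add_mem (ih _ (aeval_mem hT _ hu) (hw.aeval hD hm _) ?_) (Submodule.subset_span
      ⟨aeval_mem hT _ hu, Function.update c m B, (hw.aeval hD hm _).1, fun q hq => ?_⟩)
    · rw [← Module.End.mul_apply, ← map_mul,
        show pS K S * (a * (X - C (vK K B))) = a * ((X - C (vK K B)) * pS K S) by ring, map_mul,
        Module.End.mul_apply]
      rw [pS, h0, map_zero]
    · rcases Nat.lt_succ_iff_lt_or_eq.1 hq with h | rfl
      · rw [Function.update_of_ne (by omega)]; exact (hw.aeval hD hm _).2 q h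
      · rw [Function.update_self, ← sub_eq_zero, ← aeval_X_sub, ← Module.End.mul_apply, ← map_mul,
          show (X - C (vK K B)) * (b * pS K S) = b * ((X - C (vK K B)) * pS K S) by ring, map_mul,
          Module.End.mul_apply]
        rw [pS, h0, map_zero]

theorem decomp (hK : Function.Injective (algebraMap O K)) (hD : IsKLR n D) (hm : m ≤ n)
    (hI : ∀ q < m, Inc κ D q) (c0 : Fin l × ℤ) {T : Submodule K M}
    (hT : ∀ q < m, ∀ u ∈ T, D (.Y q) u ∈ T) (hv : v ∈ T) (hE : D (.E i) v = v) :
    v ∈ Submodule.span K {u | u ∈ T ∧ ∃ c : ℕ → Fin l × ℤ, Wt D m i c u} := by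
  induction m with
  | zero => exact Submodule.subset_span ⟨hv, fun _ => c0, hE, fun q hq => by omega⟩
  | succ m ih =>
    refine Submodule.span_le.2 ?_ (ih (by omega) (fun q hq => hI q (by omega))
      (fun q hq => hT q (by omega)))
    rintro u ⟨hu, c, hw⟩
    by_cases hu0 : u = 0
    · rw [hu0]; exact zero_mem _
    obtain ⟨h1, h2⟩ := nonStd hK (fun q hq => hI q (by omega)) hw hu0
    obtain ⟨S, -, h0⟩ := hI m (by omega) i c u h1 h2 hw
    exact split_eigen hD (by omega) hK (hT m (by omega)) S u hu hw h0

theorem wt_line [Nontrivial I] (hK : Function.Injective (algebraMap O K)) (hD : IsKLR n D)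
    (hC : IsCyc κ D) (hm : m ≤ n) (hw : Wt D m i c w) :
    ∀ u ∈ Cyc D (gens I m) w, Wt D m i c u → ∃ k : K, u = k • w := by
  induction m with
  | zero =>
    intro u hu _
    have : Cyc D (gens I 0) w ≤ Submodule.span K {w} := by
      refine Cyc.le (Submodule.mem_span_singleton_self w) ?_
      rintro g (⟨j, rfl⟩ | ⟨q, hq, rfl⟩ | ⟨q, hq, rfl⟩) u hu
      · obtain ⟨k, rfl⟩ := Submodule.mem_span_singleton.1 hu
        rw [map_smul, E_apply hD hw.1]
        split_ifs
        · exact hu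
        · simp
      · omega
      · omega
    obtain ⟨k, hk⟩ := Submodule.mem_span_singleton.1 (this hu)
    exact ⟨k, hk.symm⟩
  | succ q ih =>
    have hqn : q < n := hm
    set W := Cyc D (gens I q) w with hW
    have key0 : ∀ u ∈ W, D (.Y q) u = vK K (c q) • u := by
      have : W ≤ (D (.Y q)).eigenspace (vK K (c q)) := by
        refine Cyc.le (Module.End.mem_eigenspace_iff.2 (hw.2 q (by omega))) ?_
        intro g hg u hu
        rw [Module.End.mem_eigenspace_iff] at hu ⊢
        have hc : D (.Y q) * D g = D g * D (.Y q) := by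
          rcases hg with ⟨j, rfl⟩ | ⟨p, hp, rfl⟩ | ⟨p, hp, rfl⟩
          · exact hD.YE q j hqn
          · exact hD.YY q p hqn (by omega)
          · exact (hD.PY p q (by omega) hqn (by omega) (by omega)).symm
        rw [← Module.End.mul_apply, hc, Module.End.mul_apply, hu, map_smul]
      exact fun u hu => Module.End.mem_eigenspace_iff.1 (this hu)
    set Z : Submodule K M := ⨆ ν, ⨆ (_ : ν ≠ vK K (c q)), (D (.Y q)).eigenspace ν with hZ
    have hZm : ∀ ν x, ν ≠ vK K (c q) → D (.Y q) x = ν • x → x ∈ Z := fun ν x hν hx =>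
      Submodule.mem_iSup_of_mem ν (Submodule.mem_iSup_of_mem hν (Module.End.mem_eigenspace_iff.2 hx))
    have key1 : 1 ≤ q → ∀ u ∈ W, D (.P (q - 1)) u ∈ W ⊔ Z := by
      intro hq1 u hu
      obtain ⟨r, rfl⟩ : ∃ r, q = r + 1 := ⟨q - 1, by omega⟩
      rw [Nat.add_sub_cancel]
      have h1 : W ≤ Submodule.span K {u | u ∈ W ∧ ∃ i, D (.E i) u = u} :=
        Cyc.le (Submodule.subset_span ⟨Cyc.self _ _ _, i, hw.1⟩)
          (spanE_stable hD (by omega) Cyc.gen_mem)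
      suffices h2 : ∀ u ∈ W, ∀ i c', Wt D (r + 1) i c' u → D (.P r) u ∈ W ⊔ Z by
        suffices h3 : W ≤ (W ⊔ Z).comap (D (.P r)) from h3 hu
        refine h1.trans (Submodule.span_le.2 ?_)
        rintro u ⟨hu, i, hi⟩
        refine Submodule.span_le.2 ?_ (decomp hK hD (m := r + 1) (by omega)
          (fun q hq => inc hK hD hC (by omega)) (c 0) (T := W)
          (fun q hq => Cyc.gen_mem _ (mem_gens_Y hq)) hu hi)
        rintro u ⟨hu, c', hc'⟩
        exact h2 u hu i c' hc'
      intro u hu i' c' hwt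
      by_cases hu0 : u = 0
      · rw [hu0, map_zero]; exact zero_mem _
      have hwt' : Wt D (r + 1 + 1) i' (Function.update c' (r + 1) (c (r + 1))) u := by
        refine ⟨hwt.1, fun q hq => ?_⟩
        rcases Nat.lt_succ_iff_lt_or_eq.1 hq with h | rfl
        · rw [Function.update_of_ne (by omega)]; exact hwt.2 q h
        · rw [Function.update_self]; exact key0 u hu
      obtain ⟨hs, -⟩ := nonStd hK (fun q hq => inc hK hD hC (by omega)) hwt' hu0
      have hne := hs.ne_succ (r := r) (by omega)
      simp only [lab, Function.update_self, Function.update_of_ne (show r ≠ r + 1 by omega)] at hne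
      have hne' : c' r ≠ c (r + 1) := fun h => hne (by rw [h])
      obtain ⟨d, hd⟩ : ∃ d : K, d = if i' r = i' (r + 1) then
          1 / (vK K (Function.update c' (r + 1) (c (r + 1)) (r + 1)) -
            vK K (Function.update c' (r + 1) (c (r + 1)) r)) else 0 := ⟨_, rfl⟩
      have hx := hwt'.swap hD (r := r) hm hqn (by omega) (by
        rw [Function.update_self, Function.update_of_ne (by omega)]
        exact vK_ne_of_ne hK hne') hd
      have hx2 := hx.2 (r + 1) (by omega)
      rw [sw_succ, Function.update_of_ne (show r ≠ r + 1 by omega)] at hx2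
      rw [← sub_add_cancel (D (.P r) u)]
      exact add_mem (Submodule.mem_sup_right (hZm _ _ (vK_ne_of_ne hK hne') hx2))
        (Submodule.mem_sup_left (W.smul_mem _ hu))
    have key2 : ∀ p, p + 1 < q → ∀ x ∈ W ⊔ Z, D (.P p) x ∈ W ⊔ Z := by
      intro p hp
      suffices h : W ⊔ Z ≤ (W ⊔ Z).comap (D (.P p)) from h
      refine sup_le (fun x hx => Submodule.mem_sup_left (Cyc.gen_mem _ (mem_gens_P hp) x hx))
        (iSup_le fun ν => iSup_le fun hν => ?_)
      intro x hx
      refine Submodule.mem_sup_right (hZm ν _ hν ?_)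
      rw [Module.End.mem_eigenspace_iff] at hx
      rw [← Module.End.mul_apply, ← hD.PY p q (by omega) hqn (by omega) (by omega),
        Module.End.mul_apply, hx, map_smul]
    have key3 : ∀ a, a ≤ q → ∀ u ∈ W, chi (fun j => D (.P (cr true q j))) a u ∈ W ⊔ Z := by
      intro a
      induction a with
      | zero => intro _ u hu; exact Submodule.mem_sup_left (by simpa [chi] using hu)
      | succ a iha =>
        intro ha u hu
        rw [chi, Module.End.mul_apply]
        rcases a with _ | a
        · simpa [chi, cr] using key1 ha u hu
        · exact key2 _ (by simp [cr]; omega) _ (iha (by omega) u hu)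
    have key4 : Cyc D (gens I (q + 1)) w ≤ W ⊔ Z := by
      refine Submodule.span_le.2 ?_
      rintro u ⟨z, hz, rfl⟩
      obtain ⟨N, cc, hcc, hnf⟩ := exists_normalForm true q i hz
      have := app (hnf (Module.End K M) D (hD.mono hm)) w
      rw [Module.End.mul_apply, hw.1] at this
      rw [SetLike.mem_coe, this, normalForm]
      simp only [LinearMap.sum_apply]
      refine sum_mem fun a ha => sum_mem fun k _ => ?_
      rw [Module.End.mul_apply]
      refine key3 a (by simpa [Nat.lt_succ_iff] using ha) _ ?_
      rw [Module.End.mul_apply, Module.End.mul_apply, hw.1]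
      have hY : (D (.Y (pos true q 0)) ^ k) w = (vK K (c q)) ^ k • w := by
        have := aeval_eigen (hw.2 q (by omega)) (X ^ k)
        simpa [pos] using this
      rw [hY, map_smul]
      exact W.smul_mem _ (ev_mem Cyc.gen_mem (hcc a k) (Cyc.self _ _ _))
    intro u hu hwu
    obtain ⟨x, hx, z, hz, rfl⟩ := Submodule.mem_sup.1 (key4 hu)
    have hz0 : z = 0 := by
      refine Submodule.disjoint_def.1
        (Module.End.eigenspaces_iSupIndep (D (.Y q)) (vK K (c q))) z ?_ hz
      rw [Module.End.mem_eigenspace_iff]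
      have h1 := hwu.2 q (by omega)
      rw [map_add, key0 x hx, smul_add] at h1
      exact add_left_cancel h1
    subst hz0
    rw [add_zero] at hwu ⊢
    exact ih (by omega) (hw.mono (by omega)) x hx (hwu.mono (by omega))

end cyclic

section cyclicWeights

open Polynomial

variable {I : Type} [CommRing I] {l : ℕ} {κ : Fin l → I}
variable {K : Type} [Field K] [Algebra O K]
variable {M : Type} [AddCommGroup M] [Module K M] [Module O M] [IsScalarTower O K M]
variable {D : G I → Module.End K M} {n m r : ℕ} {i : ℕ → I} {c : ℕ → Fin l × ℤ} {v u w : M}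

/-- Weights obtained from a given one by admissible transpositions. -/
inductive Reach (n : ℕ) (i : ℕ → I) (c : ℕ → Fin l × ℤ) : (ℕ → I) × (ℕ → Fin l × ℤ) → Prop
  | refl : Reach n i c (i, c)
  | step (p : (ℕ → I) × (ℕ → Fin l × ℤ)) (r : ℕ) (h : Reach n i c p) (hr : r + 1 < n)
      (hl : ¬ linked (I := I) (.inl (p.2 r)) (.inl (p.2 (r + 1)))) :
      Reach n i c (sw r p.1, sw r p.2)

theorem Reach.tail {p : (ℕ → I) × (ℕ → Fin l × ℤ)} (h : Reach n i c p) {q : ℕ} (hq : n ≤ q) :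
    p.2 q = c q := by
  induction h with
  | refl => rfl
  | step p r h hr hl ih => rw [← ih]; exact sw_ne r p.2 q (by omega) (by omega)

/-- The weight space. -/
def WtS (D : G I → Module.End K M) (n : ℕ) (p : (ℕ → I) × (ℕ → Fin l × ℤ)) : Submodule K M where
  carrier := {v | Wt D n p.1 p.2 v}
  zero_mem' := ⟨map_zero _, fun q _ => by rw [map_zero, smul_zero]⟩
  add_mem' ha hb := ⟨by rw [map_add, ha.1, hb.1], fun q hq => by
    rw [map_add, ha.2 q hq, hb.2 q hq, smul_add]⟩
  smul_mem' k v hv := ⟨by rw [map_smul, hv.1], fun q hq => by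
    rw [map_smul, hv.2 q hq, smul_comm]⟩

theorem Cyc_le_weights [Nontrivial I] (hK : Function.Injective (algebraMap O K)) (hD : IsKLR n D)
    (hC : IsCyc κ D) (hw : Wt D n i c w) :
    Cyc D (gens I n) w ≤ ⨆ p : {p // Reach n i c p}, WtS D n p.1 := by
  refine Cyc.le (Submodule.mem_iSup_of_mem ⟨_, .refl⟩ hw) ?_
  intro g hg
  suffices h : (⨆ p : {p // Reach n i c p}, WtS D n p.1) ≤
      (⨆ p : {p // Reach n i c p}, WtS D n p.1).comap (D g) from fun u hu => h hu
  refine iSup_le ?_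
  rintro ⟨p, hp⟩ u (hu : Wt D n p.1 p.2 u)
  rw [Submodule.mem_comap]
  have hup : u ∈ ⨆ p : {p // Reach n i c p}, WtS D n p.1 :=
    Submodule.mem_iSup_of_mem ⟨p, hp⟩ hu
  rcases hg with ⟨j, rfl⟩ | ⟨q, hq, rfl⟩ | ⟨q, hq, rfl⟩
  · rw [E_apply hD hu.1]
    split_ifs
    · exact hup
    · exact zero_mem _
  · rw [hu.2 q hq]
    exact Submodule.smul_mem _ _ hup
  · by_cases hu0 : u = 0
    · rw [hu0, map_zero]; exact zero_mem _
    obtain ⟨hs, -⟩ := nonStd hK (fun q hq => inc hK hD hC hq) hu hu0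
    have hne : p.2 q ≠ p.2 (q + 1) := fun h => hs.ne_succ hq (congrArg Sum.inl h)
    obtain ⟨d, hd⟩ : ∃ d : K, d = if p.1 q = p.1 (q + 1) then
          1 / (vK K (p.2 (q + 1)) - vK K (p.2 q)) else 0 := ⟨_, rfl⟩
    have hx := hu.swap hD le_rfl hq hq (vK_ne_of_ne hK hne) hd
    rw [← sub_add_cancel (D (.P q) u) (d • u)]
    refine add_mem ?_ (Submodule.smul_mem _ _ hup)
    by_cases hl : linked (I := I) (.inl (p.2 q)) (.inl (p.2 (q + 1)))
    · have h0 : D (.P q) u - d • u = 0 := by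
        by_contra h0
        obtain ⟨hs', -⟩ := nonStd hK (fun q hq => inc hK hD hC hq) hx h0
        exact hs.not_sw hq hl (hs'.mono (by omega))
      rw [h0]; exact zero_mem _
    · exact Submodule.mem_iSup_of_mem ⟨_, .step p q hp hq hl⟩ hx

theorem cyc_inf [Nontrivial I] (hK : Function.Injective (algebraMap O K)) (hD : IsKLR n D)
    (hC : IsCyc κ D) (hw : Wt D n i c w) {T : Submodule K M}
    (hT : ∀ g ∈ gens I n, ∀ u ∈ T, D g u ∈ T) (hwT : w ∉ T) :
    ∀ x ∈ Cyc D (gens I n) w, x ∈ T → x = 0 := by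
  intro x hx hxT
  have key : ∀ p, Reach n i c p → ∀ u ∈ Cyc D (gens I n) w, u ∈ T → Wt D n p.1 p.2 u → u = 0 := by
    intro p hp
    induction hp with
    | refl =>
      intro u hu huT hwu
      obtain ⟨k, rfl⟩ := wt_line hK hD hC le_rfl hw u hu hwu
      by_cases hk : k = 0
      · rw [hk, zero_smul]
      · exact absurd ((T.smul_mem_iff hk).1 huT) hwT
    | step p r hp hr hl ih =>
      intro u hu huT hwu
      by_contra hu0
      obtain ⟨hs, hres⟩ := nonStd hK (fun q hq => inc hK hD hC hq) hwu hu0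
      have hl' : ¬ linked (I := I) (.inl (sw r p.2 r)) (.inl (sw r p.2 (r + 1))) := by
        rw [sw_self, sw_succ]; exact not_linked_symm hl
      obtain ⟨d, hd⟩ : ∃ d : K, d = if sw r p.1 r = sw r p.1 (r + 1) then
          1 / (vK K (sw r p.2 (r + 1)) - vK K (sw r p.2 r)) else 0 := ⟨_, rfl⟩
      have hx := hwu.swap hD le_rfl hr hr (vK_ne_of_not_linked hK hl') hd
      simp only [sw_sw] at hx
      refine hu0 (hwu.swap_inj hK hD hr hr hl' (hres r (by omega)) (hres _ hr) hd (ih _ ?_ ?_ hx))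
      · exact sub_mem (Cyc.gen_mem _ (mem_gens_P hr) _ hu) (Submodule.smul_mem _ _ hu)
      · exact sub_mem (hT _ (mem_gens_P hr) _ huT) (Submodule.smul_mem _ _ huT)
  obtain ⟨f, hf, hfx⟩ := (Submodule.mem_iSup_iff_exists_finsupp _ _).1
    (Cyc_le_weights hK hD hC hw hx)
  have hmem := comp_mem (Θ := (ℕ → I) ⊕ Fin n)
    (Sum.elim (fun j => D (.E j)) (fun q => D (.Y q)))
    (fun p : {p // Reach n i c p} =>
      Sum.elim (fun j => if j = p.1.1 then (1 : K) else 0) (fun q => vK K (p.1.2 q)))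
    (Cyc D (gens I n) w ⊓ T) (by
      rintro (j | q) u hu
      · exact ⟨Cyc.gen_mem _ (mem_gens_E j) _ hu.1, hT _ (mem_gens_E j) _ hu.2⟩
      · exact ⟨Cyc.gen_mem _ (mem_gens_Y q.2) _ hu.1, hT _ (mem_gens_Y q.2) _ hu.2⟩)
    f.support f (by
      rintro p - (j | q)
      · have : Wt D n p.1.1 p.1.2 (f p) := hf p
        simp only [Sum.elim_inl]
        rw [E_apply hD this.1]
        split_ifs <;> simp
      · exact (hf p).2 q q.2) (by
      rintro ⟨p, hp⟩ - ⟨p', hp'⟩ - hne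
      by_cases h1 : p.1 = p'.1
      · by_contra! h
        refine hne (Subtype.ext (Prod.ext h1 (funext fun q => ?_)))
        rcases Nat.lt_or_ge q n with hq | hq
        · by_contra hc
          exact vK_ne_of_ne hK hc (h (.inr ⟨q, hq⟩))
        · show p.2 q = p'.2 q
          rw [hp.tail hq, hp'.tail hq]
      · exact ⟨.inl p.1, by simp [h1]⟩) (by
      have : ∑ k ∈ f.support, f k = x := hfx
      rw [this]; exact ⟨hx, hxT⟩)
  rw [← hfx]
  refine Finset.sum_eq_zero fun p hp => ?_
  exact key p.1 p.2 _ (hmem p hp).1 (hmem p hp).2 (hf p)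

end cyclicWeights

section constructions

variable {I : Type} [CommRing I] {n : ℕ}

theorem IsKLR.ev_eq {A : Type} [Ring A] [Algebra O A] {D : G I → A} (h : IsKLR n D) {a b : FF I}
    (hab : urel I n a b) : ev D a = ev D b := hab A D h

theorem IsKLR.prod {A B : Type} [Ring A] [Algebra O A] [Ring B] [Algebra O B] {D : G I → A}
    {D' : G I → B} (h : IsKLR n D) (h' : IsKLR n D') : IsKLR n (fun g => (D g, D' g)) := by
  have e : ∀ z, ev (fun g => (D g, D' g)) z = (ev D z, ev D' z) := by
    have : ev (fun g => (D g, D' g)) = (ev D).prod (ev D') := by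
      refine FreeAlgebra.hom_ext (funext fun g => ?_)
      simp [ev]
    intro z; rw [this]; rfl
  refine isKLR_of_urel fun a b hab => ?_
  rw [e, e, h.ev_eq hab, h'.ev_eq hab]

/-- Restriction of scalars on endomorphism algebras. -/
def resEnd (K L V : Type) [CommRing K] [CommRing L] [Algebra O K] [Algebra O L] [Algebra K L]
    [AddCommGroup V] [Module L V] [Module K V] [Module O V] [IsScalarTower K L V]
    [IsScalarTower O K V] [IsScalarTower O L V] :
    Module.End L V →ₐ[O] Module.End K V where
  toFun f := f.restrictScalars K
  map_one' := rfl
  map_mul' _ _ := rfl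
  map_zero' := rfl
  map_add' _ _ := rfl
  commutes' _ := rfl

variable {K M : Type} [CommRing K] [Algebra O K] [AddCommGroup M] [Module K M] [Module O M]
  [IsScalarTower O K M] {D : G I → Module.End K M}

theorem ev_restrict (D : G I → Module.End K M) {W : Submodule K M} (hW : ∀ g, ∀ v ∈ W, D g v ∈ W)
    (z : FF I) (v : W) : (ev (fun g => (D g).restrict (hW g)) z v : M) = ev D z v := by
  induction z using FreeAlgebra.induction generalizing v with
  | grade0 r => rw [AlgHom.commutes, AlgHom.commutes]; rfl
  | grade1 g => simp [ev]
  | mul a b ha hb => rw [map_mul, map_mul, Module.End.mul_apply, ha, hb, Module.End.mul_apply]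
  | add a b ha hb =>
    rw [map_add, map_add, LinearMap.add_apply, Submodule.coe_add, ha, hb, LinearMap.add_apply]

theorem IsKLR.restrict (h : IsKLR n D) {W : Submodule K M} (hW : ∀ g, ∀ v ∈ W, D g v ∈ W) :
    IsKLR n (fun g => (D g).restrict (hW g)) := by
  refine isKLR_of_urel fun a b hab => LinearMap.ext fun v => Subtype.ext ?_
  rw [ev_restrict, ev_restrict, h.ev_eq hab]

theorem ev_mapQ (D : G I → Module.End K M) {W : Submodule K M} (hW : ∀ g, W ≤ W.comap (D g))
    (z : FF I) (v : M) : ev (fun g => W.mapQ W (D g) (hW g)) z (Submodule.Quotient.mk v) =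
      Submodule.Quotient.mk (ev D z v) := by
  induction z using FreeAlgebra.induction generalizing v with
  | grade0 r => rw [AlgHom.commutes, AlgHom.commutes]; rfl
  | grade1 g => simp [ev]
  | mul a b ha hb => rw [map_mul, map_mul, Module.End.mul_apply, hb, ha, Module.End.mul_apply]
  | add a b ha hb =>
    rw [map_add, map_add, LinearMap.add_apply, ha, hb, LinearMap.add_apply,
      Submodule.Quotient.mk_add]

theorem IsKLR.mapQ (h : IsKLR n D) {W : Submodule K M} (hW : ∀ g, W ≤ W.comap (D g)) :
    IsKLR n (fun g => W.mapQ W (D g) (hW g)) := by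
  refine isKLR_of_urel fun a b hab => LinearMap.ext fun v => ?_
  obtain ⟨v, rfl⟩ := Submodule.Quotient.mk_surjective W v
  rw [ev_mapQ, ev_mapQ, h.ev_eq hab]

end constructions

section algebra

variable {I : Type} [CommRing I] {l n : ℕ} {κ : Fin l → I}

theorem ev_comp {A B : Type*} [Ring A] [Algebra O A] [Ring B] [Algebra O B] (f : A →ₐ[O] B)
    (D : G I → A) (z : FF I) : ev (fun g => f (D g)) z = f (ev D z) := by
  have : ev (fun g => f (D g)) = f.comp (ev D) := by
    refine FreeAlgebra.hom_ext (funext fun g => ?_)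
    simp [ev]
  rw [this]; rfl

theorem map_cycPoly {A B : Type*} [Ring A] [Algebra O A] [Ring B] [Algebra O B] (f : A →ₐ[O] B)
    (k : I) (y : A) : f (cycPoly κ k y) = cycPoly κ k (f y) := by
  rw [cycPoly, cycPoly, map_list_prod, List.map_map]
  congr 1
  refine List.map_congr_left fun c _ => ?_
  simp only [Function.comp_apply]
  split_ifs
  · rw [map_sub, AlgHom.commutes]
  · rw [map_one]

theorem IsCyc.map {A B : Type*} [Ring A] [Algebra O A] [Ring B] [Algebra O B] (f : A →ₐ[O] B)
    {D : G I → A} (h : IsCyc κ D) : IsCyc κ (fun g => f (D g)) := by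
  intro i
  show f (D (.E i)) * cycPoly κ (i 0) (f (D (.Y 0))) = 0
  rw [← map_cycPoly, ← map_mul, h i, map_zero]

theorem IsCyc.prod {A B : Type*} [Ring A] [Algebra O A] [Ring B] [Algebra O B] {D : G I → A}
    {D' : G I → B} (h : IsCyc κ D) (h' : IsCyc κ D') : IsCyc κ (fun g => (D g, D' g)) := by
  intro i
  refine Prod.ext ?_ ?_
  · have := map_cycPoly (κ := κ) (AlgHom.fst O A B) (i 0) (D (.Y 0), D' (.Y 0))
    simp only [AlgHom.fst_apply] at this
    simp only [Prod.fst_mul, this]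
    exact h i
  · have := map_cycPoly (κ := κ) (AlgHom.snd O A B) (i 0) (D (.Y 0), D' (.Y 0))
    simp only [AlgHom.snd_apply] at this
    simp only [Prod.snd_mul, this]
    exact h' i

/-- The diagonal action on a product. -/
def prodEnd (K M N : Type) [Field K] [Algebra O K] [AddCommGroup M] [Module K M] [Module O M]
    [IsScalarTower O K M] [AddCommGroup N] [Module K N] [Module O N] [IsScalarTower O K N] :
    Module.End K M × Module.End K N →ₐ[O] Module.End K (M × N) where
  toFun f := f.1.prodMap f.2
  map_one' := rfl
  map_mul' _ _ := rfl
  map_zero' := rfl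
  map_add' _ _ := rfl
  commutes' _ := rfl

theorem cycPoly_eigen {L V : Type} [Field L] [Algebra O L] [AddCommGroup V] [Module L V]
    [Module O V] [IsScalarTower O L V] {y : Module.End L V} {a : L} {v : V} (h : y v = a • v)
    (k : I) : cycPoly κ k y v = cycPoly κ k a • v := by
  unfold cycPoly
  induction List.finRange l with
  | nil => simp
  | cons c t ih =>
    simp only [List.map_cons, List.prod_cons, Module.End.mul_apply, ih, map_smul]
    generalize (t.map fun c : Fin l => if κ c = k then
      a - algebraMap O L (Polynomial.X ^ 2 * (c.1 : O)) else 1).prod = p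
    rw [mul_comm _ p, mul_smul]
    congr 1
    split_ifs
    · rw [LinearMap.sub_apply, h, Module.algebraMap_end_apply, sub_smul, algebraMap_smul]
    · rw [Module.End.one_apply, one_smul]

theorem cycPoly_prod {L : Type} [Field L] [Algebra O L] (k : I) (a : L) :
    cycPoly κ k a = ∏ c : Fin l, if κ c = k then a - algebraMap O L (Polynomial.X ^ 2 * (c.1 : O))
      else 1 := (Fin.prod_univ_def _).symm

end algebra

section killing

variable {I : Type} [CommRing I] {l n : ℕ} {κ : Fin l → I}
variable {K L : Type} [Field K] [Field L] [Algebra O K] [Algebra K L] [Algebra O L]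
  [IsScalarTower O K L] [Setup K L]

theorem cycPoly_vL {c : Fin l} {k : I} (hc : κ c = k) :
    cycPoly κ k (vL K L (.inl (c, 0) : Lab I l)) = 0 := by
  rw [cycPoly_prod]
  refine Finset.prod_eq_zero (Finset.mem_univ c) ?_
  rw [if_pos hc, vL, vK, ← IsScalarTower.algebraMap_apply]
  simp

theorem StdU.zero {t : ℕ → Lab I l} (ht : StdU n t) (hn : 0 < n) : ∃ c, t 0 = .inl (c, 0) := by
  obtain ⟨⟨c, h⟩, ha, h1, h2⟩ := ht 0 hn
  simp only [st, prv] at h1 h2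
  exact ⟨c, by rw [ha]; congr 2; omega⟩

theorem isCyc_DT (hn : 0 < n) {T : Set (ℕ → Lab I l)} (hT : ∀ t ∈ T, StdU n t) :
    IsCyc κ (DT κ K L n T) := by
  intro i
  refine Finsupp.lhom_ext' fun t => LinearMap.ext_ring ?_
  simp only [LinearMap.comp_apply, Finsupp.lsingle_apply, Module.End.mul_apply,
    LinearMap.zero_apply]
  by_cases ht : t ∈ T
  · have h1 := DT_bv (κ := κ) (K := K) (L := L) _ (mem_gens_Y hn) t (T := T) ht
    rw [raw_Y] at h1
    obtain ⟨c, hc⟩ := (hT t ht).zero hn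
    rw [cycPoly_eigen h1, map_smul, DT_bv _ (mem_gens_E i) _ ht, raw_E]
    split_ifs with hi
    · have : κ c = i 0 := by rw [← hi, Function.comp_apply, hc]; simp [resid]
      rw [hc, cycPoly_vL this, zero_smul]
    · simp
  · have h1 : DT κ K L n T (.Y 0) (bv t) = (0 : L) • bv t := by
      rw [DT_bv_not _ t ht, zero_smul]
    rw [cycPoly_eigen h1, map_smul, DT_bv_not _ t ht, smul_zero]

/-- Two cyclotomic modules with weight vectors of the same nonzero weight have the same
relations. -/
theorem kill_transfer [Nontrivial I] {M V : Type} [AddCommGroup M] [Module K M] [Module O M]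
    [IsScalarTower O K M] [AddCommGroup V] [Module K V] [Module O V] [IsScalarTower O K V]
    {D : G I → Module.End K M} {D' : G I → Module.End K V}
    (hK : Function.Injective (algebraMap O K)) (hD : IsKLR n D) (hC : IsCyc κ D)
    (hD' : IsKLR n D') (hC' : IsCyc κ D') {j : ℕ → I} {c : ℕ → Fin l × ℤ} {u : M} {v : V}
    (hu : Wt D n j c u) (hv : Wt D' n j c v) (hv0 : v ≠ 0) {z : FF I}
    (hz : z ∈ FA (gens I n)) (hkill : ev D' z v = 0) : ev D z u = 0 := by
  let P : G I → Module.End K (M × V) := fun g => prodEnd K M V (D g, D' g)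
  have hP : IsKLR n P := (hD.prod hD').map (prodEnd K M V)
  have hPC : IsCyc κ P := (hC.prod hC').map (prodEnd K M V)
  have hw : Wt P n j c (u, v) :=
    ⟨Prod.ext hu.1 hv.1, fun q hq => Prod.ext (hu.2 q hq) (hv.2 q hq)⟩
  let T0 : Submodule K (M × V) := LinearMap.ker (LinearMap.snd K M V)
  have hT0 : ∀ g ∈ gens I n, ∀ x ∈ T0, P g x ∈ T0 := by
    intro g _ x hx
    have hx' : x.2 = 0 := hx
    show D' g x.2 = 0
    rw [hx', map_zero]
  have hw0 : (u, v) ∉ T0 := hv0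
  have hev : ev P z (u, v) = (ev D z u, 0) := by
    have e1 : ev (fun g => (D g, D' g)) z = (ev D z, ev D' z) := by
      refine Prod.ext ?_ ?_
      · exact (ev_comp (AlgHom.fst O _ _) (fun g => (D g, D' g)) z).symm
      · exact (ev_comp (AlgHom.snd O _ _) (fun g => (D g, D' g)) z).symm
    have e3 := ev_comp (prodEnd K M V) (fun g => (D g, D' g)) z
    refine (app e3 _).trans ?_
    rw [e1]
    exact Prod.ext rfl hkill
  have := cyc_inf hK hP hPC hw hT0 hw0 _ (Submodule.subset_span ⟨z, hz, rfl⟩) (by rw [hev]; rfl)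
  rw [hev] at this
  exact (Prod.ext_iff.1 this).1

theorem kill_transfer_tower [Nontrivial I] {M V : Type} [AddCommGroup M] [Module K M] [Module O M]
    [IsScalarTower O K M] [AddCommGroup V] [Module L V] [Module O V] [IsScalarTower O L V]
    {D : G I → Module.End K M} {D' : G I → Module.End L V}
    (hK : Function.Injective (algebraMap O K)) (hD : IsKLR n D) (hC : IsCyc κ D)
    (hD' : IsKLR n D') (hC' : IsCyc κ D') {j : ℕ → I} {c : ℕ → Fin l × ℤ} {u : M} {v : V}
    (hu : Wt D n j c u) (hvE : D' (.E j) v = v)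
    (hvY : ∀ q < n, D' (.Y q) v = algebraMap K L (vK K (c q)) • v) (hv0 : v ≠ 0) {z : FF I}
    (hz : z ∈ FA (gens I n)) (hkill : ev D' z v = 0) : ev D z u = 0 := by
  let _ : Module K V := Module.compHom V (algebraMap K L)
  have _ : IsScalarTower K L V := IsScalarTower.of_algebraMap_smul fun _ _ => rfl
  have _ : IsScalarTower O K V := IsScalarTower.of_algebraMap_smul fun r x => by
    rw [← algebraMap_smul L (algebraMap O K r) x, ← IsScalarTower.algebraMap_apply,
      algebraMap_smul]
  refine kill_transfer hK hD hC (hD'.map (resEnd K L V)) (hC'.map (resEnd K L V)) hu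
    (v := v) ⟨hvE, fun q hq => (hvY q hq).trans (algebraMap_smul L _ _)⟩ hv0 hz ?_
  rw [ev_comp (resEnd K L V)]
  exact hkill

/-- An element killing all standard sequences kills cyclotomic modules over `K`. -/
theorem kill_cyclotomic [Nontrivial I] (L : Type) [Field L] [Algebra K L] [Algebra O L]
    [IsScalarTower O K L] [Setup K L]
    {M : Type} [AddCommGroup M] [Module K M] [Module O M]
    [IsScalarTower O K M] {D : G I → Module.End K M} (hn : 0 < n) (hD : IsKLR n D)
    (hC : IsCyc κ D) {j : ℕ → I} {z : FF I} (hz : z ∈ FA (gens I n))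
    (hkill : ∀ t : ℕ → Lab I l, Std n t → resid κ ∘ t = j → ev (raw κ K L) z (bv t) = 0)
    {v : M} (hv : D (.E j) v = v) : ev D z v = 0 := by
  have hK : Function.Injective (algebraMap O K) := Setup.inj (L := L)
  rcases isEmpty_or_nonempty (Fin l) with hl | ⟨⟨b⟩⟩
  · have := app (hC j) v
    rw [Module.End.mul_apply, cycPoly] at this
    have hl0 : l = 0 := by by_contra h; exact hl.false ⟨0, by omega⟩
    subst hl0
    simp only [List.finRange_zero, List.map_nil, List.prod_nil, Module.End.one_apply, hv] at this
    rw [this]; simp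
  suffices h : ∀ u c, Wt D n j c u → ev D z u = 0 by
    have h1 := decomp hK hD le_rfl (fun q hq => inc hK hD hC hq) (b, 0) (T := ⊤)
      (fun _ _ _ _ => trivial) trivial hv
    have h2 : Submodule.span K {u | u ∈ (⊤ : Submodule K M) ∧ ∃ c : ℕ → Fin l × ℤ, Wt D n j c u} ≤
        LinearMap.ker (ev D z) := Submodule.span_le.2 fun u hu => by
      obtain ⟨-, c, hc⟩ := hu
      exact h u c hc
    exact h2 h1
  intro u c hu
  by_cases hu0 : u = 0
  · rw [hu0, map_zero]
  obtain ⟨hs, hres⟩ := nonStd hK (fun q hq => inc hK hD hC hq) hu hu0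
  let t : ℕ → Lab I l := fun q => if q < n then .inl (c q) else .inr (j q)
  have ht : Std n t := by
    refine ⟨hs.congr fun q hq => by simp [t, hq, lab], fun q hq => ⟨j q, ?_⟩⟩
    simp [t, Nat.not_lt.2 hq]
  have htj : resid κ ∘ t = j := by
    funext q
    simp only [Function.comp_apply, t]
    split_ifs with hq
    · exact (hres q hq).symm
    · rfl
  refine kill_transfer_tower hK hD hC (isKLR_DT (K := K) (L := L) (adm_Std n) (sep_Std n))
    (isCyc_DT hn fun _ ht => ht.1) hu
    (v := (bv t : VV I l L)) ?_ ?_ ?_ hz ?_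
  · rw [DT_bv _ (mem_gens_E j) t ht, raw_E, if_pos htj]
  · intro q hq
    rw [DT_bv _ (mem_gens_Y hq) t ht, raw_Y]
    simp [t, hq, vL]
  · simp
  · rw [(ev_ST (adm_Std n) hz (bv_mem ht)).1, hkill t ht htj]

/-- The relative form: modulo a submodule containing the cyclotomic relations. -/
theorem kill_mod [Nontrivial I] (L : Type) [Field L] [Algebra K L] [Algebra O L]
    [IsScalarTower O K L] [Setup K L]
    {M : Type} [AddCommGroup M] [Module K M] [Module O M]
    [IsScalarTower O K M] {D : G I → Module.End K M} (hn : 0 < n) (hD : IsKLR n D)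
    (hD0 : ∀ g ∉ gens I n, D g = 0)
    {j : ℕ → I} {v : M} (hv : D (.E j) v = v) {N : Submodule K M}
    (hN : ∀ g ∈ gens I n, ∀ x ∈ N, D g x ∈ N)
    (hC : ∀ u ∈ FA (gens I n), ∀ i, D (.E i) (cycPoly κ (i 0) (D (.Y 0)) (ev D u v)) ∈ N)
    {z : FF I} (hz : z ∈ FA (gens I n))
    (hkill : ∀ t : ℕ → Lab I l, Std n t → resid κ ∘ t = j → ev (raw κ K L) z (bv t) = 0) :
    ev D z v ∈ N := by
  have hW : ∀ g, ∀ x ∈ Cyc D (gens I n) v, D g x ∈ Cyc D (gens I n) v := by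
    intro g x hx
    by_cases hg : g ∈ gens I n
    · exact Cyc.gen_mem g hg x hx
    · rw [hD0 g hg]; exact zero_mem _
  set W := Cyc D (gens I n) v with hWdef
  have h1 := hD.restrict hW
  set D1 : G I → Module.End K W := fun g => (D g).restrict (hW g) with hD1
  have hN1 : ∀ g, N.comap W.subtype ≤ (N.comap W.subtype).comap (D1 g) := by
    intro g x hx
    show D g x ∈ N
    by_cases hg : g ∈ gens I n
    · exact hN g hg _ hx
    · rw [hD0 g hg]; exact zero_mem _
  have h2 := h1.mapQ hN1
  set N1 := N.comap W.subtype
  set D2 : G I → Module.End K (W ⧸ N1) := fun g => N1.mapQ N1 (D1 g) (hN1 g) with hD2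
  have hcyc : IsCyc κ D2 := by
    intro i
    refine LinearMap.ext fun x => ?_
    obtain ⟨⟨x, hx⟩, rfl⟩ := Submodule.Quotient.mk_surjective _ x
    have e1 := ev_mapQ D1 hN1 (gen (.E i) * cycPoly κ (i 0) (gen (.Y 0))) ⟨x, hx⟩
    have e2 := ev_restrict D hW (gen (.E i) * cycPoly κ (i 0) (gen (.Y 0))) ⟨x, hx⟩
    have h0 : ∀ {M' : Type} [AddCommGroup M'] [Module K M'] [Module O M'] [IsScalarTower O K M']
        (D' : G I → Module.End K M'), ev D' (gen (.E i) * cycPoly κ (i 0) (gen (.Y 0))) =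
          D' (.E i) * cycPoly κ (i 0) (D' (.Y 0)) := fun D' => by
      rw [map_mul, map_cycPoly]; simp only [ev, gen, FreeAlgebra.lift_ι_apply]
    rw [h0, h0] at e1 e2
    rw [LinearMap.zero_apply]
    refine e1.trans ((Submodule.Quotient.mk_eq_zero _).2 ?_)
    show ((D1 (.E i) * cycPoly κ (i 0) (D1 (.Y 0))) ⟨x, hx⟩ : M) ∈ N
    rw [e2, Module.End.mul_apply]
    clear e1 e2
    have hx' : x ∈ Submodule.span K _ := hx
    show D (.E i) (cycPoly κ (i 0) (D (.Y 0)) x) ∈ N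
    clear hx
    induction hx' using Submodule.span_induction with
    | mem x hx => obtain ⟨u, hu, rfl⟩ := hx; exact hC u hu i
    | zero => rw [map_zero, map_zero]; exact zero_mem _
    | add a b _ _ ha hb => rw [map_add, map_add]; exact add_mem ha hb
    | smul k a _ ha => rw [map_smul, map_smul]; exact Submodule.smul_mem _ _ ha
  have hvW : v ∈ W := Cyc.self _ _ _
  have := kill_cyclotomic L hn h2 hcyc hz hkill (v := Submodule.Quotient.mk ⟨v, hvW⟩) (by
    show Submodule.Quotient.mk (D1 (.E j) ⟨v, hvW⟩) = _
    congr 1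
    exact Subtype.ext hv)
  rw [hD2, ev_mapQ, Submodule.Quotient.mk_eq_zero] at this
  have h3 := ev_restrict D hW z ⟨v, hvW⟩
  rw [← h3]
  exact this

end killing

section moving

variable {β : Type*}

/-- Move the label in position `n` to position `p`. -/
def mv (n p : ℕ) (t : ℕ → β) (q : ℕ) : β :=
  if q < p then t q else if q = p then t n else if q ≤ n then t (q - 1) else t q

variable {n p q r : ℕ} {t : ℕ → β}

theorem mv_lt (h : q < p) : mv n p t q = t q := by simp [mv, h]
@[simp] theorem mv_eq : mv n p t p = t n := by simp [mv]
theorem mv_gt (h : p < q) (h' : q ≤ n) : mv n p t q = t (q - 1) := by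
  simp [mv, h', Nat.not_lt.2 h.le, h.ne']
theorem mv_gt' (h : p ≤ n) (h' : n < q) : mv n p t q = t q := by
  rw [mv, if_neg (by omega), if_neg (by omega), if_neg (by omega)]

@[simp] theorem mv_self : mv n n t = t := by
  funext q
  rcases lt_trichotomy q n with h | rfl | h
  · exact mv_lt h
  · exact mv_eq
  · exact mv_gt' le_rfl h

theorem sw_mv_self (h : p < n) : sw p (mv n p t) = mv n (p + 1) t := by
  funext q
  rw [sw_apply]
  split_ifs with h1 h2
  · subst h1; rw [mv_gt (by omega) (by omega), mv_lt (by omega)]; rfl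
  · subst h2; simp
  · rcases Nat.lt_or_ge q p with h3 | h3
    · rw [mv_lt h3, mv_lt (by omega)]
    · rcases Nat.lt_or_ge n q with h4 | h4
      · rw [mv_gt' h.le h4, mv_gt' h h4]
      · rw [mv_gt (by omega) h4, mv_gt (by omega) h4]

theorem sw_mv_lt (h : r + 1 < p) (hp : p ≤ n) : sw r (mv n p t) = mv n p (sw r t) := by
  funext q
  simp only [sw_apply, mv]
  split_ifs <;> first | omega | rfl

theorem sw_mv_gt (h : p < r) (hr : r + 1 ≤ n) : sw r (mv n p t) = mv n p (sw (r - 1) t) := by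
  funext q
  simp only [sw_apply, mv]
  split_ifs <;> first | omega | rfl | (congr 1; omega)

theorem mv_comp {γ : Type*} (f : β → γ) : f ∘ mv n p t = mv n p (f ∘ t) := by
  funext q
  simp only [Function.comp_apply, mv]
  split_ifs <;> rfl

theorem mv_inj (hp : p ≤ n) {s : ℕ → β} (h : mv n p t = mv n p s) : t = s := by
  funext q
  rcases Nat.lt_or_ge q p with h1 | h1
  · rw [← mv_lt (n := n) h1 (t := t), h, mv_lt h1]
  · rcases lt_trichotomy q n with h2 | rfl | h2
    · have := congrFun h (q + 1)
      rwa [mv_gt (by omega) (by omega), mv_gt (by omega) (by omega), Nat.add_sub_cancel] at this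
    · rw [← mv_eq (p := p) (t := t), h, mv_eq]
    · rw [← mv_gt' hp h2 (t := t), h, mv_gt' hp h2]

end moving

section moved

variable {I : Type} [CommRing I] {l n : ℕ}

/-- Standard sequences with one free strand inserted. -/
def TW (I : Type) (l n : ℕ) : Set (ℕ → Lab I l) := {u | ∃ p ≤ n, ∃ t, Std n t ∧ u = mv n p t}

/-- Sequences whose first free strand is in position `p`. -/
def Tp (I : Type) (l n p : ℕ) : Set (ℕ → Lab I l) :=
  {t | ∀ q ≤ n, (t q).isRight = true ↔ q = p}

theorem Std.inl {t : ℕ → Lab I l} (ht : Std n t) {q : ℕ} (hq : q < n) : ∃ c, t q = .inl c :=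
  let ⟨c, h, _⟩ := ht.1 q hq; ⟨c, h⟩

theorem mv_mem_TW {t : ℕ → Lab I l} (ht : Std n t) {p : ℕ} (hp : p ≤ n) : mv n p t ∈ TW I l n :=
  ⟨p, hp, t, ht, rfl⟩

theorem Std.mem_TW {t : ℕ → Lab I l} (ht : Std n t) : t ∈ TW I l n :=
  ⟨n, le_rfl, t, ht, mv_self.symm⟩

theorem mv_mem_Tp {t : ℕ → Lab I l} (ht : Std n t) {p : ℕ} (hp : p ≤ n) :
    mv n p t ∈ Tp I l n p := by
  intro q hq
  obtain ⟨k, hk⟩ := ht.2 n le_rfl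
  rcases lt_trichotomy q p with h | rfl | h
  · obtain ⟨c, hc⟩ := ht.inl (by omega : q < n)
    rw [mv_lt h, hc]; simp [h.ne]
  · rw [mv_eq, hk]; simp
  · obtain ⟨c, hc⟩ := ht.inl (by omega : q - 1 < n)
    rw [mv_gt h hq, hc]; simp [h.ne']

theorem Tp_disjoint {t : ℕ → Lab I l} {p p' : ℕ} (hp : p ≤ n) (h : t ∈ Tp I l n p)
    (h' : t ∈ Tp I l n p') : p = p' := (h' p hp).1 ((h p hp).2 rfl)

theorem Tp_sw {t : ℕ → Lab I l} {p r : ℕ} (h : t ∈ Tp I l n p) (hr : r + 1 ≤ n) (h1 : p ≠ r)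
    (h2 : p ≠ r + 1) : sw r t ∈ Tp I l n p := by
  intro q hq
  rw [sw_apply]
  split_ifs with h3 h4
  · rw [h _ hr]; omega
  · rw [h _ (by omega)]; omega
  · exact h q hq

theorem adm_TW : Adm (n + 1) (TW I l n) := by
  rintro _ ⟨p, hp, t, ht, rfl⟩ r hr hs
  by_contra hl
  apply hs
  rcases lt_trichotomy (r + 1) p with h | rfl | h
  · rw [sw_mv_lt h hp]
    refine mv_mem_TW (ht.sw (by omega) ?_) hp
    rwa [mv_lt (by omega), mv_lt h] at hl
  · rw [← sw_mv_self (by omega), sw_sw]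
    exact mv_mem_TW ht (by omega)
  · rcases eq_or_lt_of_le (Nat.lt_succ_iff.1 h) with h' | h'
    · subst h'
      rw [sw_mv_self (by omega)]
      exact mv_mem_TW ht (by omega)
    · obtain ⟨r, rfl⟩ := Nat.exists_eq_add_of_lt h'
      rw [sw_mv_gt h' (by omega)]
      refine mv_mem_TW (ht.sw (by omega) ?_) hp
      rw [mv_gt (by omega) (by omega), mv_gt (by omega) (by omega)] at hl
      exact hl

variable {κ : Fin l → I}
variable {K L : Type} [Field K] [Field L] [Algebra O K] [Algebra K L] [Algebra O L]
  [IsScalarTower O K L] [Setup K L]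

theorem vL_ne_Std {t : ℕ → Lab I l} (ht : Std n t) {q r : ℕ} (hqr : q < r) (hr : r < n)
    (h : r ≤ q + 2) : vL K L (t q) ≠ vL K L (t r) := by
  obtain ⟨c, hc⟩ := ht.inl (hqr.trans hr)
  refine vL_ne K L ?_ ⟨c, .inl hc⟩
  rcases (by omega : r = q + 1 ∨ r = q + 2) with rfl | rfl
  · exact ht.1.ne_succ hr
  · exact ht.1.ne_succ_succ hr

theorem sep_TW : Sep (K := K) (L := L) (n + 1) (TW I l n) := by
  rintro _ ⟨p, hp, t, ht, rfl⟩
  obtain ⟨k, hk⟩ := ht.2 n le_rfl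
  have key : ∀ q r, q < r → r ≤ n → r ≤ q + 2 →
      vL K L (mv n p t q) ≠ vL K L (mv n p t r) := by
    intro q r h1 h2 h3
    have hne : ∀ q', q' < n → t q' ≠ t n := by
      intro q' hq'
      obtain ⟨c, hc⟩ := ht.inl hq'
      simp [hc, hk]
    rcases lt_trichotomy q p with hq | rfl | hq
    · rw [mv_lt hq]
      rcases lt_trichotomy r p with hr | rfl | hr
      · rw [mv_lt hr]; exact vL_ne_Std ht h1 (by omega) h3
      · obtain ⟨c, hc⟩ := ht.inl (by omega : q < n)
        rw [mv_eq]
        exact vL_ne K L (hne q (by omega)) ⟨c, .inl hc⟩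
      · rw [mv_gt hr h2]; exact vL_ne_Std ht (by omega) (by omega) (by omega)
    · obtain ⟨c, hc⟩ := ht.inl (by omega : r - 1 < n)
      rw [mv_eq, mv_gt h1 h2]
      exact vL_ne K L (hne _ (by omega)).symm ⟨c, .inr hc⟩
    · rw [mv_gt hq (by omega), mv_gt (by omega) h2]
      exact vL_ne_Std ht (by omega) (by omega) (by omega)
  exact ⟨fun r hr => key _ _ (by omega) (by omega) (by omega),
    fun r hr => key _ _ (by omega) (by omega) (by omega)⟩

variable (κ K L n) in
/-- The induced representation on `n + 1` strands. -/
abbrev DW : G I → Module.End L (VV I l L) := DT κ K L (n + 1) (TW I l n)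

theorem isKLR_DW [Nontrivial I] : IsKLR (n + 1) (DW n κ K L) := isKLR_DT adm_TW sep_TW

theorem ST_mono {T T' : Set (ℕ → Lab I l)} (h : T ⊆ T') : ST L T ≤ ST L T' :=
  Submodule.span_mono (Set.image_mono h)

theorem mem_ST {T : Set (ℕ → Lab I l)} {v : VV I l L} : v ∈ ST L T ↔ ∀ t ∉ T, v t = 0 := by
  rw [ST, ← Finsupp.supported_eq_span_single, Finsupp.mem_supported']

theorem DW_E {t : ℕ → Lab I l} (ht : t ∈ TW I l n) (i : ℕ → I) :
    DW n κ K L (.E i) (bv t) = if resid κ ∘ t = i then bv t else 0 := by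
  rw [DT_bv _ (mem_gens_E i) t ht, raw_E]

theorem DW_Y {t : ℕ → Lab I l} (ht : t ∈ TW I l n) {r : ℕ} (hr : r ≤ n) :
    DW n κ K L (.Y r) (bv t) = vL K L (t r) • bv t := by
  rw [DT_bv _ (mem_gens_Y (by omega)) t ht, raw_Y]

theorem DW_P {t : ℕ → Lab I l} (ht : t ∈ TW I l n) {r : ℕ} (hr : r < n) :
    DW n κ K L (.P r) (bv t) = kap κ K L (t r) (t (r + 1)) • bv (sw r t) +
      dd κ K L (t r) (t (r + 1)) • bv t := by
  rw [DT_bv _ (mem_gens_P (by omega)) t ht, raw_P]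

/-- The span of basis vectors whose free strand is in one of the first `a` positions met. -/
def Low (I : Type) (l : ℕ) (L : Type) [Field L] (b : Bool) (n a : ℕ) : Submodule L (VV I l L) :=
  ST L {t | t ∈ TW I l n ∧ ∃ j < a, t ∈ Tp I l n (pos b n j)}

theorem Low_mono {b : Bool} {a a' : ℕ} (h : a ≤ a') : Low I l L b n a ≤ Low I l L b n a' :=
  ST_mono fun _ ⟨h1, j, hj, h2⟩ => ⟨h1, j, hj.trans_le h, h2⟩

theorem Low_P {b : Bool} {a : ℕ} (ha : a < n) {v : VV I l L} (hv : v ∈ Low I l L b n a) :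
    DW n κ K L (.P (cr b n a)) v ∈ Low I l L b n a := by
  have hcr : cr b n a < n := by cases b <;> simp [cr] <;> omega
  have : Low I l L b n a ≤ (Low I l L b n a).comap (DW n κ K L (.P (cr b n a))) := by
    refine Submodule.span_le.2 ?_
    rintro _ ⟨t, ⟨ht, j, hj, htj⟩, rfl⟩
    show DW n κ K L (.P (cr b n a)) (bv t) ∈ Low I l L b n a
    rw [DW_P ht hcr]
    refine add_mem ?_ (Submodule.smul_mem _ _ (bv_mem ⟨ht, j, hj, htj⟩))
    by_cases hs : sw (cr b n a) t ∈ TW I l n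
    · refine Submodule.smul_mem _ _ (bv_mem ⟨hs, j, hj, Tp_sw htj hcr ?_ ?_⟩) <;>
        cases b <;> simp [cr, pos] <;> omega
    · rw [kap_linked _ _ _ (adm_TW t ht _ (by omega) hs), zero_smul]
      exact zero_mem _
  exact this hv

variable (κ K L n) in
/-- The leading coefficient of a chain of crossings. -/
def lead (b : Bool) (a : ℕ) (s : ℕ → Lab I l) : L :=
  ∏ j ∈ Finset.range a, if b then kap κ K L (s (n - 1 - j)) (s n) else kap κ K L (s n) (s j)

theorem not_linked_inr {a : Lab I l} {k : I} : ¬ linked a (.inr k) := by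
  rcases a with a | a <;> simp [linked]

theorem lead_ne (b : Bool) {a : ℕ} (ha : a ≤ n) {s : ℕ → Lab I l} (hs : Std n s) :
    lead n κ K L b a s ≠ 0 := by
  refine Finset.prod_ne_zero_iff.2 fun j hj => ?_
  rw [Finset.mem_range] at hj
  obtain ⟨k, hk⟩ := hs.2 n le_rfl
  cases b
  · obtain ⟨c, hc⟩ := hs.inl (by omega : j < n)
    simp only [Bool.false_eq_true, if_false]
    rw [hk, hc]
    exact kap_ne κ K L (not_linked_symm not_linked_inr) (vL_ne K L (by simp) ⟨c, .inr rfl⟩)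
  · obtain ⟨c, hc⟩ := hs.inl (by omega : n - 1 - j < n)
    simp only [if_true]
    rw [hk, hc]
    exact kap_ne κ K L not_linked_inr (vL_ne K L (by simp) ⟨c, .inl rfl⟩)

theorem pos_le (b : Bool) {a : ℕ} (ha : a ≤ n) : pos b n a ≤ n := by
  cases b <;> simp [pos]; omega

theorem chain_bv (b : Bool) {a : ℕ} (ha : a ≤ n) {s : ℕ → Lab I l} (hs : Std n s) :
    chi (fun j => DW n κ K L (.P (cr b n j))) a (bv (mv n (pos b n 0) s)) -
      lead n κ K L b a s • bv (mv n (pos b n a) s) ∈ Low I l L b n a := by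
  induction a with
  | zero => simp [chi, lead]
  | succ a ih =>
    have hcr : cr b n a < n := by cases b <;> simp [cr] <;> omega
    have h := Low_mono (Nat.le_succ a) (Low_P (κ := κ) (K := K) (by omega) (ih (by omega)))
    rw [map_sub, map_smul, DW_P (mv_mem_TW hs (pos_le b (by omega)))
      hcr] at h
    have e1 : sw (cr b n a) (mv n (pos b n a) s) = mv n (pos b n (a + 1)) s := by
      cases b
      · exact sw_mv_self (by omega)
      · simp only [cr, pos, if_true]
        obtain ⟨m, rfl⟩ : ∃ m, n = m + 1 + a := ⟨n - 1 - a, by omega⟩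
        rw [show m + 1 + a - 1 - a = m by omega, show m + 1 + a - a = m + 1 by omega,
          show m + 1 + a - (a + 1) = m by omega, ← sw_mv_self (by omega), sw_sw]
    have e2 : lead n κ K L b (a + 1) s = lead n κ K L b a s *
        kap κ K L (mv n (pos b n a) s (cr b n a)) (mv n (pos b n a) s (cr b n a + 1)) := by
      rw [lead, Finset.prod_range_succ, ← lead]
      congr 1
      cases b
      · simp only [cr, pos, Bool.false_eq_true, if_false, mv_eq]
        rw [mv_gt (by omega) (by omega), Nat.add_sub_cancel]
      · simp only [cr, pos, if_true]
        rw [mv_lt (by omega), show n - 1 - a + 1 = n - a by omega, mv_eq]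
    rw [e1, smul_add, smul_smul, ← e2] at h
    have h2 : lead n κ K L b a s • dd κ K L (mv n (pos b n a) s (cr b n a))
        (mv n (pos b n a) s (cr b n a + 1)) • (bv (mv n (pos b n a) s) : VV I l L) ∈
        Low I l L b n (a + 1) :=
      Submodule.smul_mem _ _ (Submodule.smul_mem _ _ (bv_mem
        ⟨mv_mem_TW hs (pos_le b (by omega)), a, Nat.lt_succ_self a,
          mv_mem_Tp hs (pos_le b (by omega))⟩))
    have h3 := add_mem h h2
    rw [chi, Module.End.mul_apply]
    convert h3 using 1
    abel

end moved

section chains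

variable {I : Type} [CommRing I] {l n : ℕ} {κ : Fin l → I}
variable {K L : Type} [Field K] [Field L] [Algebra O K] [Algebra K L] [Algebra O L]
  [IsScalarTower O K L] [Setup K L]

variable (n κ K L) in
/-- Products of consecutive crossings in the induced representation. -/
abbrev XX (b : Bool) (a : ℕ) : Module.End L (VV I l L) :=
  chi (fun j => DW n κ K L (.P (cr b n j))) a

/-- The starting basis vector attached to a standard sequence. -/
abbrev F0 (b : Bool) (n : ℕ) (s : ℕ → Lab I l) : ℕ → Lab I l := mv n (pos b n 0) s

theorem pos_inj {b : Bool} {a a' : ℕ} (_ha : a ≤ n) (_ha' : a' ≤ n) (h : pos b n a = pos b n a') :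
    a = a' := by
  cases b <;> simp [pos] at h <;> omega

theorem Low_coef {b : Bool} {a : ℕ} (_ha : a ≤ n) {y : VV I l L} (hy : y ∈ Low I l L b n a)
    {s : ℕ → Lab I l} (hs : Std n s) {a' : ℕ} (h : a ≤ a') (ha' : a' ≤ n) :
    y (mv n (pos b n a') s) = 0 := by
  refine mem_ST.1 hy _ fun ⟨_, j, hj, hT⟩ => ?_
  have := pos_inj (by omega) (by omega)
    (Tp_disjoint (pos_le b (by omega)) (mv_mem_Tp hs (pos_le b ha')) hT)
  omega

theorem XX_coef (b : Bool) {a a' : ℕ} (h : a ≤ a') (ha' : a' ≤ n) {v : VV I l L}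
    (hv : v ∈ ST L (F0 b n '' {s | Std n s})) {s : ℕ → Lab I l} (hs : Std n s) :
    XX n κ K L b a v (mv n (pos b n a') s) =
      if a = a' then lead n κ K L b a s * v (F0 b n s) else 0 := by
  induction hv using Submodule.span_induction with
  | mem v hv =>
    obtain ⟨_, ⟨s', hs', rfl⟩, rfl⟩ := hv
    have h1 := Low_coef (h.trans ha') (chain_bv (κ := κ) (K := K) (L := L) b (h.trans ha') hs') hs h ha'
    rw [Finsupp.sub_apply, sub_eq_zero] at h1
    rw [h1, Finsupp.smul_apply]
    split_ifs with hh
    · subst hh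
      simp only [Finsupp.single_apply, smul_eq_mul]
      have : mv n (pos b n a) s' = mv n (pos b n a) s ↔ F0 b n s' = F0 b n s :=
        ⟨fun e => by rw [mv_inj (pos_le b ha') e],
          fun e => by rw [mv_inj (pos_le b (Nat.zero_le n)) e]⟩
      by_cases e : F0 b n s' = F0 b n s
      · rw [if_pos e, if_pos (this.2 e), mv_inj (pos_le b (Nat.zero_le n)) e]
      · rw [if_neg e, if_neg (this.not.2 e), mul_zero, mul_zero]
    · rw [Finsupp.single_eq_of_ne, smul_zero]
      intro e
      have h2 := mv_mem_Tp hs' (pos_le b (h.trans ha'))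
      rw [← e] at h2
      exact hh (pos_inj (h.trans ha') ha' (Tp_disjoint (pos_le b ha')
        (mv_mem_Tp hs (pos_le b ha')) h2).symm)
  | zero => simp
  | add u v _ _ hu hv =>
    rw [map_add, Finsupp.add_apply, hu, hv, Finsupp.add_apply]
    split_ifs <;> ring
  | smul c v _ hv =>
    rw [map_smul, Finsupp.smul_apply, hv, Finsupp.smul_apply, smul_eq_mul, smul_eq_mul]
    split_ifs <;> ring

/-- The chains of crossings are independent. -/
theorem XX_indep (b : Bool) {h : ℕ → VV I l L}
    (hh : ∀ a, h a ∈ ST L (F0 b n '' {s | Std n s}))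
    (h0 : ∑ a ∈ Finset.range (n + 1), XX n κ K L b a (h a) = 0) : ∀ a ≤ n, h a = 0 := by
  suffices ∀ d a, a + d = n → h a = 0 from fun a ha => this (n - a) a (by omega)
  intro d
  induction d using Nat.strong_induction_on with
  | _ d ih =>
    intro a had
    refine Finsupp.ext fun t => ?_
    by_cases ht : t ∈ F0 b n '' {s | Std n s}
    · obtain ⟨s, hs, rfl⟩ := ht
      have h1 := congrArg (fun v : VV I l L => v (mv n (pos b n a) s)) h0
      simp only [Finsupp.finsetSum_apply, Finsupp.zero_apply] at h1
      rw [Finset.sum_eq_single a] at h1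
      · rw [XX_coef b le_rfl (by omega) (hh a) hs, if_pos rfl] at h1
        exact (mul_eq_zero.1 h1).resolve_left (lead_ne b (by omega) hs)
      · intro a' ha' hne
        rw [Finset.mem_range] at ha'
        rcases lt_or_gt_of_ne hne with h2 | h2
        · rw [XX_coef b h2.le (by omega) (hh a') hs, if_neg hne]
        · rw [ih (n - a') (by omega) a' (by omega), map_zero, Finsupp.zero_apply]
      · intro h2
        exact absurd (Finset.mem_range.2 (by omega)) h2
    · exact mem_ST.1 (hh a) t ht

theorem Std.τ {s : ℕ → Lab I l} (hs : Std n s) : vL K L (s n) = Setup.τ K := by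
  obtain ⟨k, hk⟩ := hs.2 n le_rfl
  rw [hk]; rfl

theorem F0_mem (b : Bool) {s : ℕ → Lab I l} (hs : Std n s) : F0 b n s ∈ TW I l n :=
  mv_mem_TW hs (pos_le b (Nat.zero_le n))

theorem normalForm_bv (b : Bool) {s : ℕ → Lab I l} (hs : Std n s) (N : ℕ) (c : ℕ → ℕ → FF I) :
    normalForm b n (DW n κ K L) (resid κ ∘ F0 b n s) N c (bv (F0 b n s)) =
      ∑ a ∈ Finset.range (n + 1), XX n κ K L b a (∑ m ∈ Finset.range N,
        (Setup.τ K : L) ^ m • ev (DW n κ K L) (c a m) (bv (F0 b n s))) := by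
  have hY : ∀ m : ℕ, (DW n κ K L (.Y (pos b n 0)) ^ m) (bv (F0 b n s)) =
      (Setup.τ K : L) ^ m • bv (F0 b n s) := by
    intro m
    induction m with
    | zero => simp
    | succ m ih =>
      have e : F0 b n s (pos b n 0) = s n := mv_eq
      rw [pow_succ, Module.End.mul_apply, DW_Y (F0_mem b hs) (pos_le b (Nat.zero_le n)), e,
        hs.τ, map_smul, ih, smul_smul, pow_succ']
  rw [normalForm, LinearMap.sum_apply]
  refine Finset.sum_congr rfl fun a _ => ?_
  rw [LinearMap.sum_apply, map_sum]
  refine Finset.sum_congr rfl fun m _ => ?_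
  simp only [Module.End.mul_apply]
  rw [DW_E (F0_mem b hs), if_pos rfl, hY, map_smul, map_smul]

/-- The rational span of the basis vectors in `T`. -/
def KS (K : Type) {I : Type} {l : ℕ} {L : Type} [Field K] [Field L] [Algebra K L]
    (T : Set (ℕ → Lab I l)) : Submodule K (VV I l L) := Submodule.span K (bv '' T)

theorem mem_KS {T : Set (ℕ → Lab I l)} {v : VV I l L} (hv : v ∈ KS K T) :
    v ∈ ST L T ∧ ∀ t, ∃ k : K, v t = algebraMap K L k := by
  induction hv using Submodule.span_induction with
  | mem v hv =>
    obtain ⟨t, ht, rfl⟩ := hv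
    refine ⟨bv_mem ht, fun t' => ⟨if t = t' then 1 else 0, ?_⟩⟩
    rw [Finsupp.single_apply]; split_ifs <;> simp
  | zero => exact ⟨zero_mem _, fun t => ⟨0, by simp⟩⟩
  | add u v _ _ hu hv =>
    refine ⟨add_mem hu.1 hv.1, fun t => ?_⟩
    obtain ⟨a, ha⟩ := hu.2 t
    obtain ⟨b, hb⟩ := hv.2 t
    exact ⟨a + b, by rw [Finsupp.add_apply, ha, hb, map_add]⟩
  | smul c v _ hv =>
    refine ⟨?_, fun t => ?_⟩
    · rw [← algebraMap_smul L]; exact Submodule.smul_mem _ _ hv.1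
    · obtain ⟨a, ha⟩ := hv.2 t
      exact ⟨c * a, by rw [Finsupp.smul_apply, ha, Algebra.smul_def, map_mul]⟩

theorem kap_K (a b : Fin l × ℤ) : ∃ k : K, kap κ K L (.inl a) (.inl b) = algebraMap K L k := by
  unfold kap
  split_ifs
  · exact ⟨0, by simp⟩
  · exact ⟨1 / (vK K b - vK K a), by simp [vL]⟩
  · exact ⟨vK K b - vK K a - xx K, by rw [map_sub, map_sub, xx_tower]; rfl⟩
  · exact ⟨1, by simp⟩

theorem dd_K (a b : Fin l × ℤ) : ∃ k : K, dd κ K L (.inl a) (.inl b) = algebraMap K L k := by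
  unfold dd
  split_ifs
  · exact ⟨1 / (vK K b - vK K a), by simp [vL]⟩
  · exact ⟨0, by simp⟩

theorem KS_gen (b : Bool) {S : Set (ℕ → Lab I l)} (hS : ∀ s ∈ S, Std n s)
    (hsw : ∀ s ∈ S, ∀ r, r + 1 < n → Std n (sw r s) → sw r s ∈ S) {g : G I}
    (hg : g ∈ gensB I b n) {s : ℕ → Lab I l} (hs : s ∈ S) :
    DW n κ K L g (bv (F0 b n s)) ∈ KS K (F0 b n '' S) := by
  have hm : ∀ s ∈ S, (bv (F0 b n s) : VV I l L) ∈ KS K (F0 b n '' S) := fun s hs =>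
    Submodule.subset_span ⟨_, ⟨s, hs, rfl⟩, rfl⟩
  have hE : ∀ i, DW n κ K L (.E i) (bv (F0 b n s)) ∈ KS K (F0 b n '' S) := by
    intro i
    rw [DW_E (F0_mem b (hS s hs))]
    split_ifs
    · exact hm s hs
    · exact zero_mem _
  have hY : ∀ r q, r ≤ n → q < n → F0 b n s r = s q →
      DW n κ K L (.Y r) (bv (F0 b n s)) ∈ KS K (F0 b n '' S) := by
    intro r q hr hq e
    obtain ⟨c, hc⟩ := (hS s hs).inl hq
    rw [DW_Y (F0_mem b (hS s hs)) hr, e, hc, vL, algebraMap_smul]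
    exact Submodule.smul_mem _ _ (hm s hs)
  have hP : ∀ r q, r < n → q + 1 < n → F0 b n s r = s q → F0 b n s (r + 1) = s (q + 1) →
      sw r (F0 b n s) = F0 b n (sw q s) →
      DW n κ K L (.P r) (bv (F0 b n s)) ∈ KS K (F0 b n '' S) := by
    intro r q hr hq e1 e2 e3
    obtain ⟨c, hc⟩ := (hS s hs).inl (by omega : q < n)
    obtain ⟨c', hc'⟩ := (hS s hs).inl hq
    obtain ⟨k, hk⟩ := kap_K (κ := κ) (K := K) (L := L) c c'
    obtain ⟨k', hk'⟩ := dd_K (κ := κ) (K := K) (L := L) c c'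
    rw [DW_P (F0_mem b (hS s hs)) hr, e1, e2, e3]
    refine add_mem ?_ ?_
    · by_cases h : Std n (sw q s)
      · rw [hc, hc', hk, algebraMap_smul]
        exact Submodule.smul_mem _ _ (hm _ (hsw s hs q hq h))
      · rw [kap_linked κ K L (adm_Std n s (hS s hs) q hq h), zero_smul]
        exact zero_mem _
    · rw [hc, hc', hk', algebraMap_smul]
      exact Submodule.smul_mem _ _ (hm s hs)
  cases b
  · rcases hg with ⟨i, rfl⟩ | ⟨r, h1, h2, rfl⟩ | ⟨r, h1, h2, rfl⟩
    · exact hE i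
    · exact hY r (r - 1) h2 (by omega) (mv_gt h1 h2)
    · refine hP r (r - 1) h2 (by omega) (mv_gt h1 h2.le) ?_ (sw_mv_gt h1 h2)
      rw [Nat.sub_add_cancel h1]
      exact mv_gt (by simp [pos]) h2
  · have hF : ∀ s : ℕ → Lab I l, F0 true n s = s := fun s => mv_self
    rcases hg with ⟨i, rfl⟩ | ⟨r, h1, rfl⟩ | ⟨r, h1, rfl⟩
    · exact hE i
    · exact hY r r h1.le h1 (by rw [hF])
    · exact hP r r (by omega) h1 (by rw [hF]) (by rw [hF]) (by rw [hF, hF])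

theorem KS_ev (b : Bool) {S : Set (ℕ → Lab I l)} (hS : ∀ s ∈ S, Std n s)
    (hsw : ∀ s ∈ S, ∀ r, r + 1 < n → Std n (sw r s) → sw r s ∈ S) {u : FF I}
    (hu : u ∈ FA (gensB I b n)) {v : VV I l L} (hv : v ∈ KS K (F0 b n '' S)) :
    ev (DW n κ K L) u v ∈ KS K (F0 b n '' S) := by
  induction hu using Algebra.adjoin_induction generalizing v with
  | mem z hz =>
    obtain ⟨g, hg, rfl⟩ := hz
    simp only [ev, gen, FreeAlgebra.lift_ι_apply]
    induction hv using Submodule.span_induction with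
    | mem v hv => obtain ⟨_, ⟨s, hs, rfl⟩, rfl⟩ := hv; exact KS_gen b hS hsw hg hs
    | zero => rw [map_zero]; exact zero_mem _
    | add a b _ _ ha hb => rw [map_add]; exact add_mem ha hb
    | smul c a _ ha => rw [LinearMap.map_smul_of_tower]; exact Submodule.smul_mem _ _ ha
  | algebraMap r =>
    rw [AlgHom.commutes, Module.algebraMap_end_apply, ← algebraMap_smul K]
    exact Submodule.smul_mem _ _ hv
  | add a b _ _ ha hb => rw [map_add, LinearMap.add_apply]; exact add_mem (ha hv) (hb hv)
  | mul a b _ _ ha hb => rw [map_mul, Module.End.mul_apply]; exact ha (hb hv)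

end chains

section tower

variable {I : Type} [CommRing I] {l n : ℕ} {κ : Fin l → I}

theorem kill_mod_tower [Nontrivial I] (K L : Type) [Field K] [Field L] [Algebra O K] [Algebra K L]
    [Algebra O L] [IsScalarTower O K L] [Setup K L]
    {V : Type} [AddCommGroup V] [Module L V] [Module K V] [Module O V] [IsScalarTower K L V]
    [IsScalarTower O K V] [IsScalarTower O L V] {D : G I → Module.End L V} (hn : 0 < n)
    (hD : IsKLR n D) (hD0 : ∀ g ∉ gens I n, D g = 0)
    {j : ℕ → I} {v : V} (hv : D (.E j) v = v) {N : Submodule K V}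
    (hN : ∀ g ∈ gens I n, ∀ x ∈ N, D g x ∈ N)
    (hC : ∀ u ∈ FA (gens I n), ∀ i, D (.E i) (cycPoly κ (i 0) (D (.Y 0)) (ev D u v)) ∈ N)
    {z : FF I} (hz : z ∈ FA (gens I n))
    (hkill : ∀ t : ℕ → Lab I l, Std n t → resid κ ∘ t = j → ev (raw κ K L) z (bv t) = 0) :
    ev D z v ∈ N := by
  have hev : ∀ z v, ev (fun g => resEnd K L V (D g)) z v = ev D z v := fun z v => by
    rw [ev_comp]; rfl
  rw [← hev]
  refine kill_mod L hn (hD.map (resEnd K L V)) (fun g hg => ?_) hv hN (fun u hu i => ?_) hz hkill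
  · rw [hD0 g hg, map_zero]
  · rw [hev, ← map_cycPoly]
    exact hC u hu i

end tower

section induct

variable {I : Type} [CommRing I] {l n : ℕ} {κ : Fin l → I}
variable {K L : Type} [Field K] [Field L] [Algebra O K] [Algebra K L] [Algebra O L]
  [IsScalarTower O K L] [Setup K L]

/-- The cyclotomic relation as an element of the free algebra. -/
def cyc (κ : Fin l → I) (i : ℕ → I) : FF I := gen (.E i) * cycPoly κ (i 0) (gen (.Y 0))

theorem ev_cyc {A : Type*} [Ring A] [Algebra O A] (D : G I → A) (i : ℕ → I) :
    ev D (cyc κ i) = D (.E i) * cycPoly κ (i 0) (D (.Y 0)) := by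
  rw [cyc, map_mul, map_cycPoly]; simp only [ev, gen, FreeAlgebra.lift_ι_apply]

theorem ev_cyc_bv {t : ℕ → Lab I l} (ht : t ∈ TW I l n) (i : ℕ → I) :
    ev (DW n κ K L) (cyc κ i) (bv t) =
      if resid κ ∘ t = i then cycPoly κ (i 0) (vL K L (t 0)) • bv t else 0 := by
  rw [ev_cyc, Module.End.mul_apply,
    cycPoly_eigen (V := VV I l L) (DW_Y (κ := κ) (K := K) (L := L) ht (Nat.zero_le n)),
    map_smul, DW_E ht]
  split_ifs <;> simp

theorem ev_cyc_Low {v : VV I l L} (hv : v ∈ Low I l L true n n) (i : ℕ → I) :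
    ev (DW n κ K L) (cyc κ i) v = 0 := by
  have : Low I l L true n n ≤ LinearMap.ker (ev (DW n κ K L) (cyc κ i)) := by
    refine Submodule.span_le.2 ?_
    rintro _ ⟨_, ⟨⟨p, hp, s, hs, rfl⟩, j, hj, hT⟩, rfl⟩
    show ev (DW n κ K L) (cyc κ i) (bv (mv n p s)) = 0
    have hp0 : 0 < p := by
      have := Tp_disjoint hp (mv_mem_Tp hs hp) hT
      simp only [pos, if_true] at this; omega
    rw [ev_cyc_bv ⟨p, hp, s, hs, rfl⟩]
    split_ifs with h
    · obtain ⟨c, hc⟩ := hs.1.zero (hp0.trans_le hp)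
      rw [mv_lt hp0, hc, cycPoly_vL, zero_smul]
      rw [← h, Function.comp_apply, mv_lt hp0, hc]; simp [resid]
    · rfl
  exact this hv

variable (n κ K L) in
/-- The coefficient with which the cyclotomic relation returns the free strand. -/
def al (s : ℕ → Lab I l) : L :=
  cycPoly κ (resid κ (s n)) (Setup.τ K : L) * lead n κ K L true n s

theorem ev_cyc_XX {s : ℕ → Lab I l} (hs : Std n s) {a : ℕ} (ha : a ≤ n) (i : ℕ → I) :
    ev (DW n κ K L) (cyc κ i) (XX n κ K L true a (bv (F0 true n s))) =
      if a = n ∧ resid κ ∘ F0 false n s = i then al n κ K L s • bv (F0 false n s) else 0 := by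
  have h1 := chain_bv (κ := κ) (K := K) (L := L) true ha hs
  have h2 := ev_cyc_Low (κ := κ) (K := K) (Low_mono ha h1) i
  rw [map_sub, sub_eq_zero] at h2
  refine h2.trans ?_
  rw [map_smul]
  rcases ha.lt_or_eq with h | rfl
  · rw [if_neg (by omega), ev_cyc_Low (Low_mono (show a + 1 ≤ n by omega) ?_), smul_zero]
    exact Submodule.subset_span ⟨_, ⟨mv_mem_TW hs (pos_le true ha), a, by omega,
      mv_mem_Tp hs (pos_le true ha)⟩, rfl⟩
  · have e : pos true a a = pos false a 0 := by simp [pos]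
    rw [e, ev_cyc_bv (F0_mem false hs)]
    simp only [true_and]
    split_ifs with h
    · have e2 : F0 false a s 0 = s a := by show mv a (pos false a 0) s 0 = s a; simp [pos]
      rw [← h, Function.comp_apply, e2, hs.τ, smul_smul, al, mul_comm]
    · rw [smul_zero]

theorem lead_true_sw {s : ℕ → Lab I l} {r : ℕ} (hr : r + 1 < n) :
    lead n κ K L true n (sw r s) = lead n κ K L true n s := by
  have h : ∀ s : ℕ → Lab I l, lead n κ K L true n s =
      ∏ j ∈ Finset.range n, kap κ K L (s j) (s n) := fun s => by
    simp only [lead, if_true]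
    exact Finset.prod_range_reflect (fun j => kap κ K L (s j) (s n)) n
  rw [h, h, sw_ne r s n (by omega) (by omega)]
  refine Finset.prod_equiv (Equiv.swap r (r + 1)) (fun j => ?_) (fun j _ => rfl)
  simp only [Finset.mem_range, Equiv.swap_apply_def]
  split_ifs <;> omega

theorem al_sw {s : ℕ → Lab I l} {r : ℕ} (hr : r + 1 < n) :
    al n κ K L (sw r s) = al n κ K L s := by
  rw [al, al, lead_true_sw hr, sw_ne r s n (by omega) (by omega)]

/-- The `K[τ]`-span of the starting vectors. -/
def KT (K : Type) (I : Type) (l : ℕ) (L : Type) [Field K] [Field L] [Algebra O K] [Algebra K L]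
    [Algebra O L] [Setup K L] (b : Bool) (n : ℕ) : Submodule K (VV I l L) :=
  Submodule.span K {v | ∃ (m : ℕ) (s : ℕ → Lab I l), Std n s ∧
    v = (Setup.τ K : L) ^ m • bv (F0 b n s)}

theorem KS_KT {b : Bool} {v : VV I l L} (hv : v ∈ KS K (F0 b n '' {s | Std n s})) (m : ℕ) :
    (Setup.τ K : L) ^ m • v ∈ KT K I l L b n := by
  induction hv using Submodule.span_induction with
  | mem v hv => obtain ⟨_, ⟨s, hs, rfl⟩, rfl⟩ := hv; exact Submodule.subset_span ⟨m, s, hs, rfl⟩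
  | zero => rw [smul_zero]; exact zero_mem _
  | add a b _ _ ha hb => rw [smul_add]; exact add_mem ha hb
  | smul c a _ ha => rw [smul_comm]; exact Submodule.smul_mem _ _ ha

theorem KT_smul {b : Bool} {v : VV I l L} (hv : v ∈ KT K I l L b n) (m : ℕ) :
    (Setup.τ K : L) ^ m • v ∈ KT K I l L b n := by
  induction hv using Submodule.span_induction with
  | mem v hv =>
    obtain ⟨m', s, hs, rfl⟩ := hv
    exact Submodule.subset_span ⟨m + m', s, hs, by rw [smul_smul, pow_add]⟩
  | zero => rw [smul_zero]; exact zero_mem _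
  | add a b _ _ ha hb => rw [smul_add]; exact add_mem ha hb
  | smul c a _ ha => rw [smul_comm]; exact Submodule.smul_mem _ _ ha

theorem mem_KT {b : Bool} {v : VV I l L} (hv : v ∈ KT K I l L b n) :
    v ∈ ST L (F0 b n '' {s | Std n s}) ∧
      ∀ t, ∃ p : Polynomial K, v t = Polynomial.aeval (Setup.τ K : L) p := by
  induction hv using Submodule.span_induction with
  | mem v hv =>
    obtain ⟨m, s, hs, rfl⟩ := hv
    refine ⟨Submodule.smul_mem _ _ (bv_mem ⟨s, hs, rfl⟩), fun t' =>
      ⟨if F0 b n s = t' then Polynomial.X ^ m else 0, ?_⟩⟩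
    rw [Finsupp.smul_apply, Finsupp.single_apply]; split_ifs <;> simp
  | zero => exact ⟨zero_mem _, fun t => ⟨0, by simp⟩⟩
  | add u v _ _ hu hv =>
    refine ⟨add_mem hu.1 hv.1, fun t => ?_⟩
    obtain ⟨a, ha⟩ := hu.2 t
    obtain ⟨b, hb⟩ := hv.2 t
    exact ⟨a + b, by rw [Finsupp.add_apply, ha, hb, map_add]⟩
  | smul c v _ hv =>
    refine ⟨?_, fun t => ?_⟩
    · rw [← algebraMap_smul L]; exact Submodule.smul_mem _ _ hv.1
    · obtain ⟨a, ha⟩ := hv.2 t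
      exact ⟨c • a, by rw [Finsupp.smul_apply, ha, map_smul]⟩

variable (n κ K L) in
/-- The `K[τ]`-span of the chains of crossings. -/
def Lat : Submodule K (VV I l L) where
  carrier := {w | ∃ h : ℕ → VV I l L, (∀ a, h a ∈ KT K I l L false n) ∧
    w = ∑ a ∈ Finset.range (n + 1), XX n κ K L false a (h a)}
  zero_mem' := ⟨0, fun _ => zero_mem _, by simp⟩
  add_mem' := by
    rintro _ _ ⟨h, hh, rfl⟩ ⟨h', hh', rfl⟩
    exact ⟨h + h', fun a => add_mem (hh a) (hh' a), by
      simp only [Pi.add_apply, map_add, Finset.sum_add_distrib]⟩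
  smul_mem' := by
    rintro c _ ⟨h, hh, rfl⟩
    refine ⟨c • h, fun a => Submodule.smul_mem _ _ (hh a), ?_⟩
    simp only [Pi.smul_apply, LinearMap.map_smul_of_tower, Finset.smul_sum]

theorem Lat_smul {w : VV I l L} (hw : w ∈ Lat n κ K L) (m : ℕ) :
    (Setup.τ K : L) ^ m • w ∈ Lat n κ K L := by
  obtain ⟨h, hh, rfl⟩ := hw
  refine ⟨fun a => (Setup.τ K : L) ^ m • h a, fun a => KT_smul (hh a) m, ?_⟩
  simp only [map_smul, Finset.smul_sum]

theorem ev_bv (b : Bool) [Nontrivial I] {s : ℕ → Lab I l} (hs : Std n s) {u : FF I} {N : ℕ}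
    {c : ℕ → ℕ → FF I} {i : ℕ → I} (hi : resid κ ∘ F0 b n s = i)
    (hu : ev (DW n κ K L) u * DW n κ K L (.E i) = normalForm b n (DW n κ K L) i N c) :
    ev (DW n κ K L) u (bv (F0 b n s)) =
      ∑ a ∈ Finset.range (n + 1), XX n κ K L b a (∑ m ∈ Finset.range N,
        (Setup.τ K : L) ^ m • ev (DW n κ K L) (c a m) (bv (F0 b n s))) := by
  subst hi
  rw [← normalForm_bv b hs, ← hu, Module.End.mul_apply, DW_E (F0_mem b hs), if_pos rfl]

theorem ev_mem_Lat [Nontrivial I] {s : ℕ → Lab I l} (hs : Std n s) {u : FF I}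
    (hu : u ∈ FA (gens I (n + 1))) :
    ev (DW n κ K L) u (bv (F0 false n s)) ∈ Lat n κ K L := by
  obtain ⟨N, c, hc, h⟩ := exists_normalForm false n (resid κ ∘ F0 false n s) hu
  rw [ev_bv false hs rfl (h (Module.End L (VV I l L)) _ isKLR_DW)]
  refine ⟨_, fun a => sum_mem fun m _ => KS_KT ?_ m, rfl⟩
  exact KS_ev false (fun s hs => hs) (fun s _ r _ h => h) (hc a m)
    (Submodule.subset_span ⟨_, ⟨s, hs, rfl⟩, rfl⟩)

theorem gen_mem_FA {S : Set (G I)} {g : G I} (hg : g ∈ S) : gen g ∈ FA S :=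
  Algebra.subset_adjoin ⟨g, hg, rfl⟩

theorem chi_mem {A : Type*} [Ring A] [Algebra O A] {S : Subalgebra O A} {χ : ℕ → A} {a : ℕ}
    (h : ∀ j < a, χ j ∈ S) : chi χ a ∈ S := by
  induction a with
  | zero => exact one_mem _
  | succ a ih => exact mul_mem (h a (by omega)) (ih fun j hj => h j (by omega))

theorem chi_gen_mem (b : Bool) {a : ℕ} (ha : a ≤ n) :
    chi (fun j => gen (I := I) (.P (cr b n j))) a ∈ FA (gens I (n + 1)) :=
  chi_mem fun j hj => gen_mem_FA (mem_gens_P (by cases b <;> simp [cr] <;> omega))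

theorem ev_chi {A : Type*} [Ring A] [Algebra O A] (D : G I → A) (b : Bool) (a : ℕ) :
    ev D (chi (fun j => gen (.P (cr b n j))) a) = chi (fun j => D (.P (cr b n j))) a := by
  rw [map_chi]; simp only [ev, gen, FreeAlgebra.lift_ι_apply]

theorem Lat_gen [Nontrivial I] {g : G I} (hg : g ∈ gens I (n + 1)) {w : VV I l L}
    (hw : w ∈ Lat n κ K L) : DW n κ K L g w ∈ Lat n κ K L := by
  obtain ⟨h, hh, rfl⟩ := hw
  rw [map_sum]
  refine sum_mem fun a ha => ?_
  rw [Finset.mem_range] at ha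
  have hv := hh a
  generalize h a = v at hv
  induction hv using Submodule.span_induction with
  | mem v hv =>
    obtain ⟨m, s, hs, rfl⟩ := hv
    rw [map_smul, map_smul]
    refine Lat_smul ?_ m
    have := ev_mem_Lat (κ := κ) (K := K) (L := L) hs
      (mul_mem (gen_mem_FA hg) (chi_gen_mem false (by omega : a ≤ n)))
    rw [map_mul, ev_chi, Module.End.mul_apply] at this
    simpa only [ev, gen, FreeAlgebra.lift_ι_apply] using this
  | zero => rw [map_zero, map_zero]; exact zero_mem _
  | add u v _ _ hu hv => rw [map_add, map_add]; exact add_mem hu hv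
  | smul c v _ hv =>
    rw [LinearMap.map_smul_of_tower, LinearMap.map_smul_of_tower]
    exact Submodule.smul_mem _ _ hv

theorem Lat_bv {s : ℕ → Lab I l} (hs : Std n s) : bv (F0 false n s) ∈ Lat n κ K L := by
  refine ⟨fun a => if a = 0 then bv (F0 false n s) else 0, fun a => ?_, ?_⟩
  · dsimp only
    split_ifs
    · exact Submodule.subset_span ⟨0, s, hs, by simp⟩
    · exact zero_mem _
  · rw [Finset.sum_eq_single 0]
    · simp [chi]
    · intro a _ ha; simp [ha]
    · simp

/-- Elements killing the standard vectors map into a multiple of the lattice. -/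
theorem kill_Lat [Nontrivial I] {z : FF I} (hz : z ∈ FA (gens I (n + 1))) {s : ℕ → Lab I l}
    (hs : Std n s)
    (hkill : ∀ t : ℕ → Lab I l, Std (n + 1) t → resid κ ∘ t = resid κ ∘ s →
      ev (raw κ K L) z (bv t) = 0) :
    ∃ w ∈ Lat n κ K L, ev (DW n κ K L) z (bv s) = al n κ K L s • w := by
  set N : Submodule K (VV I l L) := (Lat n κ K L).map
    ((LinearMap.lsmul L (VV I l L) (al n κ K L s)).restrictScalars K) with hNdef
  have hmem : ∀ w, al n κ K L s • w ∈ N ↔ ∃ w' ∈ Lat n κ K L,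
      al n κ K L s • w' = al n κ K L s • w := fun w => Iff.rfl
  suffices ev (DW n κ K L) z (bv s) ∈ N by
    obtain ⟨w, hw, h⟩ := this
    exact ⟨w, hw, h.symm⟩
  refine kill_mod_tower K L (Nat.succ_pos n) isKLR_DW (fun g hg => by simp [DT, hg])
    (j := resid κ ∘ s) (by rw [DW_E hs.mem_TW, if_pos rfl]) ?_ ?_ hz hkill
  · rintro g hg _ ⟨w, hw, rfl⟩
    refine ⟨DW n κ K L g w, Lat_gen hg hw, ?_⟩
    simp
  · intro u hu i
    obtain ⟨M, c, hc, h⟩ := exists_normalForm true n (resid κ ∘ F0 true n s) hu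
    have hF : F0 true n s = s := mv_self
    have h1 := ev_bv (κ := κ) (K := K) (L := L) true hs rfl (h (Module.End L (VV I l L)) _ isKLR_DW)
    rw [hF] at h1
    rw [← Module.End.mul_apply, ← ev_cyc, h1, map_sum]
    refine sum_mem fun a ha => ?_
    rw [map_sum, map_sum]
    refine sum_mem fun m _ => ?_
    rw [map_smul, map_smul]
    have hk := KS_ev (κ := κ) (K := K) (L := L) true
      (S := {s' | Std n s' ∧ al n κ K L s' = al n κ K L s}) (fun s hs => hs.1)
      (fun s hs r hr h => ⟨h, (al_sw hr).trans hs.2⟩) (hc a m)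
      (v := bv s) (Submodule.subset_span ⟨_, ⟨s, ⟨hs, rfl⟩, rfl⟩, by rw [hF]⟩)
    generalize ev (DW n κ K L) (c a m) (bv s) = v at hk
    induction hk using Submodule.span_induction with
    | mem v hv =>
      obtain ⟨_, ⟨s', ⟨hs', hal⟩, rfl⟩, rfl⟩ := hv
      rw [ev_cyc_XX hs' (by rw [Finset.mem_range] at ha; omega)]
      split_ifs
      · rw [hal, smul_comm]
        exact ⟨_, Lat_smul (Lat_bv hs') m, rfl⟩
      · rw [smul_zero]; exact zero_mem _
    | zero => rw [map_zero, map_zero, smul_zero]; exact zero_mem _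
    | add u v _ _ hu hv => rw [map_add, map_add, smul_add]; exact add_mem hu hv
    | smul c v _ hv =>
      rw [LinearMap.map_smul_of_tower, LinearMap.map_smul_of_tower, smul_comm]
      exact Submodule.smul_mem _ _ hv

end induct

section poly

open Polynomial

variable {I : Type} [CommRing I] {l : ℕ} {κ : Fin l → I}

/-- The quadratic factors carried by a strand of residue `i` passing one of residue `k`. -/
def bet {R : Type} [Ring R] [Algebra O R] (k i : I) (y : R) : R[X] :=
  if k = i then 1 else
    (if k = i + 1 then X - C (y + xx R) else 1) * (if i = k + 1 then X - C (y - xx R) else 1)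

/-- The polynomial annihilating the obstruction to reaching the first position. -/
def pol {R : Type} [Ring R] [Algebra O R] (κ : Fin l → I) (k : I) (j : ℕ → I) (y : ℕ → R) :
    ℕ → R[X]
  | 0 => cycPoly κ k X
  | r + 1 => pol κ k j y r * bet k (j r) (y r)

theorem monic_bet (k i : I) : ∃ d : ℕ, ∀ (R : Type) [Ring R] [Algebra O R] [Nontrivial R] (y : R),
    (bet k i y).Monic ∧ (bet k i y).natDegree = d := by
  unfold bet
  split_ifs
  · exact ⟨0, fun R _ _ _ y => ⟨monic_one, natDegree_one⟩⟩
  · exact ⟨2, fun R _ _ _ y => ⟨(monic_X_sub_C _).mul (monic_X_sub_C _), by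
      rw [(monic_X_sub_C _).natDegree_mul (monic_X_sub_C _), natDegree_X_sub_C,
        natDegree_X_sub_C]⟩⟩
  · exact ⟨1, fun R _ _ _ y => ⟨by rw [mul_one]; exact monic_X_sub_C _, by
      rw [mul_one, natDegree_X_sub_C]⟩⟩
  · exact ⟨1, fun R _ _ _ y => ⟨by rw [one_mul]; exact monic_X_sub_C _, by
      rw [one_mul, natDegree_X_sub_C]⟩⟩
  · exact ⟨0, fun R _ _ _ y => ⟨by rw [one_mul]; exact monic_one, by rw [one_mul, natDegree_one]⟩⟩

theorem monic_cycPoly (κ : Fin l → I) (k : I) :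
    ∃ d : ℕ, ∀ (R : Type) [Ring R] [Algebra O R] [Nontrivial R],
      (cycPoly κ k (X : R[X])).Monic ∧ (cycPoly κ k (X : R[X])).natDegree = d := by
  unfold cycPoly
  induction List.finRange l with
  | nil => exact ⟨0, fun R _ _ _ => by simp⟩
  | cons c t ih =>
    obtain ⟨d, hd⟩ := ih
    simp only [List.map_cons, List.prod_cons]
    split_ifs
    · refine ⟨1 + d, fun R _ _ _ => ?_⟩
      rw [Polynomial.algebraMap_apply]
      refine ⟨(monic_X_sub_C _).mul (hd R).1, ?_⟩
      rw [(monic_X_sub_C _).natDegree_mul (hd R).1, natDegree_X_sub_C, (hd R).2]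
    · exact ⟨d, fun R _ _ _ => by simpa only [one_mul] using hd R⟩

theorem monic_pol (κ : Fin l → I) (k : I) (j : ℕ → I) (r : ℕ) :
    ∃ d : ℕ, ∀ (R : Type) [Ring R] [Algebra O R] [Nontrivial R] (y : ℕ → R),
      (pol κ k j y r).Monic ∧ (pol κ k j y r).natDegree = d := by
  induction r with
  | zero =>
    obtain ⟨d, hd⟩ := monic_cycPoly κ k
    exact ⟨d, fun R _ _ _ y => hd R⟩
  | succ r ih =>
    obtain ⟨d, hd⟩ := ih
    obtain ⟨d', hd'⟩ := monic_bet k (j r)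
    refine ⟨d + d', fun R _ _ _ y => ⟨(hd R y).1.mul (hd' R (y r)).1, ?_⟩⟩
    rw [pol, (hd R y).1.natDegree_mul (hd' R (y r)).1, (hd R y).2, (hd' R (y r)).2]

/-- Right division by a monic polynomial over a noncommutative ring. -/
theorem right_division {R : Type} [Ring R] [Nontrivial R] {P : R[X]} (hP : P.Monic) (c : R[X]) :
    ∃ Q S : R[X], c = Q * P + S ∧ S.degree < P.degree := by
  induction hd : c.natDegree using Nat.strong_induction_on generalizing c with
  | _ d ih =>
    by_cases h : c.degree < P.degree
    · exact ⟨0, c, by simp, h⟩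
    · rw [not_lt] at h
      have hc : c ≠ 0 := by
        rintro rfl
        rw [degree_zero, le_bot_iff, degree_eq_bot] at h
        exact hP.ne_zero h
      have hnd : P.natDegree ≤ d := hd ▸ natDegree_le_natDegree h
      set M : R[X] := C c.leadingCoeff * X ^ (d - P.natDegree) with hM
      have hlc : c.leadingCoeff ≠ 0 := leadingCoeff_ne_zero.2 hc
      have hMP : (M * P).natDegree = d := by
        rw [natDegree_mul' (by rw [hP.leadingCoeff, mul_one, hM, leadingCoeff_C_mul_X_pow]; exact hlc),
          hM, natDegree_C_mul_X_pow _ _ hlc]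
        omega
      have hlt : (c - M * P).degree < c.degree := by
        refine degree_sub_lt_left ?_ hc ?_
        · rw [degree_eq_natDegree hc, degree_eq_natDegree, hMP, hd]
          intro h0
          have : M * P ≠ 0 := by
            intro h0
            have := (hP.mul_left_eq_zero_iff).1 h0
            rw [hM, C_mul_X_pow_eq_monomial] at this
            simp [hc] at this
          exact this h0
        · rw [leadingCoeff_mul_monic hP, hM, leadingCoeff_C_mul_X_pow]
      by_cases h0 : c - M * P = 0
      · exact ⟨M, 0, by rw [add_zero]; exact sub_eq_zero.1 h0, by
          rw [degree_zero]; exact bot_lt_iff_ne_bot.2 (fun h => hP.ne_zero (degree_eq_bot.1 h))⟩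
      · obtain ⟨Q, S, h1, h2⟩ := ih _ (hd ▸ natDegree_lt_natDegree h0 hlt) (c - M * P) rfl
        refine ⟨Q + M, S, ?_, h2⟩
        rw [add_mul, add_right_comm, ← h1, sub_add_cancel]

/-- The action of polynomials in the free strand. -/
def Phi {L V : Type} [Field L] [Algebra O L] [AddCommGroup V] [Module L V] [Module O V]
    [IsScalarTower O L V] {R : Type} [Ring R] [Algebra O R] (f : R →ₐ[O] Module.End L V) (τ : L) :
    R[X] →ₐ[O] Module.End L V :=
  { Polynomial.eval₂RingHom' f.toRingHom (algebraMap L _ τ)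
      fun _ => Algebra.commute_algebraMap_right _ _ with
    commutes' := fun r => by
      simp [Polynomial.algebraMap_apply, eval₂RingHom'] }

section

variable {L V : Type} [Field L] [Algebra O L] [AddCommGroup V] [Module L V] [Module O V]
    [IsScalarTower O L V] {R : Type} [Ring R] [Algebra O R] (f : R →ₐ[O] Module.End L V) (τ : L)

theorem Phi_X (v : V) : Phi f τ X v = τ • v := by
  simp [Phi]

theorem Phi_C (r : R) : Phi f τ (C r) = f r := by
  simp [Phi]

theorem Phi_sum {p : R[X]} {N : ℕ} (hN : p.degree < N) (v : V) :
    Phi f τ p v = ∑ m ∈ Finset.range N, τ ^ m • f (p.coeff m) v := by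
  have hp : p = ∑ m ∈ Finset.range N, monomial m (p.coeff m) := by
    ext q
    simp only [finsetSum_coeff, coeff_monomial]
    rw [Finset.sum_ite_eq']
    split_ifs with h
    · rfl
    · exact coeff_eq_zero_of_degree_lt (hN.trans_le (by
        rw [Finset.mem_range, not_lt] at h; exact_mod_cast h))
  conv_lhs => rw [hp]
  rw [map_sum, LinearMap.sum_apply]
  refine Finset.sum_congr rfl fun m hm => ?_
  clear hm
  rw [← C_mul_X_pow_eq_monomial, map_mul, map_pow, Phi_C, Module.End.mul_apply, ← map_smul]
  congr 1
  induction m with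
  | zero => simp
  | succ m ih => rw [pow_succ', pow_succ', Module.End.mul_apply, ih, Phi_X, smul_smul]

end

end poly

section scalars

open Polynomial

variable {I : Type} [CommRing I] {l : ℕ} {κ : Fin l → I}
variable {L V : Type} [Field L] [Algebra O L] [AddCommGroup V] [Module L V] [Module O V]
    [IsScalarTower O L V] {R : Type} [Ring R] [Algebra O R] {f : R →ₐ[O] Module.End L V} {τ : L}

theorem algebraMap_End_apply (a : O) (v : V) :
    algebraMap O (Module.End L V) a v = algebraMap O L a • v := by
  rw [Module.algebraMap_end_apply, algebraMap_smul]

theorem Phi_bet {y : R} {a : L} {v : V} (h : f y v = a • v) (k i : I) :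
    Phi f τ (bet k i y) v = (bet k i a).eval τ • v := by
  have hx : ∀ v, f (xx R) v = xx L • v := fun v => by rw [map_xx, xx, algebraMap_End_apply]; rfl
  have h1 : ∀ (z : R) (b : L), f z v = b • v →
      Phi f τ (X - C z) v = (X - C b : L[X]).eval τ • v := fun z b hz => by
    rw [map_sub, LinearMap.sub_apply, Phi_X, Phi_C, hz, eval_sub, eval_X, eval_C, sub_smul]
  have h2 := h1 (y + xx R) (a + xx L) (by rw [map_add, LinearMap.add_apply, h, hx, add_smul])
  have h3 := h1 (y - xx R) (a - xx L) (by rw [map_sub, LinearMap.sub_apply, h, hx, sub_smul])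
  unfold bet
  split_ifs
  · simp
  · rw [map_mul, Module.End.mul_apply, h3, map_smul, h2, eval_mul, smul_smul, mul_comm]
  · rw [mul_one, mul_one, h2]
  · rw [one_mul, one_mul, h3]
  · simp

theorem eval_cycPoly (k : I) (a : L) : (cycPoly κ k (X : L[X])).eval a = cycPoly κ k a := by
  have := map_cycPoly (κ := κ) ((aeval a : L[X] →ₐ[L] L).restrictScalars O) k X
  simpa [aeval_def] using this

theorem Phi_pol {y : ℕ → R} {a : ℕ → L} {v : V} {r : ℕ} (h : ∀ q < r, f (y q) v = a q • v)
    (k : I) (j : ℕ → I) :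
    Phi f τ (pol κ k j y r) v = (pol κ k j a r).eval τ • v := by
  induction r with
  | zero =>
    rw [pol, pol, map_cycPoly, cycPoly_eigen (Phi_X f τ v)]
    congr 1
    exact (eval_cycPoly k τ).symm
  | succ r ih =>
    rw [pol, pol, map_mul, Module.End.mul_apply, Phi_bet (h r (Nat.lt_succ_self r)), map_smul,
      ih fun q hq => h q (by omega), smul_smul, eval_mul, mul_comm]

theorem map_pol {K : Type} [Field K] [Algebra O K] [Algebra K L] [IsScalarTower O K L]
    (y : ℕ → K) (k : I) (j : ℕ → I) (r : ℕ) :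
    (pol κ k j y r).map (algebraMap K L) = pol κ k j (fun q => algebraMap K L (y q)) r := by
  induction r with
  | zero =>
    have := map_cycPoly (κ := κ) (((mapAlgHom (Algebra.ofId K L)).restrictScalars O :
      K[X] →ₐ[O] L[X])) k X
    rw [pol, pol]
    refine Eq.trans this ?_
    congr 1
    exact map_X _
  | succ r ih =>
    rw [pol, pol, Polynomial.map_mul, ih]
    congr 1
    have hx : algebraMap K L (xx K) = xx L := by
      rw [xx, xx, ← IsScalarTower.algebraMap_apply]
    unfold bet
    split_ifs <;> simp [hx]

end scalars

section induct

variable {I : Type} [CommRing I] {l n : ℕ} {κ : Fin l → I}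
variable {K L : Type} [Field K] [Field L] [Algebra O K] [Algebra K L] [Algebra O L]
  [IsScalarTower O K L] [Setup K L]

/-- One step moving the free strand to the right without denominators. -/
def stepR (j : ℕ → I) (k : I) (r : ℕ) : FF I :=
  if k = j r then (gen (.Y (r + 1)) - gen (.Y r)) *
    ((gen (.Y r) - gen (.Y (r + 1))) * gen (.P r) + 1)
  else if j r = k + 1 then - gen (.P r) else gen (.P r)

/-- Moving the free strand to the right without denominators. -/
def moveR (j : ℕ → I) (k : I) : ℕ → FF I := chi (stepR j k)

theorem stepR_mem (j : ℕ → I) (k : I) {r : ℕ} (hr : r < n) :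
    stepR j k r ∈ FA (gens I (n + 1)) := by
  have h1 : gen (G.P (I := I) r) ∈ FA (gens I (n + 1)) := gen_mem_FA (mem_gens_P (by omega))
  have h2 : gen (G.Y (I := I) r) ∈ FA (gens I (n + 1)) := gen_mem_FA (mem_gens_Y (by omega))
  have h3 : gen (G.Y (I := I) (r + 1)) ∈ FA (gens I (n + 1)) := gen_mem_FA (mem_gens_Y (by omega))
  unfold stepR
  split_ifs
  · exact mul_mem (sub_mem h3 h2) (add_mem (mul_mem (sub_mem h2 h3) h1) (one_mem _))
  · exact neg_mem h1
  · exact h1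

/-- The scalar factor of a step. -/
def gam (κ : Fin l → I) (K : Type) {L : Type} [Field K] [Field L] [Algebra O K] [Algebra K L]
    [Algebra O L] [IsScalarTower O K L] [Setup K L] (a b : Lab I l) : L :=
  if resid κ b = resid κ a then vL K L b - vL K L a else
    if resid κ a = resid κ b + 1 then vL K L b - vL K L a + xx L else 1

theorem stepR_bv {s : ℕ → Lab I l} (hs : Std n s) {r : ℕ} (hr : r < n) {j : ℕ → I}
    (hj : resid κ ∘ s = j) :
    ev (DW n κ K L) (stepR j (j n) r) (bv (mv n r s)) =
      (gam κ K (s r) (s n) : L) • bv (mv n (r + 1) s) := by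
  subst hj
  have hne : vL K L (s n) ≠ vL K L (s r) := by
    obtain ⟨c, hc⟩ := hs.inl hr
    rw [hs.τ, hc]
    exact τ_ne K L _
  have hl : ¬ linked (s n) (s r) := by
    obtain ⟨k, hk⟩ := hs.2 n le_rfl
    rw [linked_symm, hk]
    exact not_linked_inr
  have e1 : mv n r s r = s n := mv_eq
  have e2 : mv n r s (r + 1) = s r := mv_gt (by omega) (by omega)
  have e3 : mv n (r + 1) s (r + 1) = s n := mv_eq
  have e4 : mv n (r + 1) s r = s r := mv_lt (by omega)
  have hm := mv_mem_TW hs hr.le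
  have hm' := mv_mem_TW hs (Nat.succ_le_of_lt hr)
  have hg : ∀ g, ev (DW n κ K L) (gen g) = DW n κ K L g := fun g => by
    simp only [ev, gen, FreeAlgebra.lift_ι_apply]
  have hP := DW_P (κ := κ) (K := K) (L := L) hm hr
  rw [e1, e2, sw_mv_self hr] at hP
  have hY1 := DW_Y (κ := κ) (K := K) (L := L) hm hr.le
  have hY2 := DW_Y (κ := κ) (K := K) (L := L) hm (Nat.succ_le_of_lt hr)
  have hY3 := DW_Y (κ := κ) (K := K) (L := L) hm' hr.le
  have hY4 := DW_Y (κ := κ) (K := K) (L := L) hm' (Nat.succ_le_of_lt hr)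
  simp only [Nat.succ_eq_add_one] at hY1 hY2 hY3 hY4
  rw [e1] at hY1
  rw [e2] at hY2
  rw [e4] at hY3
  rw [e3] at hY4
  have hs1 := sub_ne_zero.2 hne
  have hs2 := sub_ne_zero.2 hne.symm
  unfold stepR gam
  simp only [Function.comp_apply]
  by_cases h : resid κ (s n) = resid κ (s r)
  · rw [if_pos h, if_pos h]
    have hk : kap κ K L (s n) (s r) = 1 / (vL K L (s r) - vL K L (s n)) := by
      rw [kap, if_neg hl, if_pos h]
    have hd : dd κ K L (s n) (s r) = 1 / (vL K L (s r) - vL K L (s n)) := by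
      rw [dd, if_pos h]
    rw [hk, hd] at hP
    simp only [map_mul, map_add, map_sub, map_one, hg, Module.End.mul_apply, LinearMap.add_apply,
      LinearMap.sub_apply, Module.End.one_apply, hP, map_smul, hY1, hY2, hY3, hY4]
    match_scalars <;> field_simp
    ring
  · rw [if_neg h, if_neg h]
    have hk : kap κ K L (s n) (s r) = if resid κ (s r) = resid κ (s n) + 1 then
        vL K L (s r) - vL K L (s n) - xx L else 1 := by
      rw [kap, if_neg hl, if_neg h]
    have hd : dd κ K L (s n) (s r) = 0 := by
      rw [dd, if_neg h]
    rw [hk, hd, zero_smul, add_zero] at hP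
    by_cases h' : resid κ (s r) = resid κ (s n) + 1
    · rw [if_pos h', if_pos h', map_neg, LinearMap.neg_apply, hg, hP, if_pos h', ← neg_smul]
      congr 1
      ring
    · rw [if_neg h', if_neg h', hg, hP, if_neg h']

theorem moveR_mem (j : ℕ → I) (k : I) : moveR j k n ∈ FA (gens I (n + 1)) :=
  chi_mem fun _ hr => stepR_mem j k hr

theorem moveR_bv {s : ℕ → Lab I l} (hs : Std n s) {r : ℕ} (hr : r ≤ n) {j : ℕ → I}
    (hj : resid κ ∘ s = j) :
    ev (DW n κ K L) (moveR j (j n) r) (bv (mv n 0 s)) =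
      (∏ q ∈ Finset.range r, (gam κ K (s q) (s n) : L)) • bv (mv n r s) := by
  induction r with
  | zero => simp [moveR, chi]
  | succ r ih =>
    rw [moveR, chi, map_mul, Module.End.mul_apply]
    rw [moveR] at ih
    rw [ih (by omega), map_smul, stepR_bv hs hr hj, smul_smul, Finset.prod_range_succ]

theorem kap_gam {a b : Lab I l} {c : Fin l × ℤ} {i : I} (ha : a = .inl c) (hb : b = .inr i)
    (hτ : vL K L b = Setup.τ K) :
    kap κ K L a b * gam κ K a b =
      (bet (resid κ b) (resid κ a) (vL K L a)).eval (Setup.τ K : L) := by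
  have hl : ¬ linked a b := by rw [hb]; exact not_linked_inr
  have hne : vL K L b - vL K L a ≠ 0 := by
    rw [hτ, ha]; exact sub_ne_zero.2 (τ_ne K L _)
  rw [kap, if_neg hl, gam, bet]
  by_cases h : resid κ b = resid κ a
  · rw [if_pos h.symm, if_pos h, if_pos h, Polynomial.eval_one, one_div, inv_mul_cancel₀ hne]
  · rw [if_neg (Ne.symm h), if_neg h, if_neg h, ← hτ]
    split_ifs <;> simp only [Polynomial.eval_mul, Polynomial.eval_sub, Polynomial.eval_X,
      Polynomial.eval_C, Polynomial.eval_one] <;> ring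

variable (κ K) in
/-- The polynomial of a sequence over the ground field. -/
def polS (n : ℕ) (s : ℕ → Lab I l) : Polynomial K :=
  pol κ (resid κ (s n)) (resid κ ∘ s) (fun q => Sum.elim (vK K) 0 (s q)) n

theorem al_gam {s : ℕ → Lab I l} (hs : Std n s) :
    al n κ K L s * ∏ q ∈ Finset.range n, (gam κ K (s q) (s n) : L) =
      (pol κ (resid κ (s n)) (resid κ ∘ s) (fun q => vL K L (s q)) n).eval (Setup.τ K : L) := by
  have h1 : lead n κ K L true n s = ∏ j ∈ Finset.range n, kap κ K L (s j) (s n) := by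
    simp only [lead, if_true]
    exact Finset.prod_range_reflect (fun j => kap κ K L (s j) (s n)) n
  obtain ⟨k, hk⟩ := hs.2 n le_rfl
  rw [al, h1, mul_assoc, ← Finset.prod_mul_distrib]
  have h2 : ∀ r ≤ n, cycPoly κ (resid κ (s n)) (Setup.τ K : L) *
      ∏ j ∈ Finset.range r, (kap κ K L (s j) (s n) * gam κ K (s j) (s n)) =
      (pol κ (resid κ (s n)) (resid κ ∘ s) (fun q => vL K L (s q)) r).eval (Setup.τ K : L) := by
    intro r hr
    induction r with
    | zero =>
      rw [pol, Finset.prod_range_zero, mul_one, eval_cycPoly]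
    | succ r ih =>
      obtain ⟨c, hc⟩ := hs.inl hr
      rw [pol, Finset.prod_range_succ, ← mul_assoc, ih (by omega), Polynomial.eval_mul,
        kap_gam hc hk hs.τ, Function.comp_apply]
  exact h2 n le_rfl

theorem pol_congr {R : Type} [Ring R] [Algebra O R] {y y' : ℕ → R} {r : ℕ}
    (h : ∀ q < r, y q = y' q) (k : I) (j : ℕ → I) : pol κ k j y r = pol κ k j y' r := by
  induction r with
  | zero => rfl
  | succ r ih => rw [pol, pol, h r (Nat.lt_succ_self r), ih fun q hq => h q (by omega)]

theorem aeval_polS {s : ℕ → Lab I l} (hs : Std n s) :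
    Polynomial.aeval (Setup.τ K : L) (polS κ K n s) =
      (pol κ (resid κ (s n)) (resid κ ∘ s) (fun q => vL K L (s q)) n).eval (Setup.τ K : L) := by
  rw [← Polynomial.eval_map_algebraMap, polS, map_pol]
  congr 1
  refine pol_congr (fun q hq => ?_) _ _
  obtain ⟨c, hc⟩ := hs.inl hq
  rw [hc]; rfl

end induct

section coefficients

open Polynomial

theorem degree_sum_C_mul_X_pow_lt {R : Type} [Semiring R] (c : ℕ → R) (N : ℕ) :
    (∑ m ∈ Finset.range N, C (c m) * X ^ m : R[X]).degree < N :=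
  mem_degreeLT.1 (sum_mem fun m hm => mem_degreeLT.2 ((degree_C_mul_X_pow_le _ _).trans_lt (by
    rw [Finset.mem_range] at hm; exact_mod_cast hm)))

theorem coeff_sum_C_mul_X_pow {R : Type} [Semiring R] (c : ℕ → R) {N m : ℕ} (hm : m < N) :
    (∑ m ∈ Finset.range N, C (c m) * X ^ m).coeff m = c m := by
  simp only [finsetSum_coeff, coeff_C_mul_X_pow]
  rw [Finset.sum_ite_eq, if_pos (Finset.mem_range.2 hm)]

variable {K L : Type} [Field K] [Field L] [Algebra K L] {τ : L}

theorem aeval_sum {T : Type} {N : ℕ} {u : ℕ → T →₀ L} (hu : ∀ m t, ∃ k : K, u m t = algebraMap K L k)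
    (t : T) : ∃ p : K[X], (∑ m ∈ Finset.range N, τ ^ m • u m) t = aeval τ p ∧ p.degree < N := by
  choose k hk using fun m => hu m t
  refine ⟨∑ m ∈ Finset.range N, C (k m) * X ^ m, ?_, degree_sum_C_mul_X_pow_lt k N⟩
  rw [Finsupp.finsetSum_apply, map_sum]
  refine Finset.sum_congr rfl fun m _ => ?_
  rw [Finsupp.smul_apply, hk, map_mul, aeval_C, map_pow, aeval_X, smul_eq_mul, mul_comm]

theorem eq_of_division (hτ : Transcendental K τ) {T : Type} {p : K[X]} (hp : p.Monic)
    {h g r : T →₀ L} (hh : ∀ t, ∃ q : K[X], h t = aeval τ q) (hg : ∀ t, ∃ q : K[X], g t = aeval τ q)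
    (hr : ∀ t, ∃ q : K[X], r t = aeval τ q ∧ q.degree < p.degree)
    (heq : aeval τ p • h = aeval τ p • g + r) : h = g := by
  ext t
  obtain ⟨a, ha⟩ := hh t
  obtain ⟨b, hb⟩ := hg t
  obtain ⟨c, hc, hd⟩ := hr t
  have h1 := DFunLike.congr_fun heq t
  rw [Finsupp.add_apply, Finsupp.smul_apply, Finsupp.smul_apply, ha, hb, hc, smul_eq_mul,
    smul_eq_mul, ← map_mul, ← map_mul, ← map_add] at h1
  have h2 := transcendental_iff_injective.1 hτ h1
  have h3 : p * (a - b) = c := by rw [mul_sub, h2]; ring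
  have h4 : a - b = 0 := by
    by_contra h0
    rw [← h3, mul_comm, hp.degree_mul] at hd
    have : (0 : WithBot ℕ) ≤ (a - b).degree := zero_le_degree_iff.2 h0
    exact absurd hd (not_lt.2 (by simpa using add_le_add_left this p.degree))
  rw [ha, hb, sub_eq_zero.1 h4]

theorem eq_zero_of_sum (hτ : Transcendental K τ) {T : Type} {N : ℕ} {u : ℕ → T →₀ L}
    (hu : ∀ m t, ∃ k : K, u m t = algebraMap K L k)
    (h0 : ∑ m ∈ Finset.range N, τ ^ m • u m = 0) : ∀ m < N, u m = 0 := by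
  intro m hm
  ext t
  choose k hk using fun m => hu m t
  have h1 := DFunLike.congr_fun h0 t
  have h2 : aeval τ (∑ m ∈ Finset.range N, C (k m) * X ^ m : K[X]) = aeval τ (0 : K[X]) := by
    rw [map_zero, map_sum, ← Finsupp.zero_apply (a := t), ← h1, Finsupp.finsetSum_apply]
    refine Finset.sum_congr rfl fun m _ => ?_
    rw [Finsupp.smul_apply, hk, map_mul, aeval_C, map_pow, aeval_X, smul_eq_mul, mul_comm]
  have h3 := congrArg (coeff · m) (transcendental_iff_injective.1 hτ h2)
  rw [hk, ← coeff_sum_C_mul_X_pow k hm, h3, coeff_zero, map_zero, Finsupp.zero_apply]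

end coefficients

section induct

variable {I : Type} [CommRing I] [Nontrivial I] {l n : ℕ} {κ : Fin l → I}
variable {K L : Type} [Field K] [Field L] [Algebra O K] [Algebra K L] [Algebra O L]
  [IsScalarTower O K L] [Setup K L]

variable (n κ K L) in
/-- The action of the strands `1, …, n`. -/
def fF : FA (gensF I n) →ₐ[O] Module.End L (VV I l L) :=
  (ev (DW n κ K L)).comp (FA (gensF I n)).val

variable (I n) in
/-- The strand variables in the subalgebra on the strands `1, …, n`. -/
def yF (q : ℕ) : FA (gensF I n) :=
  if h : q < n then ⟨gen (.Y (q + 1)), gen_mem_FA (.inr (.inl ⟨q + 1, by omega, by omega, rfl⟩))⟩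
  else 0

theorem fF_yF {s : ℕ → Lab I l} (hs : Std n s) {q : ℕ} (hq : q < n) :
    fF n κ K L (yF I n q) (bv (mv n 0 s)) = vL K L (s q) • bv (mv n 0 s) := by
  rw [yF, dif_pos hq]
  show ev (DW n κ K L) (gen (.Y (q + 1))) _ = _
  have := DW_Y (κ := κ) (K := K) (L := L) (mv_mem_TW hs (Nat.zero_le n)) (Nat.succ_le_of_lt hq)
  rw [mv_gt (Nat.succ_pos q) (Nat.succ_le_of_lt hq), Nat.succ_sub_one] at this
  simpa only [ev, gen, FreeAlgebra.lift_ι_apply] using this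

theorem fF_KS {s : ℕ → Lab I l} (hs : Std n s) (r : FA (gensF I n)) :
    fF n κ K L r (bv (mv n 0 s)) ∈ KS K (F0 false n '' {s | Std n s}) :=
  KS_ev false (fun _ hs => hs) (fun _ _ _ _ h => h) r.2
    (Submodule.subset_span ⟨_, ⟨s, hs, rfl⟩, rfl⟩)

open Polynomial in
/-- The normal form with respect to the first strand, with polynomial coefficients. -/
theorem exists_Phi_form (j : ℕ → I) {u : FF I} (hu : u ∈ FA (gens I (n + 1))) :
    ∃ c : ℕ → (FA (gensF I n))[X], ∀ s : ℕ → Lab I l, Std n s → resid κ ∘ s = j →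
      ev (DW n κ K L) u (bv (mv n 0 s)) = ∑ a ∈ Finset.range (n + 1),
        XX n κ K L false a (Phi (R := FA (gensF I n)) (fF n κ K L) (Setup.τ K) (c a) (bv (mv n 0 s))) := by
  obtain ⟨N, c, hc, h⟩ := exists_normalForm false n (mv n 0 j) hu
  refine ⟨fun a => ∑ m ∈ Finset.range N, C (⟨c a m, hc a m⟩ : FA (gensF I n)) * X ^ m,
    fun s hs hj => ?_⟩
  have h1 := ev_bv (κ := κ) (K := K) (L := L) false hs (i := mv n 0 j)
    (by rw [← hj]; exact mv_comp _) (h (Module.End L (VV I l L)) _ isKLR_DW)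
  refine h1.trans (Finset.sum_congr rfl fun a _ => ?_)
  congr 1
  refine ((Phi_sum (R := FA (gensF I n)) (fF n κ K L) (Setup.τ K : L) (degree_sum_C_mul_X_pow_lt _ N) _).trans
    (Finset.sum_congr rfl fun m hm => ?_)).symm
  rw [coeff_sum_C_mul_X_pow _ (Finset.mem_range.1 hm)]
  rfl

theorem Phi_fF {s : ℕ → Lab I l} (hs : Std n s) (p : Polynomial (FA (gensF I n))) {N : ℕ}
    (hN : p.degree < N) :
    Phi (R := FA (gensF I n)) (fF n κ K L) (Setup.τ K) p (bv (mv n 0 s)) ∈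
        ST L (F0 false n '' {s | Std n s}) ∧
      ∀ t, ∃ q : Polynomial K, Phi (R := FA (gensF I n)) (fF n κ K L) (Setup.τ K) p
        (bv (mv n 0 s)) t = Polynomial.aeval (Setup.τ K : L) q ∧ q.degree < N := by
  rw [Phi_sum (R := FA (gensF I n)) _ _ hN]
  exact ⟨sum_mem fun m _ => Submodule.smul_mem _ _ (mem_KS (fF_KS hs _)).1,
    aeval_sum fun m => (mem_KS (fF_KS hs _)).2⟩

theorem degree_lt_succ {R : Type} [Semiring R] (p : Polynomial R) :
    p.degree < ((p.natDegree + 1 : ℕ) : WithBot ℕ) :=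
  Polynomial.degree_le_natDegree.trans_lt (by exact_mod_cast Nat.lt_succ_self _)

/-- The element of the free algebra with given normal form on the first strand. -/
def unPhi (Q : ℕ → Polynomial (FA (gensF I n))) : FF I :=
  ∑ a ∈ Finset.range (n + 1), chi (fun j => gen (I := I) (.P (cr false n j))) a *
    ∑ m ∈ Finset.range ((Q a).natDegree + 1), ((Q a).coeff m : FF I) * gen (.Y 0) ^ m

theorem unPhi_mem (Q : ℕ → Polynomial (FA (gensF I n))) : unPhi Q ∈ FA (gens I (n + 1)) := by
  refine sum_mem fun a ha => mul_mem (chi_gen_mem false (by rw [Finset.mem_range] at ha; omega))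
    (sum_mem fun m _ => mul_mem ?_ (pow_mem (gen_mem_FA (mem_gens_Y (Nat.succ_pos n))) m))
  refine Algebra.adjoin_mono (Set.image_mono ?_) ((Q a).coeff m).2
  rintro g (⟨i, rfl⟩ | ⟨r, h1, h2, rfl⟩ | ⟨r, h1, h2, rfl⟩)
  · exact mem_gens_E i
  · exact mem_gens_Y (by omega)
  · exact mem_gens_P (by omega)

theorem ev_unPhi {s : ℕ → Lab I l} (hs : Std n s) (Q : ℕ → Polynomial (FA (gensF I n))) :
    ev (DW n κ K L) (unPhi Q) (bv (mv n 0 s)) = ∑ a ∈ Finset.range (n + 1),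
      XX n κ K L false a (Phi (R := FA (gensF I n)) (fF n κ K L) (Setup.τ K) (Q a)
        (bv (mv n 0 s))) := by
  rw [unPhi, map_sum, LinearMap.sum_apply]
  refine Finset.sum_congr rfl fun a _ => ?_
  rw [map_mul, ev_chi, Module.End.mul_apply, Phi_sum (R := FA (gensF I n)) _ _ (degree_lt_succ _),
    map_sum, LinearMap.sum_apply]
  congr 1
  refine Finset.sum_congr rfl fun m hm => ?_
  clear hm
  have hY := DW_Y (κ := κ) (K := K) (L := L) (mv_mem_TW hs (Nat.zero_le n)) (Nat.zero_le n)
  rw [mv_eq, hs.τ] at hY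
  have hg : ev (DW n κ K L) (gen (.Y 0)) (bv (mv n 0 s)) = (Setup.τ K : L) • bv (mv n 0 s) := by
    simpa only [ev, gen, FreeAlgebra.lift_ι_apply] using hY
  have hp : (ev (DW n κ K L) (gen (.Y 0)) ^ m) (bv (mv n 0 s)) =
      (Setup.τ K : L) ^ m • bv (mv n 0 s) := by
    induction m with
    | zero => simp
    | succ m ih => rw [pow_succ, Module.End.mul_apply, hg, map_smul, ih, smul_smul, pow_succ']
  rw [map_mul, map_pow, Module.End.mul_apply, hp, map_smul]
  rfl

/-- An element killing the standard vectors factors through the cyclotomic relation. -/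
theorem exists_return (j : ℕ → I) {z : FF I} (hz : z ∈ FA (gens I (n + 1)))
    (hkill : ∀ t : ℕ → Lab I l, Std (n + 1) t → resid κ ∘ t = j → ev (raw κ K L) z (bv t) = 0) :
    ∃ W ∈ FA (gens I (n + 1)), ∀ s : ℕ → Lab I l, Std n s → resid κ ∘ s = j →
      ev (DW n κ K L) z (bv s) = ev (DW n κ K L) (W * (cyc κ (mv n 0 j) *
        chi (fun j => gen (.P (cr true n j))) n)) (bv s) := by
  obtain ⟨c, hc⟩ := exists_Phi_form (κ := κ) (K := K) (L := L) j (mul_mem hz (moveR_mem j (j n)))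
  obtain ⟨d, hd⟩ := monic_pol κ (j n) j n
  set P : Polynomial (FA (gensF I n)) := pol κ (j n) j (yF I n) n with hPdef
  have hP := hd (FA (gensF I n)) (yF I n)
  choose Q S hQS hdeg using fun a => right_division hP.1 (c a)
  refine ⟨unPhi Q, unPhi_mem Q, fun s hs hj => ?_⟩
  have hpS : (polS κ K n s).Monic ∧ (polS κ K n s).natDegree = d := by
    subst hj; exact hd K _
  have hPv : Phi (R := FA (gensF I n)) (fF n κ K L) (Setup.τ K) P (bv (mv n 0 s)) =
      Polynomial.aeval (Setup.τ K : L) (polS κ K n s) • bv (mv n 0 s) := by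
    rw [aeval_polS hs]
    subst hj
    exact Phi_pol (R := FA (gensF I n)) (fun q hq => fF_yF hs hq) _ _
  obtain ⟨_, ⟨h, hh, rfl⟩, hw⟩ := kill_Lat (κ := κ) (K := K) (L := L) hz hs
    (fun t ht h => hkill t ht (h.trans hj))
  have e1 := hc s hs hj
  rw [map_mul, Module.End.mul_apply, moveR_bv hs le_rfl hj, map_smul, mv_self, hw, smul_smul,
    mul_comm, al_gam hs, ← aeval_polS hs, Finset.smul_sum, ← sub_eq_zero,
    ← Finset.sum_sub_distrib] at e1
  simp only [← map_smul, ← map_sub] at e1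
  have e2 := XX_indep false (fun a => sub_mem (Submodule.smul_mem _ _ (mem_KT (hh a)).1)
    (Phi_fF (κ := κ) (K := K) (L := L) hs (c a) (degree_lt_succ _)).1) e1
  have key : ∀ a ≤ n, h a = Phi (R := FA (gensF I n)) (fF n κ K L) (Setup.τ K) (Q a)
      (bv (mv n 0 s)) := by
    intro a ha
    refine eq_of_division (Setup.trans (K := K) (L := L)) hpS.1 (mem_KT (hh a)).2
      (fun t => ((Phi_fF (κ := κ) (K := K) (L := L) hs (Q a) (degree_lt_succ _)).2 t).imp
        fun _ h => h.1) (r := Phi (R := FA (gensF I n)) (fF n κ K L) (Setup.τ K) (S a)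
          (bv (mv n 0 s))) ?_ ?_
    · rw [Polynomial.degree_eq_natDegree hpS.1.ne_zero, hpS.2]
      refine (Phi_fF hs (S a) ?_).2
      rw [← hP.2, ← Polynomial.degree_eq_natDegree hP.1.ne_zero]
      exact hdeg a
    · have := sub_eq_zero.1 (e2 a ha)
      rw [this, hQS a, map_add, map_mul, LinearMap.add_apply, Module.End.mul_apply, hPv, map_smul]
  have hF : F0 true n s = s := mv_self
  have hX := ev_cyc_XX (κ := κ) (K := K) (L := L) hs le_rfl (mv n 0 j)
  rw [if_pos ⟨rfl, by rw [← hj]; exact mv_comp _⟩, hF] at hX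
  rw [map_mul, map_mul, ev_chi, Module.End.mul_apply, Module.End.mul_apply]
  refine Eq.trans ?_ (congrArg _ hX.symm)
  rw [map_smul, hw]
  congr 1
  refine Eq.trans ?_ (ev_unPhi hs Q).symm
  refine Finset.sum_congr rfl fun a ha => ?_
  rw [key a (by rw [Finset.mem_range] at ha; omega)]

end induct

section induct

variable {I : Type} [CommRing I] {l n : ℕ} {κ : Fin l → I}
variable {K L : Type} [Field K] [Field L] [Algebra O K] [Algebra K L] [Algebra O L]
  [IsScalarTower O K L] [Setup K L]

variable (n κ K L) in
/-- The seminormal representation detects vanishing in cyclotomic quotients. -/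
def Detects : Prop :=
  ∀ (A : Type) [Ring A] [Algebra O A] (D : G I → A), IsKLR n D → IsCyc κ D →
    ∀ (j : ℕ → I), ∀ z ∈ FA (gens I n),
      (∀ t : ℕ → Lab I l, Std n t → resid κ ∘ t = j → ev (raw κ K L) z (bv t) = 0) →
      ev D z * D (.E j) = 0

theorem detects_succ [Nontrivial I] (ih : Detects n κ K L) : Detects (n + 1) κ K L := by
  intro A _ _ D hD hC j z hz hkill
  obtain ⟨W, hW, hWs⟩ := exists_return j hz hkill
  set Z : FF I := W * (cyc κ (mv n 0 j) * chi (fun j => gen (.P (cr true n j))) n) with hZ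
  have hcyc : cyc κ (mv n 0 j) ∈ FA (gens I (n + 1)) := by
    refine mul_mem (gen_mem_FA (mem_gens_E _)) (list_prod_mem ?_)
    simp only [List.mem_map]
    rintro _ ⟨c, -, rfl⟩
    split_ifs
    · exact sub_mem (gen_mem_FA (mem_gens_Y (Nat.succ_pos n))) (Subalgebra.algebraMap_mem _ _)
    · exact one_mem _
  have hZm : Z ∈ FA (gens I (n + 1)) := mul_mem hW (mul_mem hcyc (chi_gen_mem true le_rfl))
  have hZ0 : ev D Z = 0 := by
    rw [hZ, map_mul, map_mul, ev_cyc, hC, zero_mul, mul_zero]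
  obtain ⟨N, c, hc, h⟩ := exists_normalForm true n j (sub_mem hz hZm)
  have hc0 : ∀ a ≤ n, ∀ m < N, ev D (c a m) * D (.E j) = 0 := by
    intro a ha m hm
    refine ih A D (hD.mono (Nat.le_succ n)) hC j (c a m) (hc a m) fun s hs hj => ?_
    have hF : F0 true n s = s := mv_self
    have h1 := ev_bv (κ := κ) (K := K) (L := L) true hs (i := j) (by rw [hF]; exact hj)
      (h (Module.End L (VV I l L)) _ isKLR_DW)
    rw [hF, map_sub, LinearMap.sub_apply, hWs s hs hj, sub_self] at h1
    have hS : ∀ a m, ev (DW n κ K L) (c a m) (bv s) ∈ KS K (F0 true n '' {s | Std n s}) :=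
      fun a m => KS_ev true (fun _ hs => hs) (fun _ _ _ _ h => h) (hc a m)
        (Submodule.subset_span ⟨_, ⟨s, hs, rfl⟩, by rw [hF]⟩)
    have h2 := XX_indep true (fun a => sum_mem fun m _ => Submodule.smul_mem _ _
      (mem_KS (hS a m)).1) h1.symm a ha
    have h3 := eq_zero_of_sum (Setup.trans (K := K) (L := L)) (fun m => (mem_KS (hS a m)).2) h2 m hm
    rw [← (ev_ST adm_TW (Algebra.adjoin_mono (Set.image_mono ?_) (hc a m))
      (bv_mem hs.mem_TW)).1]
    · exact h3
    · rintro g (⟨i, rfl⟩ | ⟨r, h2, rfl⟩ | ⟨r, h2, rfl⟩)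
      · exact mem_gens_E i
      · exact mem_gens_Y (by omega)
      · exact mem_gens_P (by omega)
  have h1 := h A D hD
  rw [map_sub, hZ0, sub_zero] at h1
  rw [h1]
  refine Finset.sum_eq_zero fun a ha => Finset.sum_eq_zero fun m hm => ?_
  have hYE : ∀ m : ℕ, D (.Y (pos true n 0)) ^ m * D (.E j) =
      D (.E j) * D (.Y (pos true n 0)) ^ m := fun m =>
    (Commute.pow_left (show Commute _ _ from hD.YE _ j (by simp [pos])) m)
  rw [mul_assoc (ev D (c a m)), hYE, ← mul_assoc (ev D (c a m)),
    hc0 a (by rw [Finset.mem_range] at ha; omega) m (Finset.mem_range.1 hm), zero_mul, mul_zero]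

theorem detects_zero : Detects 0 κ K L := by
  intro A _ _ D hD _ j z hz hkill
  suffices ∃ c : O, (∀ t : ℕ → Lab I l, resid κ ∘ t = j →
      ev (raw κ K L) z (bv t) = algebraMap O L c • bv t) ∧ ev D z * D (.E j) = c • D (.E j) by
    obtain ⟨c, h1, h2⟩ := this
    have ht : resid κ ∘ (fun q => .inr (j q) : ℕ → Lab I l) = j := rfl
    have h3 := h1 _ ht
    rw [hkill _ ⟨fun q hq => absurd hq (Nat.not_lt_zero q), fun q _ => ⟨_, rfl⟩⟩ ht] at h3
    have h4 := DFunLike.congr_fun h3 (fun q => .inr (j q))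
    have h5 : Function.Injective (algebraMap O L) := by
      rw [IsScalarTower.algebraMap_eq O K L]
      exact (algebraMap K L).injective.comp (Setup.inj (L := L))
    rw [Finsupp.zero_apply, Finsupp.smul_apply, Finsupp.single_eq_same, smul_eq_mul, mul_one] at h4
    rw [h2, (map_eq_zero_iff _ h5).1 h4.symm, zero_smul]
  clear hkill
  induction hz using Algebra.adjoin_induction with
  | mem z hz =>
    obtain ⟨g, hg, rfl⟩ := hz
    simp only [ev, gen, FreeAlgebra.lift_ι_apply]
    rcases hg with ⟨i, rfl⟩ | ⟨r, hr, _⟩ | ⟨r, hr, _⟩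
    · refine ⟨if i = j then 1 else 0, fun t ht => ?_, ?_⟩
      · rw [raw_E, ht]
        by_cases h : i = j
        · simp [h]
        · simp [h, Ne.symm h]
      · split_ifs with h
        · rw [h, hD.EE, one_smul]
        · rw [hD.EE' _ _ h, zero_smul]
    · omega
    · omega
  | algebraMap r =>
    refine ⟨r, fun t _ => ?_, ?_⟩
    · rw [AlgHom.commutes, algebraMap_End_apply]
    · rw [AlgHom.commutes, Algebra.smul_def]
  | add a b _ _ ha hb =>
    obtain ⟨c, h1, h2⟩ := ha
    obtain ⟨c', h1', h2'⟩ := hb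
    exact ⟨c + c', fun t ht => by
      rw [map_add, LinearMap.add_apply, h1 t ht, h1' t ht, map_add, add_smul], by
      rw [map_add, add_mul, h2, h2', add_smul]⟩
  | mul a b _ _ ha hb =>
    obtain ⟨c, h1, h2⟩ := ha
    obtain ⟨c', h1', h2'⟩ := hb
    exact ⟨c * c', fun t ht => by
      rw [map_mul, Module.End.mul_apply, h1' t ht, map_smul, h1 t ht, smul_smul, map_mul, mul_comm],
      by rw [map_mul, mul_assoc, h2', mul_smul_comm, h2, smul_smul, mul_comm]⟩

theorem detects [Nontrivial I] (n : ℕ) : Detects n κ K L := by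
  induction n with
  | zero => exact detects_zero
  | succ n ih => exact detects_succ ih

end induct

section reduction

variable {I : Type} [CommRing I] {l n : ℕ} {κ : Fin l → I}
variable {K L : Type} [Field K] [Field L] [Algebra O K] [Algebra K L] [Algebra O L]
  [IsScalarTower O K L] [Setup K L]

theorem adm_StdU (n : ℕ) : Adm n {t : ℕ → Lab I l | StdU n t} := by
  intro t ht r hr hs
  by_contra h
  exact hs (StdU.sw ht hr h)

theorem sep_of_StdU {n : ℕ} {T : Set (ℕ → Lab I l)} (hT : ∀ t ∈ T, StdU n t) :
    Sep (K := K) (L := L) n T := by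
  intro t ht
  refine ⟨fun r hr => ?_, fun r hr => ?_⟩
  · obtain ⟨a, ha, -⟩ := hT t ht r (by omega)
    exact vL_ne K L ((hT t ht).ne_succ hr) ⟨a, .inl ha⟩
  · obtain ⟨a, ha, -⟩ := hT t ht r (by omega)
    exact vL_ne K L ((hT t ht).ne_succ_succ hr) ⟨a, .inl ha⟩

theorem exists_smul_of_FA_zero {z : FF I} (hz : z ∈ FA (gens I 0)) (t : ℕ → Lab I l) :
    ∃ c : O, ev (raw κ K L) z (bv t) = c • bv t := by
  induction hz using Algebra.adjoin_induction with
  | mem z hz =>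
    obtain ⟨g, hg, rfl⟩ := hz
    simp only [ev, gen, FreeAlgebra.lift_ι_apply]
    rcases hg with ⟨i, rfl⟩ | ⟨r, hr, _⟩ | ⟨r, hr, _⟩
    · refine ⟨if resid κ ∘ t = i then 1 else 0, ?_⟩
      rw [raw_E]
      split_ifs
      · rw [one_smul]
      · rw [zero_smul]
    · omega
    · omega
  | algebraMap r => exact ⟨r, by rw [AlgHom.commutes, Module.algebraMap_end_apply]⟩
  | add a b _ _ ha hb =>
    obtain ⟨c, h⟩ := ha
    obtain ⟨c', h'⟩ := hb
    exact ⟨c + c', by rw [map_add, LinearMap.add_apply, h, h', add_smul]⟩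
  | mul a b _ _ ha hb =>
    obtain ⟨c, h⟩ := ha
    obtain ⟨c', h'⟩ := hb
    exact ⟨c' * c, by
      rw [map_mul, Module.End.mul_apply, h', LinearMap.map_smul_of_tower, h, smul_smul]⟩

theorem pow_eigen {V : Type} [AddCommGroup V] [Module L V] {y : Module.End L V} {a : L} {v : V}
    (h : y v = a • v) (m : ℕ) : (y ^ m) v = a ^ m • v := by
  induction m with
  | zero => simp
  | succ m ih => rw [pow_succ, Module.End.mul_apply, h, map_smul, ih, smul_smul, pow_succ, mul_comm]

theorem exists_fg [Nontrivial I] {t : ℕ → Lab I l} (ht : StdU n t) :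
    ∃ N : Submodule O (VV I l L), N.FG ∧ ∀ z ∈ FA (gens I n), ev (raw κ K L) z (bv t) ∈ N := by
  induction n with
  | zero =>
    refine ⟨Submodule.span O {bv t}, Submodule.fg_span_singleton _, fun z hz => ?_⟩
    obtain ⟨c, hc⟩ := exists_smul_of_FA_zero (κ := κ) (K := K) (L := L) hz t
    exact Submodule.mem_span_singleton.2 ⟨c, hc.symm⟩
  | succ n ih =>
    obtain ⟨N, hN, hNz⟩ := ih (ht.mono n.le_succ)
    set D := DT κ K L (n + 1) {t | StdU (n + 1) t} with hDdef
    have hD : IsKLR (n + 1) D := isKLR_DT (adm_StdU _) (sep_of_StdU fun _ h => h)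
    refine ⟨⨆ a ∈ Finset.range (n + 1),
      N.map ((chi (fun j => D (.P (cr true n j))) a).restrictScalars O),
      Submodule.fg_biSup _ _ fun a _ => hN.map _, fun z hz => ?_⟩
    obtain ⟨M, c, hc, h⟩ := exists_normalForm true n (resid κ ∘ t) hz
    have h1 := LinearMap.congr_fun (h (Module.End L (VV I l L)) D hD) (bv t)
    have hE : D (.E (resid κ ∘ t)) (bv t) = bv t := by
      rw [hDdef, DT_bv _ (mem_gens_E _) _ ht, raw_E, if_pos rfl]
    rw [Module.End.mul_apply, hE, (ev_ST (adm_StdU _) hz (bv_mem ht)).1] at h1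
    rw [h1]
    simp only [normalForm, LinearMap.sum_apply, Module.End.mul_apply, hE]
    refine sum_mem fun a ha => sum_mem fun m _ => ?_
    refine Submodule.mem_iSup_of_mem a (Submodule.mem_iSup_of_mem ha
      (Submodule.mem_map_of_mem (f := (chi (fun j => D (.P (cr true n j))) a).restrictScalars O) ?_))
    obtain ⟨b, hb, -⟩ := ht n n.lt_succ_self
    have hY : D (.Y (pos true n 0)) (bv t) = vL K L (t n) • bv t := by
      rw [show pos true n 0 = n by simp [pos], hDdef, DT_bv _ (mem_gens_Y n.lt_succ_self) _ ht,
        raw_Y]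
    have hv : ∃ p : O, vL K L (t n) = algebraMap O L p := by
      rw [hb]
      exact ⟨_, (IsScalarTower.algebraMap_apply O K L _).symm⟩
    obtain ⟨p, hp⟩ := hv
    rw [pow_eigen hY, hp, ← map_pow, algebraMap_smul, LinearMap.map_smul_of_tower]
    refine N.smul_mem _ ?_
    have hm : c a m ∈ FA (gens I n) := hc a m
    rw [(ev_ST (adm_StdU _) (Algebra.adjoin_mono (Set.image_mono ?_) hm) (bv_mem ht)).1]
    · exact hNz _ hm
    · rintro g (⟨i, rfl⟩ | ⟨r, h2, rfl⟩ | ⟨r, h2, rfl⟩)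
      · exact mem_gens_E i
      · exact mem_gens_Y (by omega)
      · exact mem_gens_P (by omega)

theorem ev_cycRel {A : Type} [Ring A] [Algebra O A] (D : G I → A) (i : ℕ → I) :
    ev D (gen (.E i) * cycPoly κ (i 0) (gen (.Y 0))) = D (.E i) * cycPoly κ (i 0) (D (.Y 0)) := by
  rw [map_mul, map_cycPoly]
  simp only [ev, gen, FreeAlgebra.lift_ι_apply]

theorem IsCyc.restrict {R M : Type} [CommRing R] [Algebra O R] [AddCommGroup M] [Module R M]
    [Module O M] [IsScalarTower O R M] {D : G I → Module.End R M} (h : IsCyc κ D)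
    {W : Submodule R M} (hW : ∀ g, ∀ v ∈ W, D g v ∈ W) :
    IsCyc κ (fun g => (D g).restrict (hW g)) := by
  intro i
  refine LinearMap.ext fun v => Subtype.ext ?_
  have := ev_restrict D hW (gen (.E i) * cycPoly κ (i 0) (gen (.Y 0))) v
  rw [ev_cycRel, ev_cycRel, h i] at this
  exact this

theorem IsCyc.mapQ {R M : Type} [CommRing R] [Algebra O R] [AddCommGroup M] [Module R M]
    [Module O M] [IsScalarTower O R M] {D : G I → Module.End R M} (h : IsCyc κ D)
    {W : Submodule R M} (hW : ∀ g, W ≤ W.comap (D g)) :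
    IsCyc κ (fun g => W.mapQ W (D g) (hW g)) := by
  intro i
  refine LinearMap.ext fun v => ?_
  obtain ⟨v, rfl⟩ := Submodule.Quotient.mk_surjective W v
  have := ev_mapQ D hW (gen (.E i) * cycPoly κ (i 0) (gen (.Y 0))) v
  rw [ev_cycRel, ev_cycRel, h i] at this
  exact this

section scalars

variable {V : Type} [AddCommGroup V] [Module L V] [Module O V] [IsScalarTower O L V]

theorem IsKLR.resEnd {D : G I → Module.End L V} (h : IsKLR n D) :
    IsKLR n (fun g => resEnd O L V (D g)) := h.map (DefKLR.resEnd O L V)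

theorem IsCyc.resEnd {D : G I → Module.End L V} (h : IsCyc κ D) :
    IsCyc κ (fun g => resEnd O L V (D g)) := h.map (DefKLR.resEnd O L V)

theorem ev_resEnd (D : G I → Module.End L V) (z : FF I) (v : V) :
    ev (fun g => resEnd O L V (D g)) z v = ev D z v := by
  rw [ev_comp (resEnd O L V)]
  rfl

end scalars

end reduction

section quotient

variable {I : Type} [CommRing I] {l n : ℕ}

/-- The reduction at `X = 0` of a finitely generated cyclic module. -/
theorem exists_reduction_of_fg {κ : Fin l → I} {V : Type} [AddCommGroup V] [Module O V]
    {D : G I → Module.End O V} (hK : IsKLR n D) (hC : 0 < n → IsCyc κ D) {N : Submodule O V}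
    (hW : ∀ g, ∀ v ∈ N, D g v ∈ N) (hfg : N.FG) {b : V} (hb : b ∈ N)
    (hgen : ∀ v ∈ N, ∃ z, ev D z b = v) (hfree : ∀ r : O, r • b = 0 → r = 0) {i₀ : ℕ → I}
    (hi : D (.E i₀) b = b) :
    ∃ (A : Type) (_ : Ring A) (_ : Algebra O A) (D' : G I → A), IsKLR n D' ∧
      (0 < n → IsCyc κ D') ∧ xx A = 0 ∧ D' (.E i₀) ≠ 0 ∧
      ∀ S : Finset (ℕ → I), (∀ v ∈ N, ∑ i ∈ S, D (.E i) v = v) → ∑ i ∈ S, D' (.E i) = 1 := by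
  set Q : Submodule O N := Ideal.span {(Polynomial.X : O)} • ⊤ with hQ
  set D2 : G I → Module.End O N := fun g => (D g).restrict (hW g) with hD2
  have hQD : ∀ g, Q ≤ Q.comap (D2 g) := fun g => by
    rw [← Submodule.map_le_iff_le_comap, hQ, Submodule.map_smul'']
    exact smul_mono_right _ le_top
  refine ⟨Module.End O (N ⧸ Q), inferInstance, inferInstance,
    fun g => Q.mapQ Q (D2 g) (hQD g), (hK.restrict hW).mapQ hQD,
    fun hn => ((hC hn).restrict hW).mapQ hQD, ?_, ?_, ?_⟩
  · refine LinearMap.ext fun v => ?_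
    obtain ⟨v, rfl⟩ := Submodule.Quotient.mk_surjective Q v
    rw [xx, Module.algebraMap_end_apply, LinearMap.zero_apply, ← Submodule.Quotient.mk_smul,
      Submodule.Quotient.mk_eq_zero]
    exact Submodule.smul_mem_smul (Ideal.subset_span rfl) trivial
  · intro h0
    have h1 := LinearMap.congr_fun h0 (Submodule.Quotient.mk ⟨b, hb⟩)
    rw [Submodule.mapQ_apply, LinearMap.zero_apply, Submodule.Quotient.mk_eq_zero] at h1
    have h2 : D2 (.E i₀) ⟨b, hb⟩ = ⟨b, hb⟩ := Subtype.ext hi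
    rw [h2] at h1
    have h3 : (⊤ : Submodule O N) ≤ Q := by
      rintro ⟨v, hv⟩ -
      obtain ⟨z, rfl⟩ := hgen v hv
      have h4 : (⟨ev D z b, hv⟩ : N) = ev D2 z ⟨b, hb⟩ :=
        Subtype.ext (ev_restrict D hW z ⟨b, hb⟩).symm
      rw [h4]
      have h5 := ev_mapQ D2 hQD z ⟨b, hb⟩
      rw [(Submodule.Quotient.mk_eq_zero Q).2 h1, map_zero] at h5
      exact (Submodule.Quotient.mk_eq_zero Q).1 h5.symm
    obtain ⟨r, hr, hr0⟩ := Submodule.exists_sub_one_mem_and_smul_eq_zero_of_fg_of_le_smul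
      (Ideal.span {(Polynomial.X : O)}) (⊤ : Submodule O N) ((Submodule.fg_top N).2 hfg) h3
    have h6 := congrArg Subtype.val (hr0 ⟨b, hb⟩ trivial)
    have h7 := hfree r h6
    rw [h7, zero_sub, Ideal.mem_span_singleton, dvd_neg] at hr
    exact Polynomial.not_isUnit_X (isUnit_of_dvd_one hr)
  · intro S hS
    refine LinearMap.ext fun v => ?_
    obtain ⟨⟨v, hv⟩, rfl⟩ := Submodule.Quotient.mk_surjective Q v
    rw [LinearMap.sum_apply]
    simp only [Submodule.mapQ_apply]
    refine (map_sum Q.mkQ _ _).symm.trans (congrArg _ ?_)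
    refine Subtype.ext ?_
    rw [AddSubmonoidClass.coe_finsetSum]
    exact hS v hv

/-- The reduction at `X = 0` of the lattice generated by a standard basis vector. -/
theorem exists_reduction [Nontrivial I] (κ : Fin l → I) (K L : Type) [Field K] [Field L]
    [Algebra O K] [Algebra K L] [Algebra O L] [IsScalarTower O K L] [Setup K L] {t : ℕ → Lab I l} (ht : Std n t) :
    ∃ (A : Type) (_ : Ring A) (_ : Algebra O A) (D : G I → A), IsKLR n D ∧
      (0 < n → IsCyc κ D) ∧ xx A = 0 ∧ D (.E (resid κ ∘ t)) ≠ 0 ∧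
      ∀ S : Finset (ℕ → I), (∀ i : ℕ → I, (∀ q ≥ n, i q = resid κ (t q)) → i ∈ S) →
        ∑ i ∈ S, D (.E i) = 1 := by
  set T : Set (ℕ → Lab I l) := {s | StdU n s ∧ ∀ q ≥ n, s q = t q} with hT
  have hTt : t ∈ T := ⟨ht.1, fun _ _ => rfl⟩
  have hadm : Adm n T := by
    intro s hs r hr h
    by_contra hl
    exact h ⟨hs.1.sw hr hl, fun q hq => by rw [sw_ne r s q (by omega) (by omega)]; exact hs.2 q hq⟩
  have hTU : ∀ s ∈ T, StdU n s := fun s hs => hs.1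
  set D := DT κ K L n T with hDdef
  set D1 : G I → Module.End O (VV I l L) := fun g => resEnd O L (VV I l L) (D g) with hD1
  have k0 : IsKLR n D := isKLR_DT hadm (sep_of_StdU hTU)
  have c0 : 0 < n → IsCyc κ D := fun hn => isCyc_DT hn hTU
  have k1 : IsKLR n D1 := k0.resEnd
  have c1 : 0 < n → IsCyc κ D1 := fun hn => (c0 hn).resEnd
  have e1 : ∀ z v, ev D1 z v = ev D z v := ev_resEnd D
  set N : Submodule O (VV I l L) := (Subalgebra.toSubmodule (FA (gens I n))).map
    ((LinearMap.applyₗ (R := O) (bv t : VV I l L)).comp (ev D1).toLinearMap) with hN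
  have memN : ∀ v, v ∈ N ↔ ∃ z ∈ FA (gens I n), ev D1 z (bv t) = v := fun v => Iff.rfl
  have hW : ∀ g, ∀ v ∈ N, D1 g v ∈ N := by
    intro g v hv
    obtain ⟨z, hz, rfl⟩ := (memN v).1 hv
    by_cases hg : g ∈ gens I n
    · refine (memN _).2 ⟨gen g * z, mul_mem (gen_mem_FA hg) hz, ?_⟩
      rw [map_mul, Module.End.mul_apply]
      simp only [ev, gen, FreeAlgebra.lift_ι_apply]
    · have : D1 g = 0 := by rw [hD1]; simp only [hDdef, DT, if_neg hg, map_zero]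
      rw [this]
      exact N.zero_mem
  have hfg : N.FG := by
    obtain ⟨N', hN', h⟩ := exists_fg (κ := κ) (K := K) (L := L) ht.1
    refine hN'.of_le ?_
    intro v hv
    obtain ⟨z, hz, rfl⟩ := (memN v).1 hv
    rw [e1, (ev_ST hadm hz (bv_mem hTt)).1]
    exact h z hz
  have hNT : ∀ v ∈ N, v ∈ ST L T := by
    intro v hv
    obtain ⟨z, hz, rfl⟩ := (memN v).1 hv
    rw [e1, (ev_ST hadm hz (bv_mem hTt)).1]
    exact (ev_ST hadm hz (bv_mem hTt)).2
  have hbN : bv t ∈ N := (memN _).2 ⟨1, one_mem _, by rw [map_one]; rfl⟩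
  have hi : D1 (.E (resid κ ∘ t)) (bv t) = bv t := by
    show D (.E (resid κ ∘ t)) (bv t) = bv t
    rw [hDdef, DT_bv _ (mem_gens_E _) _ hTt, raw_E, if_pos rfl]
  have hfree : ∀ r : O, r • (bv t : VV I l L) = 0 → r = 0 := by
    intro r hr
    have h7 := DFunLike.congr_fun hr t
    have h8 : Function.Injective (algebraMap O L) := by
      rw [IsScalarTower.algebraMap_eq O K L]
      exact (algebraMap K L).injective.comp (Setup.inj (L := L))
    rwa [Finsupp.smul_apply, Finsupp.single_eq_same, Algebra.smul_def, mul_one,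
      Finsupp.zero_apply, map_eq_zero_iff _ h8] at h7
  obtain ⟨A, iA, iA', D', h1, h2, h3, h4, h5⟩ := exists_reduction_of_fg k1 c1 hW hfg hbN
    (fun v hv => let ⟨z, _, h⟩ := (memN v).1 hv; ⟨z, h⟩) hfree hi
  refine ⟨A, iA, iA', D', h1, h2, h3, h4, fun S hS => h5 S fun v hv => ?_⟩
  show ∑ i ∈ S, D (.E i) v = v
  have := hNT v hv
  clear hv
  induction this using Submodule.span_induction with
  | mem v hv =>
    obtain ⟨s, hs, rfl⟩ := hv
    rw [Finset.sum_eq_single (resid κ ∘ s)]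
    · rw [hDdef, DT_bv _ (mem_gens_E _) _ hs, raw_E, if_pos rfl]
    · intro i _ hi
      rw [hDdef, DT_bv _ (mem_gens_E _) _ hs, raw_E, if_neg hi.symm]
    · intro h
      exact absurd (hS _ fun q hq => by rw [Function.comp_apply, hs.2 q hq]) h
  | zero => simp
  | add u v _ _ hu hv =>
    simp only [map_add, Finset.sum_add_distrib]
    rw [hu, hv]
  | smul c v _ hv =>
    simp only [map_smul, ← Finset.smul_sum]
    rw [hv]

end quotient

open Paper (Node diag IsMultipartition IsTableau RowColIncreasing IsStdTab res resAt resSeqT)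

section beads

variable {I : Type} {l : ℕ}

/-- The bead configuration of a multipartition. -/
def beads (lam : Fin l → ℕ → ℕ) : Fin l × ℤ → Prop := fun a => ∀ r : ℕ, (r : ℤ) - lam a.1 r ≠ a.2

/-- Adding a box at the end of a row. -/
def addBox (lam : Fin l → ℕ → ℕ) (c : Fin l) (r : ℕ) : Fin l → ℕ → ℕ :=
  fun c' r' => lam c' r' + if c' = c ∧ r' = r then 1 else 0

/-- The condition for a row to be extendable. -/
def CanAdd (lam : Fin l → ℕ → ℕ) (c : Fin l) (r : ℕ) : Prop := r = 0 ∨ lam c r < lam c (r - 1)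

theorem beads_zero (a : Fin l × ℤ) : beads (fun _ _ => 0) a ↔ a.2 < 0 := by
  constructor
  · intro h
    by_contra h'
    exact h a.2.toNat (by push_cast; omega)
  · intro h r
    push_cast
    omega

variable {lam : Fin l → ℕ → ℕ} {c : Fin l} {r : ℕ}

theorem beads_strictMono (h : Antitone (lam c)) : StrictMono fun r : ℕ => (r : ℤ) - lam c r :=
  strictMono_nat_of_lt_succ fun r => by
    have := h (show r ≤ r + 1 by omega)
    push_cast
    omega

theorem legal_beads (h : Antitone (lam c)) (hr : CanAdd lam c r) :
    Legal (beads lam) (c, (r : ℤ) - lam c r) := by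
  refine ⟨fun s hs => ?_, fun hs => hs r rfl⟩
  have hs : (s : ℤ) - lam c s = r - lam c r - 1 := hs
  have hm := beads_strictMono h
  have h1 : s < r := hm.lt_iff_lt.1 (by show (s : ℤ) - lam c s < r - lam c r; omega)
  have h2 := hm.monotone (show s ≤ r - 1 by omega)
  rcases hr with hr | hr <;> omega

theorem exists_canAdd {a : Fin l × ℤ} (ha : Legal (beads lam) a) :
    ∃ r : ℕ, a.2 = (r : ℤ) - lam a.1 r ∧ (Antitone (lam a.1) → CanAdd lam a.1 r) := by
  obtain ⟨h1, h2⟩ := ha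
  simp only [beads, not_forall, not_not] at h2
  obtain ⟨r, hr⟩ := h2
  refine ⟨r, hr.symm, fun h => ?_⟩
  by_contra h3
  simp only [CanAdd, not_or, not_lt] at h3
  have := h (show r - 1 ≤ r by omega)
  refine h1 (r - 1) ?_
  simp only [prv]
  omega

theorem step_beads (h : Antitone (lam c)) :
    step (beads lam) (.inl (c, (r : ℤ) - lam c r) : Lab I l) = beads (addBox lam c r) := by
  funext ⟨c', s⟩
  simp only [step, beads, addBox, prv, eq_iff_iff, Prod.mk.injEq, ne_eq, not_and]
  have hinj := (beads_strictMono h).injective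
  by_cases hc : c' = c
  · subst hc
    simp only [true_and, forall_const]
    constructor
    · rintro (rfl | ⟨h1, h2⟩) q hq
      · split_ifs at hq with e
        · subst e; push_cast at hq; omega
        · exact e (hinj (by show (q : ℤ) - lam c' q = r - lam c' r; push_cast at hq; omega))
      · split_ifs at hq with e
        · subst e; push_cast at hq; omega
        · exact h2 q (by push_cast at hq; omega)
    · intro h1
      by_cases hs : s = (r : ℤ) - lam c' r
      · exact .inl hs
      · refine .inr ⟨fun h2 => ?_, fun q hq => ?_⟩
        · have := h1 r
          rw [if_pos rfl] at this
          push_cast at this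
          omega
        · have := h1 q
          split_ifs at this with e
          · subst e; exact hs hq.symm
          · exact this (by push_cast; omega)
  · simp [hc]

end beads

section tableaux

variable {l n : ℕ} {lam : Fin l → ℕ → ℕ} {T : Node l → ℕ} {c : Fin l} {r : ℕ}

theorem antitone_addBox (h : ∀ c, Antitone (lam c)) (hr : CanAdd lam c r) (c' : Fin l) :
    Antitone (addBox lam c r c') := by
  refine antitone_nat_of_succ_le fun q => ?_
  have h1 := h c' (show q ≤ q + 1 by omega)
  simp only [addBox]
  by_cases hc : c' = c ∧ q + 1 = r
  · obtain ⟨rfl, rfl⟩ := hc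
    rcases hr with hr | hr
    · omega
    · simp only [Nat.add_sub_cancel] at hr
      simp
      omega
  · rw [if_neg hc]
    omega

theorem diag_addBox : diag l (addBox lam c r) = insert (c, r, lam c r) (diag l lam) := by
  ext ⟨c', r', j⟩
  simp only [diag, addBox, Set.mem_ofPred_eq, Set.mem_insert_iff, Prod.mk.injEq]
  by_cases h : c' = c ∧ r' = r
  · obtain ⟨rfl, rfl⟩ := h
    simp
    omega
  · simp only [if_neg h]
    constructor
    · exact fun h => .inr h
    · rintro (⟨h1, h2, -⟩ | h1)
      · exact absurd ⟨h1, h2⟩ h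
      · exact h1

theorem sum_addBox (N : ℕ) (hr : r < N) :
    ∑ c' : Fin l, ∑ r' ∈ Finset.range N, addBox lam c r c' r' =
      (∑ c' : Fin l, ∑ r' ∈ Finset.range N, lam c' r') + 1 := by
  simp only [addBox, Finset.sum_add_distrib, ite_and]
  congr 1
  rw [Finset.sum_eq_single c (fun b _ hb => by simp [hb]) (by simp)]
  simp [hr]

theorem sum_range_succ_of_rows (h : ∀ (c : Fin l) (r : ℕ), lam c r ≠ 0 → r < n) :
    ∑ c : Fin l, ∑ r ∈ Finset.range (n + 1), lam c r =
      ∑ c : Fin l, ∑ r ∈ Finset.range n, lam c r := by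
  refine Finset.sum_congr rfl fun c _ => ?_
  rw [Finset.sum_range_succ]
  by_contra hne
  exact absurd (h c n (by omega)) (lt_irrefl _)

theorem isMultipartition_addBox (h : IsMultipartition l n lam) (hr : CanAdd lam c r) :
    IsMultipartition l (n + 1) (addBox lam c r) := by
  have hrn : r < n + 1 := by
    rcases hr with hr | hr
    · omega
    · have := h.2.1 c (r - 1) (by omega)
      omega
  refine ⟨antitone_addBox h.1 hr, fun c' r' h' => ?_, ?_⟩
  · by_cases hc : c' = c ∧ r' = r
    · omega
    · simp only [addBox, if_neg hc, add_zero] at h'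
      exact (h.2.1 c' r' h').trans n.lt_succ_self
  · rw [sum_addBox _ hrn, sum_range_succ_of_rows h.2.1, h.2.2]

theorem isMultipartition_of_addBox (h : IsMultipartition l (n + 1) (addBox lam c r))
    (hlam : ∀ c, Antitone (lam c)) : IsMultipartition l n lam := by
  have hr : r < n + 1 := h.2.1 c r (by simp [addBox])
  have hs := h.2.2
  rw [sum_addBox _ hr] at hs
  have hrow : ∀ (c : Fin l) (r : ℕ), lam c r ≠ 0 → r < n := by
    intro c' r' h'
    by_contra hn
    have h1 : ∀ q ∈ Finset.range (n + 1), 1 ≤ lam c' q := fun q hq => by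
      have := hlam c' (show q ≤ r' by rw [Finset.mem_range] at hq; omega)
      omega
    have h2 := Finset.sum_le_sum h1
    have h3 := Finset.single_le_sum (f := fun c' => ∑ r ∈ Finset.range (n + 1), lam c' r)
      (fun _ _ => Nat.zero_le _) (Finset.mem_univ c')
    simp only [Finset.sum_const, Finset.card_range, smul_eq_mul, mul_one] at h2 h3
    omega
  refine ⟨hlam, hrow, ?_⟩
  rw [← sum_range_succ_of_rows hrow]
  omega

theorem Icc_succ_eq : Set.Icc 1 (n + 1) = insert (n + 1) (Set.Icc 1 n) := by
  ext k
  simp only [Set.mem_Icc, Set.mem_insert_iff]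
  omega

theorem isStdTab_addBox (h : IsStdTab l n lam T) (hr : CanAdd lam c r) :
    IsStdTab l (n + 1) (addBox lam c r) (Function.update T (c, r, lam c r) (n + 1)) := by
  obtain ⟨h1, ⟨h2, h3⟩, h4, h5⟩ := h
  set x : Node l := (c, r, lam c r) with hx
  have hxd : x ∉ diag l lam := by simp [diag, hx]
  have hT : ∀ y ∈ diag l lam, Function.update T x (n + 1) y = T y := fun y hy =>
    Function.update_of_ne (fun e => hxd (by rwa [e] at hy)) _ _
  have hTx : Function.update T x (n + 1) x = n + 1 := Function.update_self _ _ _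
  have hle : ∀ y ∈ diag l lam, Function.update T x (n + 1) y < n + 1 := fun y hy => by
    rw [hT y hy]
    exact Nat.lt_succ_of_le (h2.mapsTo hy).2
  have hd := diag_addBox (lam := lam) (c := c) (r := r)
  rw [← hx] at hd
  have hanti := h1.1
  refine ⟨isMultipartition_addBox h1 hr, ⟨?_, ?_⟩, ?_, ?_⟩
  · have hb := Set.BijOn.insert (a := x) (h2.congr fun y hy => (hT y hy).symm)
      (by rw [hTx]; simp)
    rwa [hTx, ← hd, ← Icc_succ_eq] at hb
  · intro y hy
    rw [hd, Set.mem_insert_iff, not_or] at hy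
    rw [Function.update_of_ne hy.1, h3 y hy.2]
  · intro c' r' j hj
    have hm : ((c', r', j + 1) : Node l) ∈ diag l (addBox lam c r) := hj
    have hl : ((c', r', j) : Node l) ∈ diag l lam := by
      rw [hd] at hm
      rcases hm with hm | hm
      · rw [hx, Prod.mk.injEq, Prod.mk.injEq] at hm
        obtain ⟨rfl, rfl, h⟩ := hm
        show j < lam c' r'
        omega
      · have : j + 1 < lam c' r' := hm
        show j < lam c' r'
        omega
    rw [hd] at hm
    rcases hm with hm | hm
    · rw [hm, hTx]
      exact hle _ hl
    · rw [hT _ hl, hT _ hm]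
      exact h4 c' r' j hm
  · intro c' r' j hj
    have hm : ((c', r' + 1, j) : Node l) ∈ diag l (addBox lam c r) := hj
    have hl : ((c', r', j) : Node l) ∈ diag l lam := by
      rw [hd] at hm
      rcases hm with hm | hm
      · rw [hx, Prod.mk.injEq, Prod.mk.injEq] at hm
        obtain ⟨rfl, rfl, rfl⟩ := hm
        rcases hr with hr | hr
        · omega
        · exact hr
      · have : j < lam c' (r' + 1) := hm
        exact this.trans_le (hanti c' (show r' ≤ r' + 1 by omega))
    rw [hd] at hm
    rcases hm with hm | hm
    · rw [hm, hTx]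
      exact hle _ hl
    · rw [hT _ hl, hT _ hm]
      exact h5 c' r' j hm

theorem exists_eq_addBox (h : IsStdTab l (n + 1) lam T) :
    ∃ (mu : Fin l → ℕ → ℕ) (c : Fin l) (r : ℕ), CanAdd mu c r ∧ lam = addBox mu c r ∧
      T (c, r, mu c r) = n + 1 ∧ IsStdTab l n mu (Function.update T (c, r, mu c r) 0) := by
  obtain ⟨h1, ⟨h2, h3⟩, h4, h5⟩ := h
  obtain ⟨⟨c, r, j⟩, hx, hTx⟩ := h2.surjOn (show n + 1 ∈ Set.Icc 1 (n + 1) by simp)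
  have hle : ∀ y ∈ diag l lam, T y ≤ n + 1 := fun y hy => (h2.mapsTo hy).2
  have hj : j < lam c r := hx
  have hj1 : lam c r = j + 1 := by
    by_contra hne
    have hj2 : j + 1 < lam c r := by omega
    have := h4 c r j hj2
    have := hle (c, r, j + 1) hj2
    omega
  have hj2 : lam c (r + 1) ≤ j := by
    by_contra hne
    have hj2 : j < lam c (r + 1) := by omega
    have := h5 c r j hj2
    have := hle (c, r + 1, j) hj2
    omega
  set mu : Fin l → ℕ → ℕ := fun c' r' => lam c' r' - if c' = c ∧ r' = r then 1 else 0 with hmu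
  have hmuj : mu c r = j := by simp [hmu, hj1]
  have hlam : lam = addBox mu c r := by
    funext c' r'
    simp only [addBox, hmu]
    split_ifs with e
    · obtain ⟨rfl, rfl⟩ := e
      omega
    · rfl
  have hanti : ∀ c, Antitone (mu c) := by
    intro c'
    refine antitone_nat_of_succ_le fun q => ?_
    have h6 := h1.1 c' (show q ≤ q + 1 by omega)
    simp only [hmu]
    by_cases hc : c' = c ∧ q = r
    · obtain ⟨rfl, rfl⟩ := hc
      simp
      omega
    · rw [if_neg hc]
      exact (Nat.sub_le _ _).trans h6
  have hadd : CanAdd mu c r := by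
    by_cases hr : r = 0
    · exact .inl hr
    · right
      have h6 := h1.1 c (show r - 1 ≤ r by omega)
      rw [hmuj]
      simp only [hmu]
      rw [if_neg (by omega)]
      omega
  rw [hlam] at h1
  have hd := diag_addBox (lam := mu) (c := c) (r := r)
  rw [← hlam, hmuj] at hd
  have hxd : ((c, r, j) : Node l) ∉ diag l mu := by simp [diag, hmuj]
  refine ⟨mu, c, r, hadd, hlam, by rw [hmuj, hTx], ?_⟩
  rw [hmuj]
  have hsub : ∀ y ∈ diag l mu, y ∈ diag l lam := fun y hy => by rw [hd]; exact .inr hy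
  have hT : ∀ y ∈ diag l mu, Function.update T (c, r, j) 0 y = T y := fun y hy =>
    Function.update_of_ne (fun e => hxd (by rwa [e] at hy)) _ _
  refine ⟨isMultipartition_of_addBox h1 hanti, ⟨?_, ?_⟩, ?_, ?_⟩
  · refine Set.BijOn.congr ?_ fun y hy => (hT y hy).symm
    have h7 : diag l mu = diag l lam \ {(c, r, j)} := by
      rw [hd, Set.insert_sdiff_self_of_notMem hxd]
    have h8 : Set.Icc 1 n = Set.Icc 1 (n + 1) \ {n + 1} := by
      ext k
      simp only [Set.mem_Icc, Set.mem_sdiff, Set.mem_singleton_iff]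
      omega
    rw [h7, h8, ← hTx]
    refine ⟨fun y hy => ⟨?_, fun e => hy.2 (h2.injOn hy.1 hx e)⟩, h2.injOn.mono Set.sdiff_subset,
      fun k hk => ?_⟩
    · rw [hTx]
      exact h2.mapsTo hy.1
    · rw [hTx] at hk
      obtain ⟨y, hy, hyk⟩ := h2.surjOn hk.1
      exact ⟨y, ⟨hy, fun e => hk.2 (by rw [← hyk, e, hTx]; rfl)⟩, hyk⟩
  · intro y hy
    by_cases e : y = (c, r, j)
    · rw [e, Function.update_self]
    · rw [Function.update_of_ne e]
      refine h3 y fun h => ?_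
      rw [hd] at h
      exact h.elim e hy
  · intro c' r' q hq
    have hl : ((c', r', q) : Node l) ∈ diag l mu := (Nat.lt_succ_self q).trans hq
    rw [hT _ hl, hT _ hq]
    exact h4 c' r' q (hsub (c', r', q + 1) hq)
  · intro c' r' q hq
    have hl : ((c', r', q) : Node l) ∈ diag l mu :=
      (show q < mu c' (r' + 1) from hq).trans_le (hanti c' (show r' ≤ r' + 1 by omega))
    rw [hT _ hl, hT (c', r' + 1, q) hq]
    exact h5 c' r' q (hsub (c', r' + 1, q) hq)

end tableaux

section correspondence

variable {I : Type} {l : ℕ}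

/-- The labels of `t` record the contents of the nodes of the tableau `T`. -/
def Records (t : ℕ → Lab I l) (n : ℕ) (lam : Fin l → ℕ → ℕ) (T : Node l → ℕ) : Prop :=
  ∀ k < n, ∃ x ∈ diag l lam, T x = k + 1 ∧ t k = .inl (x.1, (x.2.1 : ℤ) - x.2.2)

theorem Records.addBox {t : ℕ → Lab I l} {n : ℕ} {lam : Fin l → ℕ → ℕ} {T T' : Node l → ℕ}
    {c : Fin l} {r : ℕ} (h : Records t n lam T) (hT : ∀ x ∈ diag l lam, T' x = T x)
    (hx : T' (c, r, lam c r) = n + 1) (ht : t n = .inl (c, (r : ℤ) - lam c r)) :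
    Records t (n + 1) (addBox lam c r) T' := by
  intro k hk
  rw [diag_addBox]
  rcases Nat.lt_succ_iff_lt_or_eq.1 hk with hk | rfl
  · obtain ⟨x, hx, h1, h2⟩ := h k hk
    exact ⟨x, .inr hx, by rw [hT x hx, h1], h2⟩
  · exact ⟨_, .inl rfl, hx, ht⟩

theorem isStdTab_zero : IsStdTab l 0 (fun _ _ => 0) (fun _ => 0) := by
  refine ⟨⟨fun _ => antitone_const, by simp, by simp⟩, ⟨?_, fun _ _ => rfl⟩, by simp, by simp⟩
  have h1 : diag l (fun _ _ => 0) = ∅ := by ext x; simp [diag]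
  have h2 : Set.Icc 1 0 = (∅ : Set ℕ) := by simp
  rw [h1, h2]
  exact Set.bijOn_empty _

theorem st_zero_eq_beads (t : ℕ → Lab I l) : st t 0 = beads fun _ _ => 0 := by
  funext a
  rw [beads_zero]
  rfl

theorem exists_tableau {t : ℕ → Lab I l} {n : ℕ} (ht : StdU n t) :
    ∃ (lam : Fin l → ℕ → ℕ) (T : Node l → ℕ),
      IsStdTab l n lam T ∧ st t n = beads lam ∧ Records t n lam T := by
  induction n with
  | zero => exact ⟨_, _, isStdTab_zero, st_zero_eq_beads t, fun k hk => absurd hk k.not_lt_zero⟩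
  | succ n ih =>
    obtain ⟨lam, T, h1, h2, h3⟩ := ih (ht.mono n.le_succ)
    obtain ⟨⟨c, s⟩, ha, hl⟩ := ht n n.lt_succ_self
    rw [h2] at hl
    obtain ⟨r, hr, hadd⟩ := exists_canAdd hl
    obtain rfl : s = r - lam c r := hr
    refine ⟨addBox lam c r, _, isStdTab_addBox h1 (hadd (h1.1.1 c)), ?_, ?_⟩
    · rw [← step_beads (I := I) (h1.1.1 c), ← h2, ← ha]
      rfl
    · refine h3.addBox (fun x hx => Function.update_of_ne ?_ _ _) (Function.update_self _ _ _) ha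
      rintro rfl
      exact lt_irrefl _ (show lam c r < lam c r from hx)

theorem exists_stdU (k₀ : I) {n : ℕ} {lam : Fin l → ℕ → ℕ} {T : Node l → ℕ}
    (h : IsStdTab l n lam T) : ∃ t : ℕ → Lab I l,
      StdU n t ∧ st t n = beads lam ∧ Records t n lam T := by
  induction n generalizing lam T with
  | zero =>
    have h0 : lam = fun _ _ => 0 := by
      funext c r
      by_contra hne
      exact absurd (h.1.2.1 c r hne) r.not_lt_zero
    subst h0
    exact ⟨fun _ => .inr k₀, fun k hk => absurd hk k.not_lt_zero, st_zero_eq_beads _,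
      fun k hk => absurd hk k.not_lt_zero⟩
  | succ n ih =>
    obtain ⟨mu, c, r, h1, rfl, h2, h3⟩ := exists_eq_addBox h
    obtain ⟨t, h4, h5, h6⟩ := ih h3
    set a : Lab I l := .inl (c, (r : ℤ) - mu c r) with ha
    have htt : ∀ q < n, t q = Function.update t n a q := fun q hq =>
      (Function.update_of_ne hq.ne _ _).symm
    have hst : st (Function.update t n a) n = beads mu := by
      rw [← h5]
      exact (st_congr htt).symm
    have ht : Function.update t n a n = a := Function.update_self _ _ _
    refine ⟨Function.update t n a, fun q hq => ?_, ?_, ?_⟩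
    · rcases Nat.lt_succ_iff_lt_or_eq.1 hq with hq | rfl
      · exact h4.congr htt q hq
      · exact ⟨_, ht, by rw [hst]; exact legal_beads (h3.1.1 c) h1⟩
    · rw [← step_beads (I := I) (h3.1.1 c), ← hst]
      show step _ (Function.update t n a n) = _
      rw [ht]
    · refine Records.addBox (T := Function.update T (c, r, mu c r) 0) (fun k hk => ?_)
        (fun x hx => (Function.update_of_ne ?_ _ _).symm) h2 ht
      · rw [← htt k hk]
        exact h6 k hk
      · rintro rfl
        exact lt_irrefl _ (show mu c r < mu c r from hx)

theorem Records.resAt_eq {e n : ℕ} {t : ℕ → Lab (ZMod e) l} {lam : Fin l → ℕ → ℕ}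
    {T : Node l → ℕ} (h : Records t n lam T) (hT : IsStdTab l n lam T) (κ : Fin l → ZMod e)
    {k : ℕ} (hk : k < n) : resAt e κ lam T (k + 1) = resid κ (t k) := by
  obtain ⟨x, hx, hxk, htk⟩ := h k hk
  have hex : ∃ x, x ∈ diag l lam ∧ T x = k + 1 := ⟨x, hx, hxk⟩
  have hc : hex.choose = x :=
    hT.2.1.1.injOn hex.choose_spec.1 hx (by rw [hex.choose_spec.2, hxk])
  rw [resAt, dif_pos hex, hc, htk]
  simp [res, resid]

/-- Residue sequences of standard tableaux are residue sequences of standard words. -/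
theorem exists_std_iff {e n : ℕ} (κ : Fin l → ZMod e) (i : Fin n → ZMod e) :
    (∃ t : ℕ → Lab (ZMod e) l, Std n t ∧ (∀ q ≥ n, t q = .inr 0) ∧
      ∀ k : Fin n, resid κ (t k) = i k) ↔
    ∃ (lam : Fin l → ℕ → ℕ) (T : Node l → ℕ), IsStdTab l n lam T ∧ i = resSeqT e n κ lam T := by
  constructor
  · rintro ⟨t, ht, -, hi⟩
    obtain ⟨lam, T, h1, -, h3⟩ := exists_tableau ht.1
    exact ⟨lam, T, h1, funext fun k => ((h3.resAt_eq h1 κ k.2).trans (hi k)).symm⟩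
  · rintro ⟨lam, T, h1, rfl⟩
    obtain ⟨t, h2, -, h3⟩ := exists_stdU (0 : ZMod e) h1
    refine ⟨fun q => if q < n then t q else .inr 0, ⟨h2.congr fun q hq => (if_pos hq).symm,
      fun q hq => ⟨0, if_neg hq.not_gt⟩⟩, fun q hq => if_neg hq.not_gt, fun k => ?_⟩
    show resid κ (if (k : ℕ) < n then _ else _) = _
    rw [if_pos k.2]
    exact (h3.resAt_eq h1 κ k.2).symm

end correspondence

open Paper (Rel CRel KLR CKLR F fe fy fpsi ae ay ce lo hi swapIdx)

section specialisation

variable {A : Type*} [Ring A] [Algebra O A]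

theorem algebraMap_X_sq_mul (hx : xx A = 0) (c : O) :
    algebraMap O A (Polynomial.X ^ 2 * c) = 0 := by
  have : algebraMap O A Polynomial.X = 0 := hx
  rw [map_mul, map_pow, this, zero_pow two_ne_zero, zero_mul]

theorem cycPoly_eq_pow {I : Type} {l : ℕ} (κ : Fin l → I) (k : I) (y : A) (hx : xx A = 0) :
    cycPoly κ k y = y ^ (Finset.univ.filter fun c : Fin l => κ c = k).card := by
  rw [Finset.card_filter, Fin.sum_univ_def, cycPoly]
  induction List.finRange l with
  | nil => simp
  | cons c L ih =>
    rw [List.map_cons, List.prod_cons, ih, List.map_cons, List.sum_cons, pow_add,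
      algebraMap_X_sq_mul hx, sub_zero]
    split_ifs <;> simp

theorem one_add_one_eq_zero_iff {e : ℕ} (he : e ≠ 1) : (1 : ZMod e) + 1 = 0 ↔ e = 2 := by
  have h := ZMod.natCast_eq_zero_iff 2 e
  rw [one_add_one_eq_two, ← Nat.cast_ofNat (n := 2), h, Nat.dvd_prime Nat.prime_two]
  simp [he]

theorem eq_add_iff {e : ℕ} (he : e ≠ 1) {i j : ZMod e} (h : j = i + 1) : i = j + 1 ↔ e = 2 := by
  rw [← one_add_one_eq_zero_iff he, h, add_assoc]
  simp

theorem Qv_far {I : Type} [CommRing I] {i j : I} (a b : A) (h1 : i ≠ j) (h2 : j ≠ i + 1)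
    (h3 : j ≠ i - 1) : Qv i j a b = 1 := by
  have h4 : i ≠ j + 1 := fun h => h3 (eq_sub_of_add_eq h.symm)
  rw [Qv, if_neg h1, if_neg h2, if_neg h4, one_mul]

variable {e : ℕ} {i j k : ZMod e}

theorem ne_of_eq_add_one (he : e ≠ 1) (h : j = i + 1) : i ≠ j := by
  have : Fact (e ≠ 1) := ⟨he⟩
  have : Nontrivial (ZMod e) := ZMod.nontrivial_iff.2 he
  rintro rfl
  exact one_ne_zero (left_eq_add.1 h)

theorem Qv_up (he : e ≠ 1) (he' : e ≠ 2) (hx : xx A = 0) (a b : A) (h : j = i + 1) :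
    Qv i j a b = b - a := by
  rw [Qv, if_neg (ne_of_eq_add_one he h), if_pos h, if_neg (he' ∘ (eq_add_iff he h).1), mul_one, hx,
    sub_zero]

theorem Qv_down (he : e ≠ 1) (he' : e ≠ 2) (hx : xx A = 0) (a b : A) (h : j = i - 1) :
    Qv i j a b = a - b := by
  have h' : i = j + 1 := by rw [h, sub_add_cancel]
  rw [Qv, if_neg (ne_of_eq_add_one he h').symm, if_pos h', if_neg (he' ∘ (eq_add_iff he h').1),
    one_mul, hx, sub_zero]

theorem Qv_two (he : e = 2) (hx : xx A = 0) (a b : A) (h : j = i + 1) :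
    Qv i j a b = (b - a) * (a - b) := by
  have he1 : e ≠ 1 := by omega
  rw [Qv, if_neg (ne_of_eq_add_one he1 h), if_pos h, if_pos ((eq_add_iff he1 h).2 he), hx,
    sub_zero, sub_zero]

theorem bt_other (a b c : A) (h : ¬ (k = i ∧ (j = i + 1 ∨ j = i - 1))) : bt i j k a b c = 0 := by
  have h' : i = j + 1 → j = i - 1 := fun h => eq_sub_of_add_eq h.symm
  rw [bt]
  split_ifs <;> tauto

theorem bt_plus (he : e ≠ 1) (he' : e ≠ 2) (a b c : A) (hk : k = i) (h : j = i + 1) :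
    bt i j k a b c = 1 := by
  rw [bt, if_pos hk, if_pos h, if_neg (he' ∘ (eq_add_iff he h).1)]

theorem bt_minus (he : e ≠ 1) (he' : e ≠ 2) (a b c : A) (hk : k = i) (h : j = i - 1) :
    bt i j k a b c = -1 := by
  have h' : i = j + 1 := by rw [h, sub_add_cancel]
  rw [bt, if_pos hk, if_neg (he' ∘ (eq_add_iff he h').1), if_pos h']

theorem bt_two (he : e = 2) (a b c : A) (hk : k = i) (h : j = i + 1) :
    bt i j k a b c = a - 2 * b + c := by
  rw [bt, if_pos hk, if_pos h, if_pos ((eq_add_iff (by omega) h).2 he)]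

theorem eq_two_of_eq_sub (he : e = 2) (h : j = i - 1) : j = i + 1 := by
  have h1 := (one_add_one_eq_zero_iff (e := e) (by omega)).2 he
  rw [h, sub_eq_add_neg, neg_eq_of_add_eq_zero_left h1]

end specialisation

section fromKLR

variable {e n : ℕ} {A : Type*} [Ring A]

/-- The extension by zero of a residue sequence. -/
def ext (i : Fin n → ZMod e) (q : ℕ) : ZMod e := if h : q < n then i ⟨q, h⟩ else 0

theorem ext_apply (i : Fin n → ZMod e) (q : Fin n) : ext i q = i q := dif_pos q.2

theorem ext_of_le (i : Fin n → ZMod e) {q : ℕ} (h : n ≤ q) : ext i q = 0 := dif_neg h.not_gt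

theorem ext_restrict {i : ℕ → ZMod e} (h : ∀ q ≥ n, i q = 0) : ext (fun k : Fin n => i k) = i := by
  funext q
  rw [ext]
  split_ifs with hq
  · rfl
  · exact (h q (not_lt.1 hq)).symm

theorem ext_injective : Function.Injective (ext : (Fin n → ZMod e) → ℕ → ZMod e) := by
  intro i j h
  funext k
  rw [← ext_apply i, h, ext_apply]

theorem ext_swapIdx (r : Fin (n - 1)) (i : Fin n → ZMod e) : ext (swapIdx r i) = sw r (ext i) := by
  have hr := r.2
  funext q
  by_cases hq : q < n
  · rw [show ext (swapIdx r i) q = swapIdx r i ⟨q, hq⟩ from ext_apply _ ⟨q, hq⟩, swapIdx, sw,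
      Function.comp_apply, Function.comp_apply, ← ext_apply i]
    congr 1
    simp only [Equiv.swap_apply_def, Fin.ext_iff, lo, hi]
    split_ifs <;> rfl
  · rw [ext_of_le _ (not_lt.1 hq), sw, Function.comp_apply,
      Equiv.swap_apply_of_ne_of_ne (by omega) (by omega), ext_of_le _ (not_lt.1 hq)]

/-- The images of the generators under a homomorphism from the free algebra. -/
def ofHom (φ : F e n →+* A) : G (ZMod e) → A
  | .E i => if ∀ q ≥ n, i q = 0 then φ (fe fun k => i k) else 0
  | .Y r => if h : r < n then φ (fy ⟨r, h⟩) else 0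
  | .P r => if h : r + 1 < n then φ (fpsi ⟨r, by omega⟩) else 0

variable (φ : F e n →+* A)

theorem ofHom_E_ext (i : Fin n → ZMod e) : ofHom φ (.E (ext i)) = φ (fe i) := by
  rw [ofHom, if_pos fun q hq => ext_of_le i hq]
  simp only [ext_apply]

theorem ofHom_Y (r : Fin n) : ofHom φ (.Y r) = φ (fy r) := dif_pos r.2

theorem ofHom_P (r : Fin (n - 1)) : ofHom φ (.P r) = φ (fpsi r) :=
  dif_pos (show (r : ℕ) + 1 < n by have := r.2; omega)

theorem ofHom_E_cases (i : ℕ → ZMod e) :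
    (∃ i' : Fin n → ZMod e, i = ext i') ∨
      ofHom φ (.E i) = 0 ∧ ∀ r, r + 1 < n → ofHom φ (.E (sw r i)) = 0 := by
  by_cases h : ∀ q ≥ n, i q = 0
  · exact .inl ⟨_, (ext_restrict h).symm⟩
  · refine .inr ⟨if_neg h, fun r hr => if_neg fun h' => h fun q hq => ?_⟩
    rw [← h' q hq, sw, Function.comp_apply, Equiv.swap_apply_of_ne_of_ne (by omega) (by omega)]

end fromKLR

theorem val_lo {n : ℕ} (r : Fin (n - 1)) : ((lo r : Fin n) : ℕ) = r := rfl

theorem val_hi {n : ℕ} (r : Fin (n - 1)) : ((hi r : Fin n) : ℕ) = r + 1 := rfl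

section fromKLR

variable {e n : ℕ} {A : Type*} [Ring A] [Algebra O A]

theorem isKLR_ofHom (he : e ≠ 1) (hx : xx A = 0) {φ : F e n →+* A}
    (hφ : ∀ ⦃a b⦄, Rel e n a b → φ a = φ b) : IsKLR n (ofHom φ) where
  EE i := by
    obtain ⟨i, rfl⟩ | ⟨h, -⟩ := ofHom_E_cases φ i
    · simpa [ofHom_E_ext] using hφ (.idem_mul i i)
    · rw [h, zero_mul]
  EE' i j hij := by
    obtain ⟨i, rfl⟩ | ⟨h, -⟩ := ofHom_E_cases φ i
    · obtain ⟨j, rfl⟩ | ⟨h, -⟩ := ofHom_E_cases φ j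
      · have hne : i ≠ j := fun h => hij (by rw [h])
        simpa [ofHom_E_ext, hne] using hφ (.idem_mul i j)
      · rw [h, mul_zero]
    · rw [h, zero_mul]
  YE r i hr := by
    obtain ⟨i, rfl⟩ | ⟨h, -⟩ := ofHom_E_cases φ i
    · simpa [ofHom_E_ext, ← ofHom_Y] using hφ (.dot_idem ⟨r, hr⟩ i)
    · rw [h, zero_mul, mul_zero]
  PE r i hr := by
    obtain ⟨i, rfl⟩ | ⟨h, h'⟩ := ofHom_E_cases φ i
    · have := hφ (.cross_idem ⟨r, by omega⟩ i)
      rw [map_mul, map_mul, ← ofHom_E_ext, ← ofHom_E_ext, ← ofHom_P, ext_swapIdx] at this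
      exact this
    · rw [h, h' r hr, zero_mul, mul_zero]
  YY r s hr hs := by
    simpa [← ofHom_Y] using hφ (.dot_dot ⟨r, hr⟩ ⟨s, hs⟩)
  PY r s hr hs h1 h2 := by
    have := hφ (.cross_dot ⟨r, by omega⟩ ⟨s, hs⟩ (by simpa [lo] using h1) (by simpa [hi] using h2))
    simpa [← ofHom_Y, ← ofHom_P] using this
  PP r s h1 h2 := by
    simpa [← ofHom_P] using hφ (.cross_cross ⟨r, by omega⟩ ⟨s, by omega⟩ (.inl h1))
  PYh r i hr := by
    obtain ⟨i, rfl⟩ | ⟨h, -⟩ := ofHom_E_cases φ i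
    · have := hφ (.cross_dot_hi ⟨r, by omega⟩ i)
      rw [← ext_apply i, ← ext_apply i] at this
      simp only [map_mul, map_add, ← ofHom_P, ← ofHom_Y, ← ofHom_E_ext, apply_ite φ, map_one,
        map_zero] at this
      convert this <;> rfl
    · rw [h, mul_zero, mul_zero]
  YPh r i hr := by
    obtain ⟨i, rfl⟩ | ⟨h, -⟩ := ofHom_E_cases φ i
    · have := hφ (.dot_cross ⟨r, by omega⟩ i)
      rw [← ext_apply i, ← ext_apply i] at this
      simp only [map_mul, map_add, ← ofHom_P, ← ofHom_Y, ← ofHom_E_ext, apply_ite φ, map_one,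
        map_zero] at this
      convert this <;> rfl
    · rw [h, mul_zero, mul_zero]
  sq r i hr := by
    obtain ⟨i, rfl⟩ | ⟨h, -⟩ := ofHom_E_cases φ i
    · set s : Fin (n - 1) := ⟨r, by omega⟩
      have hl : ext i r = i (lo s) := ext_apply i (lo s)
      have hh : ext i (r + 1) = i (hi s) := ext_apply i (hi s)
      have hp : ofHom φ (.P r) = φ (fpsi s) := ofHom_P φ s
      have hyl : ofHom φ (.Y r) = φ (fy (lo s)) := ofHom_Y φ (lo s)
      have hyh : ofHom φ (.Y (r + 1)) = φ (fy (hi s)) := ofHom_Y φ (hi s)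
      rw [hl, hh, hp, hyl, hyh, ofHom_E_ext]
      by_cases h1 : i (lo s) = i (hi s)
      · simpa [Qv, h1] using hφ (.cross_sq_eq s i h1)
      by_cases he2 : e = 2
      · by_cases h2 : i (hi s) = i (lo s) + 1
        · rw [Qv_two he2 hx _ _ h2]
          simpa using hφ (.cross_sq_two s i he2 h2)
        · have h3 : i (hi s) ≠ i (lo s) - 1 := fun h => h2 (eq_two_of_eq_sub he2 h)
          rw [Qv_far _ _ h1 h2 h3]
          simpa using hφ (.cross_sq_far s i h1 h2 h3)
      · by_cases h2 : i (hi s) = i (lo s) + 1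
        · rw [Qv_up he he2 hx _ _ h2]
          simpa using hφ (.cross_sq_up s i he2 h2)
        · by_cases h3 : i (hi s) = i (lo s) - 1
          · rw [Qv_down he he2 hx _ _ h3]
            simpa using hφ (.cross_sq_down s i he2 h3)
          · rw [Qv_far _ _ h1 h2 h3]
            simpa using hφ (.cross_sq_far s i h1 h2 h3)
    · rw [h, mul_zero, mul_zero]
  br r i hr := by
    obtain ⟨i, rfl⟩ | ⟨h, -⟩ := ofHom_E_cases φ i
    · set s : Fin (n - 1) := ⟨r, by omega⟩
      set t : Fin (n - 1) := ⟨r + 1, by omega⟩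
      have ht : t.1 = s.1 + 1 := rfl
      have hl : ext i r = i (lo s) := ext_apply i (lo s)
      have hh : ext i (r + 1) = i (hi s) := ext_apply i (hi s)
      have hh2 : ext i (r + 2) = i (hi t) := ext_apply i (hi t)
      have hp : ofHom φ (.P r) = φ (fpsi s) := ofHom_P φ s
      have hp' : ofHom φ (.P (r + 1)) = φ (fpsi t) := ofHom_P φ t
      have hyl : ofHom φ (.Y r) = φ (fy (lo s)) := ofHom_Y φ (lo s)
      have hyh : ofHom φ (.Y (r + 1)) = φ (fy (hi s)) := ofHom_Y φ (hi s)
      have hyh2 : ofHom φ (.Y (r + 2)) = φ (fy (hi t)) := ofHom_Y φ (hi t)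
      rw [hl, hh, hh2, hp, hp', hyl, hyh, hyh2, ofHom_E_ext]
      by_cases h1 : i (hi t) = i (lo s) ∧ (i (hi s) = i (lo s) + 1 ∨ i (hi s) = i (lo s) - 1)
      · obtain ⟨h1, h2⟩ := h1
        by_cases he2 : e = 2
        · have h3 : i (hi s) = i (lo s) + 1 := h2.elim id (eq_two_of_eq_sub he2)
          rw [bt_two he2 _ _ _ h1 h3]
          have := hφ (.braid_two s t ht i he2 h1 h3)
          simp only [map_mul, map_add, map_sub, map_ofNat] at this
          rw [this]
          congr 1
          abel
        · rcases h2 with h2 | h2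
          · rw [bt_plus he he2 _ _ _ h1 h2]
            simpa using hφ (.braid_plus s t ht i he2 h1 h2)
          · rw [bt_minus he he2 _ _ _ h1 h2, ← sub_eq_add_neg]
            simpa using hφ (.braid_minus s t ht i he2 h1 h2)
      · rw [bt_other _ _ _ h1, add_zero]
        simpa using hφ (.braid_other s t ht i h1)
    · rw [h, mul_zero, mul_zero]

variable {l : ℕ} {κ : Fin l → ZMod e}

theorem isCyc_ofHom (hx : xx A = 0) {φ : F e n →+* A} (hn : 0 < n)
    (hφ : ∀ i : Fin n → ZMod e, φ (fe i) *
      φ (fy ⟨0, hn⟩) ^ (Finset.univ.filter fun c : Fin l => κ c = i ⟨0, hn⟩).card = 0) :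
    IsCyc κ (ofHom φ) := by
  intro i
  obtain ⟨i, rfl⟩ | ⟨h, -⟩ := ofHom_E_cases φ i
  · rw [ofHom_E_ext, cycPoly_eq_pow _ _ _ hx, show ext i 0 = i ⟨0, hn⟩ from ext_apply i ⟨0, hn⟩,
      show ofHom φ (.Y 0) = φ (fy ⟨0, hn⟩) from ofHom_Y φ ⟨0, hn⟩]
    convert hφ i
  · rw [h, zero_mul]

end fromKLR

section toKLR

variable {e n : ℕ} {A : Type*} [Ring A] [Algebra O A] (D : G (ZMod e) → A)

/-- The homomorphism from the free algebra determined by the images of the generators. -/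
def toHom : F e n →+* A :=
  (FreeAlgebra.lift ℤ fun g : Paper.Gen e n => match g with
    | .idem i => D (.E (ext i))
    | .dot r => D (.Y r)
    | .cross r => D (.P r) : F e n →ₐ[ℤ] A).toRingHom

theorem toHom_fe (i : Fin n → ZMod e) : toHom D (fe i) = D (.E (ext i)) :=
  FreeAlgebra.lift_ι_apply _ _

theorem toHom_fy (r : Fin n) : toHom (e := e) D (fy r) = D (.Y r) :=
  FreeAlgebra.lift_ι_apply _ _

theorem toHom_fpsi (r : Fin (n - 1)) : toHom (e := e) D (fpsi r) = D (.P r) :=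
  FreeAlgebra.lift_ι_apply _ _

variable {D}

theorem toHom_rel (he : e ≠ 1) (hx : xx A = 0) (hD : IsKLR n D)
    (hS : ∀ S : Finset (Fin n → ZMod e), (∀ i, i ∈ S) → ∑ i ∈ S, D (.E (ext i)) = 1)
    ⦃a b : F e n⦄ (h : Rel e n a b) : toHom D a = toHom D b := by
  have hlt : ∀ r : Fin (n - 1), (r : ℕ) + 1 < n := fun r => by have := r.2; omega
  have hl : ∀ (i : Fin n → ZMod e) (r : Fin (n - 1)), i (lo r) = ext i r :=
    fun i r => (ext_apply i (lo r)).symm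
  have hh : ∀ (i : Fin n → ZMod e) (r : Fin (n - 1)), i (hi r) = ext i (r + 1) :=
    fun i r => (ext_apply i (hi r)).symm
  cases h with
  | idem_mul i j =>
    rw [map_mul, toHom_fe, toHom_fe]
    split_ifs with h
    · rw [h, hD.EE, toHom_fe]
    · rw [hD.EE' _ _ fun h' => h (ext_injective h'), map_zero]
  | idem_sum S h =>
    rw [map_sum, map_one, ← hS S h]
    exact Finset.sum_congr rfl fun i _ => toHom_fe D i
  | dot_idem k i =>
    simp only [map_mul, toHom_fe, toHom_fy]
    exact hD.YE _ _ k.2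
  | cross_idem r i =>
    simp only [map_mul, toHom_fe, toHom_fpsi, ext_swapIdx]
    exact hD.PE _ _ (hlt r)
  | dot_dot k m =>
    simp only [map_mul, toHom_fy]
    exact hD.YY _ _ k.2 m.2
  | cross_dot r k h1 h2 =>
    simp only [map_mul, toHom_fy, toHom_fpsi]
    exact hD.PY _ _ (hlt r) k.2 (fun h => h1 (Fin.ext h)) (fun h => h2 (Fin.ext h))
  | cross_cross r t h =>
    simp only [map_mul, toHom_fpsi]
    rcases h with h | h
    · exact hD.PP _ _ h (hlt t)
    · exact (hD.PP _ _ h (hlt r)).symm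
  | cross_dot_hi r i =>
    simp only [map_mul, map_add, toHom_fe, toHom_fy, toHom_fpsi, apply_ite (toHom D), map_one,
      map_zero, hl, hh, val_lo, val_hi]
    convert hD.PYh r (ext i) (hlt r)
  | dot_cross r i =>
    simp only [map_mul, map_add, toHom_fe, toHom_fy, toHom_fpsi, apply_ite (toHom D), map_one,
      map_zero, hl, hh, val_lo, val_hi]
    convert hD.YPh r (ext i) (hlt r)
  | cross_sq_eq r i h =>
    have h1 := hD.sq r (ext i) (hlt r)
    rw [← hl, ← hh, h, Qv, if_pos rfl, zero_mul] at h1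
    simpa only [map_mul, toHom_fe, toHom_fpsi, map_zero] using h1
  | cross_sq_far r i h1 h2 h3 =>
    have h4 := hD.sq r (ext i) (hlt r)
    rw [← hl, ← hh, Qv_far _ _ h1 h2 h3, one_mul] at h4
    simpa only [map_mul, toHom_fe, toHom_fpsi] using h4
  | cross_sq_up r i he' h =>
    have h4 := hD.sq r (ext i) (hlt r)
    rw [← hl, ← hh, Qv_up he he' hx _ _ h] at h4
    simp only [map_mul, map_sub, toHom_fe, toHom_fpsi, toHom_fy]
    exact h4
  | cross_sq_down r i he' h =>
    have h4 := hD.sq r (ext i) (hlt r)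
    rw [← hl, ← hh, Qv_down he he' hx _ _ h] at h4
    simp only [map_mul, map_sub, toHom_fe, toHom_fpsi, toHom_fy]
    exact h4
  | cross_sq_two r i he' h =>
    have h4 := hD.sq r (ext i) (hlt r)
    rw [← hl, ← hh, Qv_two he' hx _ _ h] at h4
    simp only [map_mul, map_sub, toHom_fe, toHom_fpsi, toHom_fy]
    exact h4
  | braid_other r t ht i h =>
    have h4 := hD.br r (ext i) (by have := t.2; omega)
    rw [← hl, ← hh, show (r : ℕ) + 2 = t + 1 by omega, ← hh, bt_other _ _ _ h, add_zero, ← ht] at h4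
    simp only [map_mul, toHom_fe, toHom_fpsi]
    exact h4
  | braid_plus r t ht i he' h1 h2 =>
    have h4 := hD.br r (ext i) (by have := t.2; omega)
    rw [← hl, ← hh, show (r : ℕ) + 2 = t + 1 by omega, ← hh, bt_plus he he' _ _ _ h1 h2, ← ht] at h4
    simp only [map_mul, map_add, map_one, toHom_fe, toHom_fpsi]
    exact h4
  | braid_minus r t ht i he' h1 h2 =>
    have h4 := hD.br r (ext i) (by have := t.2; omega)
    rw [← hl, ← hh, show (r : ℕ) + 2 = t + 1 by omega, ← hh, bt_minus he he' _ _ _ h1 h2, ← ht,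
      ← sub_eq_add_neg] at h4
    simp only [map_mul, map_sub, map_one, toHom_fe, toHom_fpsi]
    exact h4
  | braid_two r t ht i he' h1 h2 =>
    have h4 := hD.br r (ext i) (by have := t.2; omega)
    rw [← hl, ← hh, show (r : ℕ) + 2 = t + 1 by omega, ← hh, bt_two he' _ _ _ h1 h2, ← ht] at h4
    simp only [map_mul, map_add, map_sub, map_ofNat, toHom_fe, toHom_fpsi, toHom_fy]
    refine h4.trans ?_
    congr 1
    rw [val_lo, val_hi, val_hi, ← ht]
    abel

end toKLR

/-- The base field of the seminormal representations. -/
abbrev FracO := FractionRing O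

/-- The extension by a transcendental element. -/
abbrev FracOT := FractionRing (Polynomial FracO)

instance : Setup FracO FracOT where
  inj := IsFractionRing.injective O FracO
  τ := algebraMap (Polynomial FracO) FracOT Polynomial.X
  trans := (transcendental_algebraMap_iff (IsFractionRing.injective _ _)).2
    (Polynomial.transcendental_X FracO)

section main

variable {e n : ℕ} {Λ : ZMod e →₀ ℕ} {l : ℕ} {κ : Fin l → ZMod e}

/-- The projection of the free algebra onto the cyclotomic KLR algebra. -/
def proj (e n : ℕ) (Λ : ZMod e →₀ ℕ) : F e n →+* CKLR e n Λ :=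
  (RingQuot.mkRingHom (CRel e n Λ)).comp (RingQuot.mkRingHom (Rel e n))

theorem exists_std_of_ce_ne_zero (he : e ≠ 1)
    (hκ : ∀ i : ZMod e, Λ i = (Finset.univ.filter fun c : Fin l => κ c = i).card)
    {i : Fin n → ZMod e} (hi : ce e n Λ i ≠ 0) :
    ∃ t : ℕ → Lab (ZMod e) l, Std n t ∧ (∀ q ≥ n, t q = .inr 0) ∧
      ∀ k : Fin n, resid κ (t k) = i k := by
  rcases n.eq_zero_or_pos with rfl | hn
  · exact ⟨fun _ => .inr 0, ⟨fun q hq => absurd hq q.not_lt_zero, fun q _ => ⟨0, rfl⟩⟩,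
      fun _ _ => rfl, fun k => k.elim0⟩
  have : Nontrivial (ZMod e) := ZMod.nontrivial_iff.2 he
  let _ : Algebra O (CKLR e n Λ) := RingHom.toAlgebra'
    ((Int.castRingHom (CKLR e n Λ)).comp (Polynomial.evalRingHom 0))
    fun c x => Int.cast_commute _ x
  have hx : xx (CKLR e n Λ) = 0 := by
    show Int.castRingHom (CKLR e n Λ) (Polynomial.eval 0 Polynomial.X) = 0
    rw [Polynomial.eval_X, map_zero]
  have hK : IsKLR n (ofHom (proj e n Λ)) := isKLR_ofHom he hx fun a b h => by
    rw [proj, RingHom.comp_apply, RingQuot.mkRingHom_rel h, RingHom.comp_apply]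
  have hC : IsCyc κ (ofHom (proj e n Λ)) := isCyc_ofHom hx hn fun i => by
    have := RingQuot.mkRingHom_rel (CRel.cyc (Λ := Λ) i hn)
    rw [map_mul, map_pow, map_zero, hκ] at this
    convert this <;> rfl
  by_contra hno
  refine hi ?_
  have := detects (κ := κ) (K := FracO) (L := FracOT) n _ _ hK hC (ext i) 1 (one_mem _) ?_
  · rwa [map_one, one_mul, ofHom_E_ext] at this
  · intro t ht hti
    refine absurd ⟨t, ht, fun q hq => ?_, fun k => ?_⟩ hno
    · obtain ⟨k, hk⟩ := ht.2 q hq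
      have := congrFun hti q
      rw [Function.comp_apply, hk, ext_of_le i hq] at this
      rw [hk, ← this]
      rfl
    · rw [← ext_apply i, ← hti]
      rfl

theorem ce_ne_zero_of_exists_std (he : e ≠ 1)
    (hκ : ∀ i : ZMod e, Λ i = (Finset.univ.filter fun c : Fin l => κ c = i).card)
    {i : Fin n → ZMod e}
    (hi : ∃ t : ℕ → Lab (ZMod e) l, Std n t ∧ (∀ q ≥ n, t q = .inr 0) ∧
      ∀ k : Fin n, resid κ (t k) = i k) : ce e n Λ i ≠ 0 := by
  obtain ⟨t, ht, htail, hti⟩ := hi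
  have : Nontrivial (ZMod e) := ZMod.nontrivial_iff.2 he
  have hres : resid κ ∘ t = ext i := by
    funext q
    by_cases hq : q < n
    · exact (hti ⟨q, hq⟩).trans (ext_apply i ⟨q, hq⟩).symm
    · rw [Function.comp_apply, htail q (not_lt.1 hq), ext_of_le i (not_lt.1 hq)]
      rfl
  obtain ⟨A, _, _, D, hK, hC, hx, hne, hS⟩ := exists_reduction κ FracO FracOT ht
  rw [hres] at hne
  have hrel := toHom_rel he hx hK fun S h => by
    rw [← hS (S.image ext) fun j hj => ?_, Finset.sum_image fun a _ b _ h => ext_injective h]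
    refine Finset.mem_image.2 ⟨_, h _, ext_restrict fun q hq => ?_⟩
    rw [hj q hq, htail q hq]
    rfl
  set f : KLR e n →+* A := RingQuot.lift ⟨toHom D, hrel⟩ with hf
  have hfa : ∀ x, f (RingQuot.mkRingHom (Rel e n) x) = toHom D x :=
    fun x => RingQuot.lift_mkRingHom_apply _ hrel x
  have hcrel : ∀ ⦃a b⦄, CRel e n Λ a b → f a = f b := by
    rintro _ _ ⟨i, hn⟩
    have h := hC hn (ext i)
    rw [cycPoly_eq_pow _ _ _ hx, show ext i 0 = i ⟨0, hn⟩ from ext_apply i ⟨0, hn⟩] at h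
    rw [map_mul, map_pow, map_zero, ae, ay, hfa, hfa, toHom_fe, toHom_fy, hκ]
    convert h
  intro h0
  have h := RingQuot.lift_mkRingHom_apply f hcrel (ae e n i)
  rw [show RingQuot.mkRingHom (CRel e n Λ) (ae e n i) = 0 from h0, map_zero, ae, hfa, toHom_fe] at h
  exact hne h.symm

end main

end DefKLR
end

namespace Paper

/-!
STATEMENT 8: in the cyclotomic KLR algebra `R^Λ_n` over ℤ (with `Λ` of level `ℓ` and
multicharge `κ`), the idempotent `e(i)` (for `i ∈ I^n`) is nonzero if and only if `i`
is the residue sequence of some standard `λ`-tableau, `λ ∈ P^Λ_n`.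
-/
theorem statement8 (e n : ℕ) (he : e ≠ 1) (Λ : ZMod e →₀ ℕ) (ℓ : ℕ)
    (hlev : Λ.sum (fun _ m => m) = ℓ) (κ : Fin ℓ → ZMod e)
    (hκ : ∀ i : ZMod e, Λ i = (Finset.univ.filter fun c : Fin ℓ => κ c = i).card)
    (i : Fin n → ZMod e) :
    ce e n Λ i ≠ 0 ↔
      ∃ (lam : Fin ℓ → ℕ → ℕ) (T : Node ℓ → ℕ),
        IsStdTab ℓ n lam T ∧ i = resSeqT e n κ lam T := by
  rw [← DefKLR.exists_std_iff κ i]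
  exact ⟨DefKLR.exists_std_of_ce_ne_zero he hκ,
    DefKLR.ce_ne_zero_of_exists_std he hκ⟩

end Paper
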